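/- arXiv:1110.5942 — 2 statements merged into one kernel-verified Lean document; each statement's English description precedes it below -/
import Mathlib

section
/- There exists a constant c > 0 such that for every nondeterministic Streett automaton A with n ≥ 2 states and any index size k ≥ 1, there exists a deterministic Rabin automaton B over the same alphabet with L(B) = L(A), whose number of states is at most 2^{c·n²·log₂ n} and whose index size is at most n·(min(n,k)+1). -/
/-- The set of states occurring infinitely often in an infinite run. -/
def InfStates {Q : Type*} (ρ : ℕ → Q) : Set Q :=
  {q | ∀ N : ℕ, ∃ m : ℕ, N ≤ m ∧ ρ m = q}

open Classical in
/-- Abstract commitment system. -/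
structure CSys (Q : Type) where
  D : ℕ
  act : Set Q → ℕ → Prop
  P : Set Q → ℕ → Set Q
  nx : Set Q → ℕ → Set Q
  mu : Set Q → ℕ
  good : Set Q → Prop
  act0 : ∀ J, ¬ act J 0
  actD : ∀ J j, act J j → j ≤ D
  P0 : ∀ J, P J 0 = ∅
  nx0 : ∀ J, nx J 0 = J
  mu_lt : ∀ J j, act J j → mu (nx J j) < mu J
  mu_univ : mu Set.univ ≤ D
  sound : ∀ J S, S ⊆ J → (∀ j, act J j → (S ∩ P J j).Nonempty) → good S
  complete : ∀ J S j, S ⊆ J → good S → act J j → S ∩ P J j = ∅ → S ⊆ nx J j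

abbrev SPath := List (ℕ × ℕ)

def SLe (x y : SPath) : Prop := x.map toLex ≤ y.map toLex

theorem SLe_append (p x y : SPath) (h : SLe (p ++ x) (p ++ y)) : SLe x y := by
  unfold SLe at *
  induction p with
  | nil => exact h
  | cons a p ih =>
    apply ih
    rw [← not_lt] at *
    intro h2
    apply h
    simp only [List.cons_append, List.map_cons]
    rw [List.cons_lt_cons_iff]
    exact Or.inr ⟨rfl, h2⟩

theorem SLe_cons (a b : ℕ × ℕ) (x y : SPath) (h : SLe (a::x) (b::y)) :
    a.1 < b.1 ∨ a.1 = b.1 ∧ a.2 ≤ b.2 := by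
  unfold SLe at *
  rw [← not_lt] at h
  simp only [List.map_cons] at h
  rw [List.cons_lt_cons_iff] at h
  simp only [Prod.Lex.toLex_lt_toLex] at h
  push Not at h
  rcases lt_trichotomy a.1 b.1 with h1 | h1 | h1
  · exact Or.inl h1
  · exact Or.inr ⟨h1, h.1.2 h1.symm⟩
  · exact absurd h.1.1 (by omega)

namespace CSys

variable {Q : Type} (C : CSys Q)

open Classical in
noncomputable def nextLab (J : Set Q) : ℕ → ℕ
  | 0 => 0
  | m+1 => if C.act J m then m else nextLab J m

theorem nextLab_act (J : Set Q) (m : ℕ) : C.nextLab J m = 0 ∨ C.act J (C.nextLab J m) := by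
  induction m with
  | zero => left; rfl
  | succ m ih =>
    unfold nextLab
    split_ifs with h
    · exact Or.inr h
    · exact ih

theorem nextLab_lt (J : Set Q) (m : ℕ) (hm : 0 < m) : C.nextLab J m < m := by
  induction m with
  | zero => omega
  | succ m ih =>
    unfold nextLab
    split_ifs with h
    · omega
    · rcases Nat.eq_zero_or_pos m with rfl | h
      · simp [nextLab]
      · have := ih h; omega

theorem nextLab_between (J : Set Q) (m j : ℕ) (h1 : C.nextLab J m < j) (h2 : j < m) :
    ¬ C.act J j := by
  induction m with
  | zero => omega
  | succ m ih =>
    unfold nextLab at h1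
    split_ifs at h1 with h
    · omega
    · rcases Nat.lt_succ_iff_lt_or_eq.mp h2 with h3 | rfl
      · exact ih h1 h3
      · exact h

def commit (J : Set Q) : SPath → Set Q
  | [] => J
  | a :: x => commit (C.nx J a.1) x

theorem commit_append (J : Set Q) (x y : SPath) :
    C.commit J (x ++ y) = C.commit (C.commit J x) y := by
  induction x generalizing J with
  | nil => rfl
  | cons a x ih => simp [commit, ih]

theorem commit_map (J : Set Q) (φ : ℕ → ℕ) (x : SPath) :
    C.commit J (x.map (Prod.map id φ)) = C.commit J x := by
  induction x generalizing J with
  | nil => rfl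
  | cons a x ih => simp [commit, ih]

open Classical in
noncomputable def upd (F : ℕ) (q : Q) (J : Set Q) : SPath → SPath
  | [] => [(C.nextLab J (C.D+1), F)]
  | a :: x =>
    if q ∈ C.P J a.1 then [(C.nextLab J a.1, F)]
    else if q ∈ C.nx J a.1 then a :: upd F q (C.nx J a.1) x
    else [(a.1, F)]

def pass (q : Q) (J : Set Q) : SPath → Prop
  | [] => True
  | a :: x => q ∉ C.P J a.1 ∧ q ∈ C.nx J a.1 ∧ pass q (C.nx J a.1) x

theorem upd_pass (F : ℕ) (q : Q) (J : Set Q) (s y : SPath) (h : C.pass q J s) :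
    C.upd F q J (s ++ y) = s ++ C.upd F q (C.commit J s) y := by
  induction s generalizing J with
  | nil => rfl
  | cons a s ih =>
    obtain ⟨h1, h2, h3⟩ := h
    simp [upd, commit, h1, h2, ih _ h3]

theorem pass_of_upd (F : ℕ) (q : Q) (J : Set Q) (x s z : SPath) (hs : ∀ a ∈ s, a.2 ≠ F)
    (h : C.upd F q J x = s ++ z) :
    ∃ y, x = s ++ y ∧ C.pass q J s ∧ C.upd F q (C.commit J s) y = z := by
  induction s generalizing J x with
  | nil => exact ⟨x, rfl, trivial, h⟩
  | cons a s ih =>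
    cases x with
    | nil =>
      simp [upd] at h
      have := hs a (by simp)
      rw [← h.1] at this
      simp at this
    | cons b x =>
      have ha := hs a (by simp)
      unfold upd at h
      split_ifs at h with h1 h2
      · simp at h; rw [← h.1] at ha; simp at ha
      rotate_left
      · simp at h; rw [← h.1] at ha; simp at ha
      · simp only [List.cons_append, List.cons.injEq] at h
        obtain ⟨rfl, h⟩ := h
        obtain ⟨y, rfl, h3, h4⟩ := ih (C.nx J b.1) x (fun a ha => hs a (by simp [ha])) h
        refine ⟨y, rfl, ⟨h1, h2, h3⟩, h4⟩

theorem pass_mem (q : Q) (J : Set Q) (s : SPath) (hq : q ∈ J) (h : C.pass q J s) :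
    q ∈ C.commit J s := by
  induction s generalizing J with
  | nil => exact hq
  | cons a s ih => exact ih _ h.2.1 h.2.2

def labOK (J : Set Q) (x : SPath) : Prop :=
  ∀ s a y, x = s ++ a :: y → a.1 = 0 ∨ C.act (C.commit J s) a.1

theorem upd_form (F : ℕ) (q : Q) (J : Set Q) (x : SPath) (hx : C.labOK J x) :
    ∃ s y l, x = s ++ y ∧ C.upd F q J x = s ++ [(l, F)] ∧ (l = 0 ∨ C.act (C.commit J s) l) := by
  induction x generalizing J with
  | nil => exact ⟨[], [], _, rfl, rfl, C.nextLab_act _ _⟩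
  | cons a x ih =>
    unfold upd
    split_ifs with h1 h2
    · exact ⟨[], _, _, rfl, rfl, C.nextLab_act _ _⟩
    rotate_left
    · exact ⟨[], _, _, rfl, rfl, hx [] a x rfl⟩
    · obtain ⟨s, y, l, rfl, h3, h4⟩ := ih (C.nx J a.1) (by
        intro s b y e
        exact hx (a :: s) b y (by simp [e]))
      exact ⟨a :: s, y, l, rfl, by simp [h3], h4⟩

theorem upd_ne_nil (F : ℕ) (q : Q) (J : Set Q) (x : SPath) : C.upd F q J x ≠ [] := by
  cases x with
  | nil => simp [upd]
  | cons a x => unfold upd; split_ifs <;> simp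

end CSys
abbrev Mac (Q : Type) := Q → Option SPath

structure PreInv {Q : Type} (C : CSys Q) (f : Mac Q) : Prop where
  lab : ∀ q x, f q = some x → C.labOK Set.univ x
  uniq : ∀ q q' s s' l l' i y y', f q = some (s ++ (l,i) :: y) → f q' = some (s' ++ (l',i) :: y') →
    s = s' ∧ l = l'
  inc : ∀ q x, f q = some x → (0 :: x.map Prod.snd).Pairwise (· < ·)
  fl : ∀ q q' s y, f q = some s → f q' = some (s ++ y) → y = []

structure MInv {Q : Type} (C : CSys Q) (f : Mac Q) : Prop extends PreInv C f where
  nd : ∀ q s a y, f q = some (s ++ a :: y) → ∃ q' b y', f q' = some (s ++ b :: y') ∧ b.1 ≠ 0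

theorem snoc_eq_append_cons {α : Type*} (s s1 y1 : List α) (a b : α) (h : s ++ [b] = s1 ++ a :: y1) :
    (s1 = s ∧ a = b ∧ y1 = []) ∨ ∃ y2, s = s1 ++ a :: y2 ∧ y1 = y2 ++ [b] := by
  rcases List.eq_nil_or_concat y1 with rfl | ⟨y2, c, rfl⟩
  · left
    have := List.append_inj' h rfl
    simp at this
    exact ⟨this.1.symm, this.2.symm, rfl⟩
  · right
    have h' : s ++ [b] = (s1 ++ a :: y2) ++ [c] := by simpa using h
    have := List.append_inj' h' rfl
    simp at this
    refine ⟨y2, this.1, by simp [this.2]⟩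

section Step
variable {Q : Type} (C : CSys Q) (N : ℕ) (idx : Q → ℕ)

open Classical in
noncomputable def prd (f : Mac Q) (R : Q → Q → Prop) (q' : Q) : Q :=
  if h : ∃ q, (f q).isSome ∧ R q q' ∧ ∀ q2, (f q2).isSome → R q2 q' →
      SLe (C.upd (N + idx q') q' Set.univ ((f q).getD []))
        (C.upd (N + idx q') q' Set.univ ((f q2).getD [])) then h.choose else q'

open Classical in
noncomputable def stepH (f : Mac Q) (R : Q → Q → Prop) : Mac Q := fun q' =>
  if ∃ q, (f q).isSome ∧ R q q' then
    some (C.upd (N + idx q') q' Set.univ ((f (prd C N idx f R q')).getD [])) else none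

theorem prd_spec [Fintype Q] (f : Mac Q) (R : Q → Q → Prop) (q' : Q)
    (h : ∃ q, (f q).isSome ∧ R q q') :
    (f (prd C N idx f R q')).isSome ∧ R (prd C N idx f R q') q' ∧
    ∀ q2, (f q2).isSome → R q2 q' →
      SLe (C.upd (N + idx q') q' Set.univ ((f (prd C N idx f R q')).getD []))
        (C.upd (N + idx q') q' Set.univ ((f q2).getD [])) := by
  classical
  have h' : ∃ q, (f q).isSome ∧ R q q' ∧ ∀ q2, (f q2).isSome → R q2 q' →
      SLe (C.upd (N + idx q') q' Set.univ ((f q).getD []))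
        (C.upd (N + idx q') q' Set.univ ((f q2).getD [])) := by
    obtain ⟨q, hq, hm⟩ := Finset.exists_min_image
      (Finset.univ.filter fun q => (f q).isSome ∧ R q q')
      (fun q => (C.upd (N + idx q') q' Set.univ ((f q).getD [])).map toLex)
      (by obtain ⟨q, hq⟩ := h; exact ⟨q, by simpa using hq⟩)
    simp only [Finset.mem_filter, Finset.mem_univ, true_and] at hq hm
    exact ⟨q, hq.1, hq.2, fun q2 h1 h2 => hm q2 ⟨h1, h2⟩⟩
  unfold prd
  rw [dif_pos h']
  exact h'.choose_spec

theorem stepH_some [Fintype Q] {f : Mac Q} {R : Q → Q → Prop} {q' : Q} {z : SPath}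
    (h : stepH C N idx f R q' = some z) :
    ∃ x, f (prd C N idx f R q') = some x ∧ R (prd C N idx f R q') q' ∧
      z = C.upd (N + idx q') q' Set.univ x ∧
      ∀ q2 x2, f q2 = some x2 → R q2 q' → SLe z (C.upd (N + idx q') q' Set.univ x2) := by
  unfold stepH at h
  split_ifs at h with hc
  obtain ⟨h1, h2, h3⟩ := prd_spec C N idx f R q' hc
  obtain ⟨x, hx⟩ := Option.isSome_iff_exists.mp h1
  refine ⟨x, hx, h2, ?_, ?_⟩
  · simpa [hx] using h.symm
  · intro q2 x2 h4 h5
    have := h3 q2 (by simp [h4]) h5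
    simp only [Option.some.injEq] at h
    rw [h, h4] at this
    exact this

theorem stepH_isSome {f : Mac Q} {R : Q → Q → Prop} {q q' : Q} {x : SPath}
    (hx : f q = some x) (hR : R q q') : ∃ z, stepH C N idx f R q' = some z := by
  unfold stepH
  rw [if_pos ⟨q, by simp [hx], hR⟩]
  exact ⟨_, rfl⟩

def IdsLt (N : ℕ) (f : Mac Q) : Prop := ∀ q x, f q = some x → ∀ a ∈ x, a.2 < N

theorem stepH_form [Fintype Q] {f : Mac Q} (hf : PreInv C f) {R : Q → Q → Prop}
    {q' : Q} {z : SPath} (h : stepH C N idx f R q' = some z) :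
    ∃ q s y l, f q = some (s ++ y) ∧ z = s ++ [(l, N + idx q')] ∧
      (l = 0 ∨ C.act (C.commit Set.univ s) l) := by
  obtain ⟨x, h1, h2, h3, -⟩ := stepH_some C N idx h
  obtain ⟨s, y, l, rfl, h5, h6⟩ := C.upd_form (N + idx q') q' Set.univ x (hf.lab _ _ h1)
  exact ⟨_, s, y, l, h1, h3.trans h5, h6⟩

theorem preInv_stepH [Fintype Q] {f : Mac Q} (hf : PreInv C f) (hN : IdsLt N f)
    (hidx : Function.Injective idx) (hN0 : 0 < N)
    (R : Q → Q → Prop) : PreInv C (stepH C N idx f R) := by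
  constructor
  · intro q' z hz s1 a y1 he
    obtain ⟨q, s, y, l, h1, rfl, h3⟩ := stepH_form C N idx hf hz
    rcases snoc_eq_append_cons _ _ _ _ _ he with ⟨rfl, rfl, rfl⟩ | ⟨y2, rfl, -⟩
    · exact h3
    · exact hf.lab _ _ h1 s1 a (y2 ++ y) (by simp)
  · intro q q' s s' l l' i y y' hz hz'
    obtain ⟨q1, s1, y1, l1, h1, h2, h3⟩ := stepH_form C N idx hf hz
    obtain ⟨q2, s2, y2, l2, g1, g2, g3⟩ := stepH_form C N idx hf hz'
    rcases snoc_eq_append_cons _ _ _ _ _ h2.symm with ⟨rfl, h4, rfl⟩ | ⟨y3, rfl, -⟩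
    · simp only [Prod.mk.injEq] at h4
      rcases snoc_eq_append_cons _ _ _ _ _ g2.symm with ⟨rfl, g4, rfl⟩ | ⟨y4, rfl, -⟩
      · simp only [Prod.mk.injEq] at g4
        have : q = q' := hidx (by omega)
        subst this
        rw [hz] at hz'
        simp only [Option.some.injEq] at hz'
        have := List.append_inj' hz' rfl
        simp at this
        exact this
      · have := hN _ _ g1 (l', i) (by simp)
        simp at this
        omega
    · have := hN _ _ h1 (l, i) (by simp)
      simp at this
      rcases snoc_eq_append_cons _ _ _ _ _ g2.symm with ⟨rfl, g4, rfl⟩ | ⟨y4, rfl, -⟩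
      · simp only [Prod.mk.injEq] at g4
        omega
      · exact hf.uniq q1 q2 s s' l l' i (y3 ++ y1) (y4 ++ y2) (by simpa using h1) (by simpa using g1)
  · intro q x hx
    obtain ⟨q1, s1, y1, l1, h1, rfl, h3⟩ := stepH_form C N idx hf hx
    have h4 := hf.inc _ _ h1
    have h5 := hN _ _ h1
    simp only [List.map_append, List.pairwise_cons, List.pairwise_append, List.mem_append,
      List.mem_map, List.map_cons, List.map_nil, List.mem_singleton] at h4 ⊢
    refine ⟨?_, h4.2.1, by simp, ?_⟩
    · rintro a (ha | rfl)
      · exact h4.1 a (Or.inl ha)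
      · omega
    · rintro a ⟨b, hb, rfl⟩ c rfl
      have := h5 b (by simp [hb])
      omega
  · intro q q' s y hz hz'
    obtain ⟨q1, s1, y1, l1, h1, h2, h3⟩ := stepH_form C N idx hf hz
    obtain ⟨q2, s2, y2, l2, g1, g2, g3⟩ := stepH_form C N idx hf hz'
    subst h2
    have g2' : s2 ++ [(l2, N + idx q')] = s1 ++ (l1, N + idx q) :: y := by rw [← g2]; simp
    rcases snoc_eq_append_cons _ _ _ _ _ g2' with ⟨rfl, g4, rfl⟩ | ⟨y4, rfl, -⟩
    · rfl
    · have := hN _ _ g1 (l1, N + idx q) (by simp)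
      simp at this

def Flash (h : Mac Q) (s : SPath) : Prop :=
  ∀ q y, h q = some (s ++ y) → y = [] ∨ ∃ i y', y = (0, i) :: y'

noncomputable def trunc (h : Mac Q) (x : SPath) : SPath :=
  x.take (sInf {k | Flash h (x.take k)})

theorem trunc_spec (h : Mac Q) (x : SPath) (hx : Flash h x) :
    (∃ y, x = trunc h x ++ y) ∧ Flash h (trunc h x) ∧
      ∀ s y, trunc h x = s ++ y → Flash h s → y = [] := by
  have hne : {k | Flash h (x.take k)}.Nonempty := ⟨x.length, by simpa using hx⟩
  refine ⟨⟨x.drop _, (List.take_append_drop _ x).symm⟩, Nat.sInf_mem hne, ?_⟩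
  intro s y he hs
  have hs' : s = x.take s.length := by
    have : s <+: x := List.IsPrefix.trans (l₂ := trunc h x) ⟨y, he.symm⟩ (List.take_prefix _ _)
    exact List.prefix_iff_eq_take.mp this
  have h1 : sInf {k | Flash h (x.take k)} ≤ s.length := Nat.sInf_le (by
    show Flash h (x.take s.length)
    rw [← hs']; exact hs)
  have h2 : (trunc h x).length ≤ s.length := by
    unfold trunc; rw [List.length_take]; omega
  rw [he] at h2
  simp at h2
  exact h2

noncomputable def stepG (h : Mac Q) : Mac Q := fun q => (h q).map (trunc h)

theorem stepG_some {C : CSys Q} {h : Mac Q} (hh : PreInv C h) {q : Q} {x : SPath}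
    (hx : stepG h q = some x) : (∃ y, h q = some (x ++ y)) ∧ Flash h x ∧
      ∀ s y, x = s ++ y → Flash h s → y = [] := by
  unfold stepG at hx
  rw [Option.map_eq_some_iff] at hx
  obtain ⟨z, hz, rfl⟩ := hx
  obtain ⟨⟨y, h1⟩, h2, h3⟩ := trunc_spec h z (by
    intro q' y hq'
    exact Or.inl (hh.fl _ _ _ _ hz hq'))
  exact ⟨⟨y, by rw [hz, ← h1]⟩, h2, h3⟩

theorem stepG_isSome {h : Mac Q} {q : Q} {z : SPath} (hz : h q = some z) :
    ∃ x, stepG h q = some x := ⟨trunc h z, by simp [stepG, hz]⟩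

theorem inv_stepG {C : CSys Q} {h : Mac Q} (hh : PreInv C h) : MInv C (stepG h) := by
  refine ⟨⟨?_, ?_, ?_, ?_⟩, ?_⟩
  · intro q x hx s a y e
    obtain ⟨⟨z, h1⟩, -, -⟩ := stepG_some hh hx
    exact hh.lab _ _ h1 s a (y ++ z) (by simp [e])
  · intro q q' s s' l l' i y y' h1 h2
    obtain ⟨⟨z, h1⟩, -, -⟩ := stepG_some hh h1
    obtain ⟨⟨z', h2⟩, -, -⟩ := stepG_some hh h2
    exact hh.uniq q q' s s' l l' i (y ++ z) (y' ++ z') (by simpa using h1) (by simpa using h2)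
  · intro q x hx
    obtain ⟨⟨z, h1⟩, -, -⟩ := stepG_some hh hx
    have := hh.inc _ _ h1
    rw [List.map_append, ← List.cons_append, List.pairwise_append] at this
    exact this.1
  · intro q q' s y h1 h2
    obtain ⟨-, h3, -⟩ := stepG_some hh h1
    obtain ⟨-, -, h4⟩ := stepG_some hh h2
    exact h4 s y rfl h3
  · intro q s a y hq
    obtain ⟨⟨z, h1⟩, -, h2⟩ := stepG_some hh hq
    have h3 : ¬ Flash h s := fun h => by simpa using h2 s _ rfl h
    unfold Flash at h3
    push Not at h3
    obtain ⟨q', y', h4, h5, h6⟩ := h3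
    obtain ⟨x, hx⟩ := stepG_isSome h4
    obtain ⟨⟨z', g1⟩, g2, g3⟩ := stepG_some hh hx
    rw [h4] at g1
    simp only [Option.some.injEq] at g1
    rcases List.append_eq_append_iff.mp g1 with ⟨as, e1, e2⟩ | ⟨bs, e1, e2⟩
    · cases as with
      | nil =>
        simp at e1
        subst e1
        simpa using h2 x _ rfl g2
      | cons b as =>
        refine ⟨q', b, as, by rw [hx, e1], ?_⟩
        intro hb
        refine h6 b.2 (as ++ z') ?_
        rw [e2, ← hb]; simp
    · have := h2 x (bs ++ a :: y) (by rw [e1]; simp) g2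
      simp at this

open Classical in
noncomputable def ids [Fintype Q] (g : Mac Q) : Finset ℕ :=
  insert 0 (Finset.univ.biUnion fun q => (((g q).getD []).map Prod.snd).toFinset)

theorem mem_ids [Fintype Q] {g : Mac Q} {i : ℕ} :
    i ∈ ids g ↔ i = 0 ∨ ∃ q s l y, g q = some (s ++ (l, i) :: y) := by
  simp only [ids, Finset.mem_insert, Finset.mem_biUnion, Finset.mem_univ, true_and,
    List.mem_toFinset, List.mem_map]
  constructor
  · rintro (h | ⟨q, ⟨l, i⟩, h1, rfl⟩)
    · exact Or.inl h
    · right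
      cases hq : g q with
      | none => simp [hq] at h1
      | some x =>
        simp [hq] at h1
        obtain ⟨s, y, rfl⟩ := List.append_of_mem h1
        exact ⟨q, s, l, y, hq⟩
  · rintro (h | ⟨q, s, l, y, h1⟩)
    · exact Or.inl h
    · right
      exact ⟨q, (l, i), by simp [h1], rfl⟩

open Classical in
noncomputable def comp (L : Finset ℕ) (i : ℕ) : ℕ :=
  if i ∈ L then (L.filter (· < i)).card else L.card + i

theorem comp_lt_card {L : Finset ℕ} {i : ℕ} (hi : i ∈ L) : comp L i < L.card := by
  unfold comp
  rw [if_pos hi]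
  apply Finset.card_lt_card
  refine ⟨Finset.filter_subset _ _, fun h => ?_⟩
  simpa using h hi

theorem comp_strict {L : Finset ℕ} {i j : ℕ} (hi : i ∈ L) (hj : j ∈ L) (h : i < j) :
    comp L i < comp L j := by
  unfold comp
  rw [if_pos hi, if_pos hj]
  apply Finset.card_lt_card
  refine ⟨fun x hx => ?_, fun h2 => ?_⟩
  · simp only [Finset.mem_filter] at hx ⊢
    exact ⟨hx.1, hx.2.trans h⟩
  · have : i ∈ L.filter (· < i) := h2 (by simp [hi, h])
    simp at this

theorem comp_inj (L : Finset ℕ) : Function.Injective (comp L) := by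
  intro i j h
  by_cases hi : i ∈ L <;> by_cases hj : j ∈ L
  · rcases lt_trichotomy i j with h1 | h1 | h1
    · have := comp_strict hi hj h1; omega
    · exact h1
    · have := comp_strict hj hi h1; omega
  · have := comp_lt_card hi
    have h2 : comp L j = L.card + j := if_neg hj
    omega
  · have := comp_lt_card hj
    have h2 : comp L i = L.card + i := if_neg hi
    omega
  · have h1 : comp L i = L.card + i := if_neg hi
    have h2 : comp L j = L.card + j := if_neg hj
    omega

theorem comp_le {L : Finset ℕ} {i : ℕ} (hi : i ∈ L) : comp L i ≤ i := by
  unfold comp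
  rw [if_pos hi]
  calc _ ≤ (Finset.range i).card := Finset.card_le_card (fun x hx => by
        simp at hx ⊢; exact hx.2)
    _ = i := by simp

theorem comp_eq {L : Finset ℕ} {i : ℕ} (h : ∀ j ≤ i, j ∈ L) : comp L i = i := by
  unfold comp
  rw [if_pos (h i le_rfl)]
  have : L.filter (· < i) = Finset.range i := by
    ext x; simp; intro hx; exact h x hx.le
  rw [this]; simp

theorem of_comp_eq {L : Finset ℕ} {i : ℕ} (hi : i ∈ L) (h : comp L i = i) : ∀ j ≤ i, j ∈ L := by
  unfold comp at h
  rw [if_pos hi] at h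
  have h1 : L.filter (· < i) ⊆ Finset.range i := fun x hx => by simp at hx ⊢; exact hx.2
  have h2 := Finset.eq_of_subset_of_card_le h1 (by simp [h])
  intro j hj
  rcases hj.lt_or_eq with h3 | rfl
  · have : j ∈ L.filter (· < i) := by rw [h2]; simpa using h3
    simp at this; exact this.1
  · exact hi

noncomputable def missing (L : Finset ℕ) : ℕ := sInf {k | k ∉ L}

theorem lt_missing_iff {L : Finset ℕ} {i : ℕ} : i < missing L ↔ ∀ j ≤ i, j ∈ L := by
  have hne : {k | k ∉ L}.Nonempty := by
    obtain ⟨k, hk⟩ := Infinite.exists_notMem_finset L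
    exact ⟨k, hk⟩
  constructor
  · intro h j hj
    by_contra hc
    have : missing L ≤ j := Nat.sInf_le hc
    omega
  · intro h
    by_contra hc
    push Not at hc
    exact (Nat.sInf_mem hne : missing L ∉ L) (h _ hc)

theorem missing_le (L : Finset ℕ) : missing L ≤ L.card := by
  have : Finset.range (missing L) ⊆ L := fun x hx => by
    simp at hx
    exact lt_missing_iff.mp hx x le_rfl
  simpa using Finset.card_le_card this

def rmap (φ : ℕ → ℕ) : SPath → SPath := List.map (Prod.map id φ)

theorem rmap_inj {φ : ℕ → ℕ} (h : Function.Injective φ) : Function.Injective (rmap φ) :=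
  List.map_injective_iff.mpr (Function.injective_id.prodMap h)

theorem rmap_eq_append {φ : ℕ → ℕ} {x s y : SPath} (h : rmap φ x = s ++ y) :
    ∃ s' y', x = s' ++ y' ∧ rmap φ s' = s ∧ rmap φ y' = y := List.map_eq_append_iff.mp h

theorem rmap_eq_append_cons {φ : ℕ → ℕ} {x s y : SPath} {a : ℕ × ℕ} (h : rmap φ x = s ++ a :: y) :
    ∃ s' b y', x = s' ++ b :: y' ∧ rmap φ s' = s ∧ a = (b.1, φ b.2) ∧ rmap φ y' = y := by
  obtain ⟨s', y', rfl, h1, h2⟩ := rmap_eq_append h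
  cases y' with
  | nil => simp [rmap] at h2
  | cons b y' =>
    simp only [rmap, List.map_cons, List.cons.injEq] at h2
    exact ⟨s', b, y', rfl, h1, h2.1.symm, h2.2⟩

noncomputable def stepM [Fintype Q] (g : Mac Q) : Mac Q :=
  fun q => (g q).map (rmap (comp (ids g)))

theorem stepM_some [Fintype Q] {g : Mac Q} {q : Q} {x : SPath} (h : stepM g q = some x) :
    ∃ z, g q = some z ∧ rmap (comp (ids g)) z = x := by
  simpa [stepM] using h

theorem rmap_append (φ : ℕ → ℕ) (x y : SPath) : rmap φ (x ++ y) = rmap φ x ++ rmap φ y := by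
  simp [rmap]

theorem inv_stepM [Fintype Q] {C : CSys Q} {g : Mac Q} (hg : MInv C g) : MInv C (stepM g) := by
  have hinj := rmap_inj (comp_inj (ids g))
  refine ⟨⟨?_, ?_, ?_, ?_⟩, ?_⟩
  · intro q x hx s a y e
    obtain ⟨z, hz, rfl⟩ := stepM_some hx
    obtain ⟨s', b, y', rfl, rfl, rfl, rfl⟩ := rmap_eq_append_cons e
    have := hg.lab _ _ hz s' b y' rfl
    unfold rmap
    rw [C.commit_map]
    exact this
  · intro q q' s s' l l' i y y' h1 h2
    obtain ⟨z, hz, e1⟩ := stepM_some h1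
    obtain ⟨z', hz', e2⟩ := stepM_some h2
    obtain ⟨s1, b1, y1, rfl, rfl, e3, rfl⟩ := rmap_eq_append_cons e1
    obtain ⟨s2, b2, y2, rfl, rfl, e4, rfl⟩ := rmap_eq_append_cons e2
    obtain ⟨l1, i1⟩ := b1
    obtain ⟨l2, i2⟩ := b2
    simp only [Prod.mk.injEq] at e3 e4
    have : i1 = i2 := comp_inj (ids g) (by rw [← e3.2, ← e4.2])
    subst this
    obtain ⟨rfl, rfl⟩ := hg.uniq _ _ _ _ _ _ _ _ _ hz hz'
    exact ⟨rfl, by rw [e3.1, e4.1]⟩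
  · intro q x hx
    obtain ⟨z, hz, rfl⟩ := stepM_some hx
    have h0 : comp (ids g) 0 = 0 := Nat.le_zero.mp (comp_le (mem_ids.mpr (Or.inl rfl)))
    have h1 := hg.inc _ _ hz
    have h2 : (0 :: (rmap (comp (ids g)) z).map Prod.snd) =
        (0 :: z.map Prod.snd).map (comp (ids g)) := by
      simp [rmap, h0]
    rw [h2, List.pairwise_map]
    refine h1.imp_of_mem ?_
    have hmem : ∀ a ∈ (0 :: z.map Prod.snd), a ∈ ids g := by
      intro a ha
      rw [mem_ids]
      simp only [List.mem_cons, List.mem_map] at ha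
      rcases ha with ha | ⟨b, hb, rfl⟩
      · exact Or.inl ha
      · right
        obtain ⟨s, y, rfl⟩ := List.append_of_mem hb
        exact ⟨q, s, b.1, y, hz⟩
    intro a b ha hb hab
    exact comp_strict (hmem a ha) (hmem b hb) hab
  · intro q q' s y h1 h2
    obtain ⟨z, hz, rfl⟩ := stepM_some h1
    obtain ⟨z', hz', e⟩ := stepM_some h2
    obtain ⟨s1, y1, rfl, e1, rfl⟩ := rmap_eq_append e
    have := hinj e1
    subst this
    have := hg.fl _ _ _ _ hz hz'
    subst this
    rfl
  · intro q s a y h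
    obtain ⟨z, hz, e⟩ := stepM_some h
    obtain ⟨s', b, y', rfl, rfl, rfl, rfl⟩ := rmap_eq_append_cons e
    obtain ⟨q', b', y2, h1, h2⟩ := hg.nd _ _ _ _ hz
    refine ⟨q', (b'.1, comp (ids g) b'.2), rmap (comp (ids g)) y2, ?_, h2⟩
    simp [stepM, h1, rmap]
    rfl

end Step
section Bounds
variable {Q : Type} [Fintype Q] {C : CSys Q}

def extSet (g : Mac Q) (s : SPath) : Set Q := {q' | ∃ y', g q' = some (s ++ y')}

theorem length_bound {g : Mac Q} (hg : MInv C g) {q : Q} {s y : SPath} (h : g q = some (s ++ y)) :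
    s.length + (extSet g s).ncard
      + C.mu (C.commit Set.univ s) ≤ Fintype.card Q + C.D := by
  induction s using List.reverseRecOn generalizing q y with
  | nil =>
    have h1 := Set.ncard_le_ncard (Set.subset_univ (extSet g []))
    rw [Set.ncard_univ, Nat.card_eq_fintype_card] at h1
    have h2 := C.mu_univ
    simp only [List.length_nil, CSys.commit]
    omega
  | append_singleton s a ih =>
    have h' : g q = some (s ++ a :: y) := by simpa using h
    have h1 := ih h'
    have hsub : (extSet g (s ++ [a])) ⊆
        (extSet g s) := by
      intro q' hq'
      obtain ⟨y', h⟩ := hq'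
      exact ⟨[a] ++ y', by simpa using h⟩
    have hc : C.commit Set.univ (s ++ [a]) = C.nx (C.commit Set.univ s) a.1 := by
      rw [C.commit_append]; rfl
    rw [hc, List.length_append, List.length_singleton]
    by_cases ha : a.1 = 0
    · rw [ha, C.nx0]
      have : (extSet g (s ++ [a])).ncard <
        (extSet g s).ncard := by
        apply Set.ncard_lt_ncard
        swap
        · exact Set.toFinite _
        refine ⟨hsub, fun hs => ?_⟩
        obtain ⟨q', b, y', h2, h3⟩ := hg.nd _ _ _ _ h'
        obtain ⟨y3, h4⟩ := hs (show q' ∈ (extSet g s) from ⟨_, h2⟩)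
        rw [h2] at h4
        simp at h4
        rw [h4.1] at h3
        exact h3 ha
      omega
    · have h2 : C.act (C.commit Set.univ s) a.1 := (hg.lab _ _ h' s a y rfl).resolve_left ha
      have h3 := C.mu_lt _ _ h2
      have h4 := Set.ncard_le_ncard hsub
      omega

theorem length_le {g : Mac Q} (hg : MInv C g) {q : Q} {s : SPath} (h : g q = some s) :
    s.length ≤ Fintype.card Q + C.D := by
  classical
  have := length_bound hg (q := q) (s := s) (y := []) (by simpa using h)
  omega

theorem rep_exists {g : Mac Q} (hg : MInv C g) (k : ℕ) {q : Q} {s y : SPath}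
    (hk : Fintype.card Q + C.D ≤ s.length + k)
    (h : g q = some (s ++ y)) : ∃ q' y', g q' = some (s ++ y') ∧ ∀ a ∈ y', a.1 ≠ 0 := by
  induction k generalizing q s y with
  | zero =>
    have := length_le hg h
    simp at this
    have hy : y = [] := List.length_eq_zero_iff.mp (by omega)
    subst hy
    exact ⟨q, [], h, by simp⟩
  | succ k ih =>
    cases y with
    | nil => exact ⟨q, [], h, by simp⟩
    | cons a y =>
      obtain ⟨q', b, y', h2, h3⟩ := hg.nd _ _ _ _ h
      obtain ⟨q2, y2, h4, h5⟩ := ih (q := q') (s := s ++ [b]) (y := y') (by simp; omega) (by simpa using h2)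
      refine ⟨q2, b :: y2, by simpa using h4, ?_⟩
      simp only [List.mem_cons]
      rintro a (rfl | ha)
      · exact h3
      · exact h5 a ha

omit [Fintype Q] in
theorem mu_chain (J : Set Q) (x : SPath) (hx : C.labOK J x) (h0 : ∀ a ∈ x, a.1 ≠ 0) :
    C.mu (C.commit J x) + x.length ≤ C.mu J := by
  induction x generalizing J with
  | nil => simp [CSys.commit]
  | cons a x ih =>
    have h1 := (hx [] a x rfl).resolve_left (h0 a (by simp))
    have h2 := C.mu_lt _ _ h1
    have h3 := ih (C.nx J a.1) (fun s b y e => hx (a :: s) b y (by simp [e]))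
      (fun b hb => h0 b (by simp [hb]))
    simp only [CSys.commit, List.length_cons] at *
    omega

omit [Fintype Q] in
theorem labOK_append {J : Set Q} {s d y : SPath} (h : C.labOK J (s ++ (d ++ y))) :
    C.labOK (C.commit J s) d := by
  intro s' a y' e
  have := h (s ++ s') a (y' ++ y) (by simp [e])
  rwa [C.commit_append] at this

omit [Fintype Q] in
theorem mu_le {g : Mac Q} (hg : MInv C g) {q : Q} {s y : SPath} (h : g q = some (s ++ y)) :
    C.mu (C.commit Set.univ s) ≤ C.D := by
  induction s using List.reverseRecOn generalizing y with
  | nil => exact C.mu_univ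
  | append_singleton s a ih =>
    have h' : g q = some (s ++ a :: y) := by simpa using h
    have h1 := ih h'
    rw [C.commit_append]
    show C.mu (C.nx (C.commit Set.univ s) a.1) ≤ _
    rcases hg.lab _ _ h' s a y rfl with h2 | h2
    · rwa [h2, C.nx0]
    · have := C.mu_lt _ _ h2; omega

def lastId (x : SPath) : ℕ := (x.getLast?.map Prod.snd).getD 0

theorem lastId_append (s : SPath) (a : ℕ × ℕ) : lastId (s ++ [a]) = a.2 := by simp [lastId]

theorem card_ids {g : Mac Q} (hg : MInv C g) (hQ : 0 < Fintype.card Q) :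
    (ids g).card ≤ Fintype.card Q * (C.D + 1) := by
  classical
  by_cases hne : ∃ q x, g q = some x
  · have hnode : ∀ i : ids g, ∃ (p : Q × SPath × SPath), g p.1 = some (p.2.1 ++ p.2.2) ∧
        lastId p.2.1 = i ∧ ∀ a ∈ p.2.2, a.1 ≠ 0 := by
      rintro ⟨i, hi⟩
      rcases mem_ids.mp hi with rfl | ⟨q, s, l, y, h⟩
      · obtain ⟨q, x, hx⟩ := hne
        obtain ⟨q', y', h1, h2⟩ := rep_exists hg (Fintype.card Q + C.D) (q := q) (s := []) (y := x) (by simp) hx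
        exact ⟨(q', [], y'), h1, rfl, h2⟩
      · obtain ⟨q', y', h1, h2⟩ := rep_exists hg (Fintype.card Q + C.D) (q := q) (s := s ++ [(l, i)]) (y := y) (by simp) (by simpa using h)
        exact ⟨(q', s ++ [(l, i)], y'), h1, lastId_append _ _, h2⟩
    choose p hp1 hp2 hp3 using hnode
    let F : ids g → Q × Fin (C.D + 1) := fun i =>
      ((p i).1, ⟨C.mu (C.commit Set.univ (p i).2.1), Nat.lt_succ_of_le (mu_le hg (hp1 i))⟩)
    have key : ∀ i j : ids g, (p i).1 = (p j).1 →
        C.mu (C.commit Set.univ (p i).2.1) = C.mu (C.commit Set.univ (p j).2.1) →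
        ∀ d, (p j).2.1 = (p i).2.1 ++ d → (p i).2.2 = d ++ (p j).2.2 → i = j := by
      intro i j _ h2 d h3 h4
      have h5 := hg.lab _ _ (hp1 i)
      rw [h4] at h5
      have h6 := mu_chain _ d (labOK_append h5) (fun a ha => hp3 i a (by rw [h4]; simp [ha]))
      rw [← C.commit_append, ← h3] at h6
      have hd : d = [] := List.length_eq_zero_iff.mp (by omega)
      subst hd
      apply Subtype.ext
      rw [← hp2 i, ← hp2 j, h3]
      simp
    have hF : Function.Injective F := by
      intro i j hij
      simp only [F, Prod.mk.injEq, Fin.mk.injEq] at hij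
      have h1 := hp1 i
      have h2 := hp1 j
      rw [hij.1, h2] at h1
      simp only [Option.some.injEq] at h1
      rcases List.append_eq_append_iff.mp h1 with ⟨d, e1, e2⟩ | ⟨d, e1, e2⟩
      · exact (key j i hij.1.symm hij.2.symm d e1 e2).symm
      · exact key i j hij.1 hij.2 d e1 e2
    have := Fintype.card_le_of_injective F hF
    simpa using this
  · have : ids g = {0} := by
      ext i
      rw [mem_ids]
      simp only [Finset.mem_singleton, or_iff_left_iff_imp]
      rintro ⟨q, s, l, y, h⟩
      exact absurd ⟨q, _, h⟩ hne
    rw [this]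
    simp only [Finset.card_singleton]
    exact Nat.mul_pos hQ (by omega)
end Bounds

section FullStep
variable {Q : Type} [Fintype Q] (C : CSys Q) (N : ℕ) (idx : Q → ℕ)

noncomputable def stepF (R : Q → Q → Prop) (f : Mac Q) : Mac Q := stepM (stepG (stepH C N idx f R))
noncomputable def stepE (R : Q → Q → Prop) (f : Mac Q) : ℕ := missing (ids (stepG (stepH C N idx f R)))

structure Ctx : Prop where
  hidx : Function.Injective idx
  hN : N = Fintype.card Q * (C.D + 1)
  hQ : 0 < Fintype.card Q

variable {C N idx}

theorem Ctx.Npos (X : Ctx C N idx) : 0 < N := by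
  rw [X.hN]; exact Nat.mul_pos X.hQ (by omega)

theorem invG (X : Ctx C N idx) {f : Mac Q} (hf : MInv C f) (hN : IdsLt N f) (R : Q → Q → Prop) :
    MInv C (stepG (stepH C N idx f R)) :=
  inv_stepG (preInv_stepH C N idx hf.toPreInv hN X.hidx X.Npos R)

theorem inv_step (X : Ctx C N idx) {f : Mac Q} (hf : MInv C f) (hN : IdsLt N f)
    (R : Q → Q → Prop) : MInv C (stepF C N idx R f) :=
  inv_stepM (invG X hf hN R)

theorem ids_step (X : Ctx C N idx) {f : Mac Q} (hf : MInv C f) (hN : IdsLt N f)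
    (R : Q → Q → Prop) : IdsLt N (stepF C N idx R f) := by
  intro q x hx a ha
  obtain ⟨z, hz, rfl⟩ := stepM_some hx
  simp only [rmap, List.mem_map] at ha
  obtain ⟨b, hb, rfl⟩ := ha
  obtain ⟨s, y, rfl⟩ := List.append_of_mem hb
  have h1 : b.2 ∈ ids (stepG (stepH C N idx f R)) := mem_ids.mpr (Or.inr ⟨q, s, b.1, y, hz⟩)
  have h2 := comp_lt_card h1
  have h3 := card_ids (invG X hf hN R) X.hQ
  rw [← X.hN] at h3
  exact h2.trans_le h3

theorem stepE_le (X : Ctx C N idx) {f : Mac Q} (hf : MInv C f) (hN : IdsLt N f)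
    (R : Q → Q → Prop) : stepE C N idx R f ≤ N := by
  have h3 := card_ids (invG X hf hN R) X.hQ
  rw [← X.hN] at h3
  exact (missing_le _).trans h3

theorem step_isSome {R : Q → Q → Prop} {f : Mac Q} {q q' : Q} {x : SPath}
    (hx : f q = some x) (hR : R q q') : ∃ z, stepF C N idx R f q' = some z := by
  obtain ⟨z, hz⟩ := stepH_isSome C N idx hx hR
  obtain ⟨z2, hz2⟩ := stepG_isSome hz
  exact ⟨_, by simp only [stepF, stepM, hz2]; rfl⟩

theorem rmap_fix {φ : ℕ → ℕ} {p : SPath} (h : ∀ a ∈ p, φ a.2 = a.2) : rmap φ p = p := by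
  induction p with
  | nil => rfl
  | cons a p ih =>
    have h1 := ih (fun b hb => h b (by simp [hb]))
    have h2 := h a (by simp)
    unfold rmap at *
    rw [List.map_cons, h1]
    simp [Prod.map, h2]

theorem step_back (X : Ctx C N idx) {f : Mac Q} (hf : MInv C f) (hN : IdsLt N f)
    {R : Q → Q → Prop} {p z' : SPath} {q' : Q} (hp : ∀ a ∈ p, a.2 < stepE C N idx R f)
    (h : stepF C N idx R f q' = some (p ++ z')) :
    ∃ y z z2, f (prd C N idx f R q') = some (p ++ y) ∧ R (prd C N idx f R q') q' ∧
      C.pass q' Set.univ p ∧ C.upd (N + idx q') q' (C.commit Set.univ p) y = z ++ z2 ∧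
      z' = rmap (comp (ids (stepG (stepH C N idx f R)))) z ∧
      (∀ a ∈ z, a.2 ∈ ids (stepG (stepH C N idx f R))) ∧
      (z = [] → ∃ i y', z2 = (0, i) :: y') ∧
      ∀ q2 y2, f q2 = some (p ++ y2) → R q2 q' →
        SLe (z ++ z2) (C.upd (N + idx q') q' (C.commit Set.univ p) y2) := by
  set g := stepG (stepH C N idx f R) with hg
  have hpre := preInv_stepH C N idx hf.toPreInv hN X.hidx X.Npos R
  obtain ⟨x, hx, e⟩ := stepM_some h
  obtain ⟨p1, z, rfl, e1, rfl⟩ := rmap_eq_append e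
  have hfix : rmap (comp (ids g)) p = p := rmap_fix (fun a ha => comp_eq (lt_missing_iff.mp (hp a ha)))
  have : p1 = p := rmap_inj (comp_inj (ids g)) (by rw [e1]; exact hfix.symm)
  subst this
  obtain ⟨⟨z2, h1⟩, h2, h3⟩ := stepG_some hpre hx
  obtain ⟨x, h4, h5, h6, h7⟩ := stepH_some C N idx h1
  have hpN : ∀ a ∈ p1, a.2 ≠ N + idx q' := by
    intro a ha
    have := hp a ha
    have := stepE_le X hf hN R
    omega
  obtain ⟨y, rfl, h8, h9⟩ := C.pass_of_upd (N + idx q') q' Set.univ x p1 (z ++ z2) hpN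
    (by rw [← h6]; simp)
  refine ⟨y, z, z2, h4, h5, h8, h9, rfl, ?_, ?_, ?_⟩
  · intro a ha
    obtain ⟨s, y, rfl⟩ := List.append_of_mem ha
    exact mem_ids.mpr (Or.inr ⟨q', p1 ++ s, a.1, y, by rw [hg, hx]; simp⟩)
  · rintro rfl
    rcases h2 q' z2 (by simpa using h1) with rfl | h10
    · exact absurd h9 (C.upd_ne_nil _ _ _ _)
    · exact h10
  · intro q2 y2 h10 h11
    have := h7 q2 _ h10 h11
    rw [C.upd_pass _ _ _ _ _ h8, List.append_assoc] at this
    exact SLe_append _ _ _ this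

end FullStep
theorem anti_const (u : ℕ → ℕ) (T : ℕ) (h : ∀ t ≥ T, u (t+1) ≤ u t) :
    ∃ T' ≥ T, ∃ c, ∀ t ≥ T', u t = c := by
  classical
  have hne : {c | ∃ t ≥ T, u t = c}.Nonempty := ⟨u T, T, le_rfl, rfl⟩
  obtain ⟨T', hT', hc⟩ := Nat.sInf_mem hne
  refine ⟨T', hT', u T', ?_⟩
  intro t ht
  induction t, ht using Nat.le_induction with
  | base => rfl
  | succ t ht ih =>
    have h1 := h t (hT'.trans ht)
    have h2 : sInf {c | ∃ t ≥ T, u t = c} ≤ u (t+1) := Nat.sInf_le ⟨t+1, by omega, rfl⟩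
    omega

section Inf
variable {Q : Type} [Finite Q]

theorem inf_of_frequently (ρ : ℕ → Q) (S : Set Q) (h : ∀ T, ∃ t ≥ T, ρ t ∈ S) :
    (InfStates ρ ∩ S).Nonempty := by
  by_contra hc
  rw [Set.not_nonempty_iff_eq_empty] at hc
  have h1 : ∀ q, ∃ N, ∀ m, N ≤ m → q ∈ S → ρ m ≠ q := by
    intro q
    by_cases hq : q ∈ S
    · have : q ∉ InfStates ρ := fun h => by
        have : q ∈ InfStates ρ ∩ S := ⟨h, hq⟩
        rw [hc] at this; exact this
      simp only [InfStates, Set.mem_ofPred_eq, not_forall, not_exists, not_and] at this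
      obtain ⟨N, hN⟩ := this
      exact ⟨N, fun m hm _ => hN m hm⟩
    · exact ⟨0, fun m _ h => absurd h hq⟩
  choose N hN using h1
  obtain ⟨M, hM⟩ := (Set.finite_range N).bddAbove
  obtain ⟨t, ht, h2⟩ := h M
  exact hN (ρ t) t ((hM ⟨ρ t, rfl⟩).trans ht) h2 rfl

theorem eventually_inf (ρ : ℕ → Q) : ∃ T, ∀ t ≥ T, ρ t ∈ InfStates ρ := by
  by_contra hc
  push Not at hc
  obtain ⟨q, h1, h2⟩ := inf_of_frequently ρ (InfStates ρ)ᶜ hc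
  exact h2 h1

omit [Finite Q] in
theorem inf_subset (ρ : ℕ → Q) (S : Set Q) (T : ℕ) (h : ∀ t ≥ T, ρ t ∈ S) : InfStates ρ ⊆ S := by
  intro q hq
  obtain ⟨m, hm, rfl⟩ := hq T
  exact h m hm

theorem konig (R : ℕ → Q → Q → Prop)
    (h : ∀ M, ∃ ρ : ℕ → Q, ∀ t < M, R t (ρ t) (ρ (t+1))) :
    ∃ ρ : ℕ → Q, ∀ t, R t (ρ t) (ρ (t+1)) := by
  choose σ hσ using h
  have h1 : ∀ t, ∃ q, ∀ᶠ M in (Filter.hyperfilter ℕ : Filter ℕ), σ M t = q := by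
    intro t
    by_contra hc
    push Not at hc
    have h2 : ∀ q, ∀ᶠ M in (Filter.hyperfilter ℕ : Filter ℕ), σ M t ≠ q := fun q => hc q
    obtain ⟨M, hM⟩ := (Filter.eventually_all.mpr h2).exists
    exact hM _ rfl
  choose ρ hρ using h1
  refine ⟨ρ, fun t => ?_⟩
  have h3 : ∀ᶠ M in (Filter.hyperfilter ℕ : Filter ℕ), t < M := by
    have : ∀ᶠ M in Filter.atTop, t < M := Filter.eventually_gt_atTop t
    rw [← Nat.cofinite_eq_atTop] at this
    exact Filter.hyperfilter_le_cofinite this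
  obtain ⟨M, ⟨h4, h5⟩, h6⟩ := (((hρ t).and (hρ (t+1))).and h3).exists
  have := hσ M t h6
  rwa [h4, h5] at this
end Inf

section Runs
variable {Q : Type} [Fintype Q] (C : CSys Q) (N : ℕ) (idx : Q → ℕ) (Q₀ : Set Q) (R : ℕ → Q → Q → Prop)

open Classical in
noncomputable def init0 : Mac Q := fun q => if q ∈ Q₀ then some [] else none

noncomputable def mrun : ℕ → Mac Q
  | 0 => init0 Q₀
  | t+1 => stepF C N idx (R t) (mrun t)

noncomputable def erun (t : ℕ) : ℕ := stepE C N idx (R t) (mrun C N idx Q₀ R t)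

def MAcc (r : ℕ) : Prop := (∃ T, ∀ t ≥ T, r < erun C N idx Q₀ R t) ∧
  ∀ T, ∃ t ≥ T, ∃ q x, mrun C N idx Q₀ R t q = some x ∧ lastId x = r

omit [Fintype Q] in
theorem init0_some {q : Q} {x : SPath} (h : init0 Q₀ q = some x) : q ∈ Q₀ ∧ x = [] := by
  unfold init0 at h
  split_ifs at h with h1
  simp at h
  exact ⟨h1, h⟩

omit [Fintype Q] in
theorem inv_init0 : MInv C (init0 Q₀) := by
  refine ⟨⟨?_, ?_, ?_, ?_⟩, ?_⟩
  · intro q x h s a y e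
    rw [(init0_some _ h).2] at e
    simp at e
  · intro q q' s s' l l' i y y' h
    have := (init0_some _ h).2
    simp at this
  · intro q x h
    rw [(init0_some _ h).2]; simp
  · intro q q' s y h1 h2
    have := (init0_some _ h2).2
    simp at this
    exact this.2
  · intro q s a y h
    have := (init0_some _ h).2
    simp at this

omit [Fintype Q] in
theorem ids_init0 : IdsLt N (init0 Q₀) := by
  intro q x h
  rw [(init0_some _ h).2]; simp

variable {C N idx}

theorem inv_mrun (X : Ctx C N idx) (t : ℕ) :
    MInv C (mrun C N idx Q₀ R t) ∧ IdsLt N (mrun C N idx Q₀ R t) := by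
  induction t with
  | zero => exact ⟨inv_init0 C Q₀, ids_init0 N Q₀⟩
  | succ t ih => exact ⟨inv_step X ih.1 ih.2 _, ids_step X ih.1 ih.2 _⟩

theorem erun_pos (t : ℕ) : 0 < erun C N idx Q₀ R t := by
  unfold erun stepE
  rw [lt_missing_iff]
  intro j hj
  exact mem_ids.mpr (Or.inl (by omega))

theorem erun_le (X : Ctx C N idx) (t : ℕ) : erun C N idx Q₀ R t ≤ N :=
  stepE_le X (inv_mrun Q₀ R X t).1 (inv_mrun Q₀ R X t).2 _

theorem lastId_lt {p : SPath} {e : ℕ} (he : 0 < e) (h : ∀ a ∈ p, a.2 < e) : lastId p < e := by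
  rcases List.eq_nil_or_concat p with rfl | ⟨s, a, rfl⟩
  · exact he
  · rw [List.concat_eq_append] at *
    rw [lastId_append]; exact h a (by simp)

theorem complete_aux (X : Ctx C N idx) (ρ : ℕ → Q)
    (hρ : ∀ t, R t (ρ t) (ρ (t+1))) (hg : C.good (InfStates ρ)) (k : ℕ) (p : SPath)
    (hk : Fintype.card Q + C.D < p.length + k)
    (hJ : InfStates ρ ⊆ C.commit Set.univ p) (T : ℕ)
    (hT : ∀ t ≥ T, (∃ y, mrun C N idx Q₀ R t (ρ t) = some (p ++ y)) ∧
      ∀ a ∈ p, a.2 < erun C N idx Q₀ R t) :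
    ∃ r < N, MAcc C N idx Q₀ R r := by
  induction k generalizing p T with
  | zero =>
    obtain ⟨⟨y, h1⟩, -⟩ := hT T le_rfl
    have := length_le (inv_mrun Q₀ R X T).1 h1
    simp at this
    omega
  | succ k ih =>
    by_cases hfl : ∀ T', ∃ t ≥ T', ∃ q, mrun C N idx Q₀ R t q = some p
    · refine ⟨lastId p, ?_, ⟨T, fun t ht => lastId_lt (erun_pos _ _ _) (hT t ht).2⟩, ?_⟩
      · exact (lastId_lt (erun_pos _ _ _) (hT T le_rfl).2).trans_le (erun_le Q₀ R X T)
      · intro T'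
        obtain ⟨t, ht, q, hq⟩ := hfl T'
        exact ⟨t, ht, q, p, hq, rfl⟩
    push Not at hfl
    obtain ⟨T1, hT1⟩ := hfl
    obtain ⟨T2, hT2⟩ := eventually_inf ρ
    have hex : ∀ t, ∃ a y, t ≥ T + T1 → mrun C N idx Q₀ R t (ρ t) = some (p ++ a :: y) := by
      intro t
      by_cases ht : t ≥ T + T1
      · obtain ⟨⟨y, h1⟩, -⟩ := hT t (by omega)
        cases y with
        | nil => exact absurd (by simpa using h1) (hT1 t (by omega) (ρ t))
        | cons a y => exact ⟨a, y, fun _ => h1⟩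
      · exact ⟨(0, 0), [], fun h => absurd h ht⟩
    choose a y hay using hex
    set J := C.commit Set.univ p with hJdef
    have step : ∀ t ≥ T + T1, ∃ i0, i0 ∈ ids (stepG (stepH C N idx (mrun C N idx Q₀ R t) (R t))) ∧
        (a (t+1)).2 = comp (ids (stepG (stepH C N idx (mrun C N idx Q₀ R t) (R t)))) i0 ∧
        (ρ (t+1) ∈ C.P J (a t).1 → (a (t+1)).1 < (a t).1) ∧ (a (t+1)).1 ≤ (a t).1 ∧
        (ρ (t+1) ∉ C.P J (a t).1 → ρ (t+1) ∈ C.nx J (a t).1 → (a (t+1)).1 = (a t).1 → i0 ≤ (a t).2) := by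
      intro t ht
      have hI := inv_mrun Q₀ R X t
      obtain ⟨y1, z, z2, h1, h2, h3, h4, h5, h6, h7, h8⟩ := step_back X hI.1 hI.2 (R := R t) (p := p)
        (z' := a (t+1) :: y (t+1)) (q' := ρ (t+1)) (hT t (by omega)).2 (hay (t+1) (by omega))
      cases z with
      | nil => simp [rmap] at h5
      | cons b z =>
        simp only [rmap, List.map_cons, List.cons.injEq] at h5
        have h9 := h8 (ρ t) _ (hay t ht) (hρ t)
        refine ⟨b.2, h6 b (by simp), by rw [h5.1]; rfl, ?_⟩
        have h10 : (a (t+1)).1 = b.1 := by rw [h5.1]; rfl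
        rw [h10]
        unfold CSys.upd at h9
        rw [← hJdef] at h9
        split_ifs at h9 with g1 g2
        · have g3 := SLe_cons _ _ _ _ h9
          have g4 : 0 < (a t).1 := by
            rcases Nat.eq_zero_or_pos (a t).1 with g | g
            · rw [g, C.P0] at g1; exact absurd g1 (by simp)
            · exact g
          have g5 := C.nextLab_lt J (a t).1 g4
          simp only at g3
          exact ⟨fun _ => by omega, by omega, fun h => absurd g1 h⟩
        · have g3 := SLe_cons _ _ _ _ h9
          exact ⟨fun h => absurd h g1, by omega, fun _ _ h => by omega⟩
        · have g3 := SLe_cons _ _ _ _ h9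
          simp only at g3
          exact ⟨fun h => absurd h g1, by omega, fun _ h => absurd h g2⟩
    obtain ⟨T3, hT3, l, hl⟩ := anti_const (fun t => (a t).1) (T + T1) (fun t ht => by
      obtain ⟨i0, h1, h2, h3, h4, h5⟩ := step t ht
      exact h4)
    have hnP : ∀ t ≥ T3, ρ (t+1) ∉ C.P J l := by
      intro t ht hc
      obtain ⟨i0, h1, h2, h3, h4, h5⟩ := step t (by omega)
      rw [hl t ht, hl (t+1) (by omega)] at h3
      exact absurd (h3 hc) (by omega)
    have hJ' : InfStates ρ ⊆ C.nx J l := by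
      have hlab := (inv_mrun Q₀ R X T3).1.lab _ _ (hay T3 hT3) p (a T3) (y T3) rfl
      rw [hl T3 le_rfl] at hlab
      rcases hlab with h0 | hact
      · rw [h0, C.nx0]; exact hJ
      · refine C.complete J _ l hJ hg hact ?_
        ext q
        simp only [Set.mem_inter_iff, Set.mem_empty_iff_false, iff_false, not_and]
        intro hq hqP
        obtain ⟨m, hm, rfl⟩ := hq (T3 + 1)
        obtain ⟨m, rfl⟩ : ∃ m', m = m' + 1 := ⟨m - 1, by omega⟩
        exact hnP m (by omega) hqP
    have step2 : ∀ t ≥ T3 + T2, ∃ i0, i0 ∈ ids (stepG (stepH C N idx (mrun C N idx Q₀ R t) (R t))) ∧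
        (a (t+1)).2 = comp (ids (stepG (stepH C N idx (mrun C N idx Q₀ R t) (R t)))) i0 ∧
        i0 ≤ (a t).2 := by
      intro t ht
      obtain ⟨i0, h1, h2, h3, h4, h5⟩ := step t (by omega)
      refine ⟨i0, h1, h2, h5 ?_ ?_ ?_⟩
      · rw [hl t (by omega)]; exact hnP t (by omega)
      · rw [hl t (by omega)]; exact hJ' (hT2 _ (by omega))
      · rw [hl t (by omega), hl (t+1) (by omega)]
    obtain ⟨T4, hT4, i, hi⟩ := anti_const (fun t => (a t).2) (T3 + T2) (fun t ht => by
      obtain ⟨i0, h1, h2, h3⟩ := step2 t ht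
      rw [h2]
      exact (comp_le h1).trans h3)
    refine ih (p ++ [(l, i)]) (by simp; omega) (by rw [C.commit_append]; exact hJ') T4 ?_
    intro t ht
    have ha : a t = (l, i) := Prod.ext (hl t (by omega)) (hi t ht)
    refine ⟨⟨y t, by rw [hay t (by omega), ha]; simp⟩, ?_⟩
    intro b hb
    rw [List.mem_append, List.mem_singleton] at hb
    rcases hb with hb | rfl
    · exact (hT t (by omega)).2 b hb
    · obtain ⟨i0, h1, h2, h3⟩ := step2 t (by omega)
      rw [hi t ht] at h3
      rw [hi (t+1) (by omega)] at h2
      have h4 := comp_le h1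
      have h5 : i0 = i := by omega
      subst h5
      exact lt_missing_iff.mpr (of_comp_eq h1 h2.symm)

theorem complete_main (X : Ctx C N idx) (ρ : ℕ → Q) (h0 : ρ 0 ∈ Q₀)
    (hρ : ∀ t, R t (ρ t) (ρ (t+1))) (hg : C.good (InfStates ρ)) :
    ∃ r < N, MAcc C N idx Q₀ R r := by
  refine complete_aux Q₀ R X ρ hρ hg (Fintype.card Q + C.D + 1) [] (by simp)
    (Set.subset_univ _) 0 ?_
  intro t _
  refine ⟨?_, by simp⟩
  simp only [List.nil_append]
  induction t with
  | zero => exact ⟨[], by simp [mrun, init0, h0]⟩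
  | succ t ih =>
    obtain ⟨y, hy⟩ := ih (by omega)
    exact step_isSome hy (hρ t)

end Runs

section Sound
variable {Q : Type} [Fintype Q] {C : CSys Q} {N : ℕ} {idx : Q → ℕ} (Q₀ : Set Q) (R : ℕ → Q → Q → Prop)

theorem id_le_last {x : SPath} (h : (0 :: x.map Prod.snd).Pairwise (· < ·)) :
    ∀ a ∈ x, a.2 ≤ lastId x := by
  rcases List.eq_nil_or_concat x with rfl | ⟨s, b, rfl⟩
  · simp
  · rw [List.concat_eq_append] at *
    rw [lastId_append]
    intro a ha
    rw [List.mem_append, List.mem_singleton] at ha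
    rcases ha with ha | rfl
    · rw [List.pairwise_cons, List.map_append, List.pairwise_append] at h
      exact (h.2.2.2 a.2 (List.mem_map_of_mem ha) b.2 (by simp)).le
    · exact le_rfl

theorem last_cases {x : SPath} (h : (0 :: x.map Prod.snd).Pairwise (· < ·)) :
    (x = [] ∧ lastId x = 0) ∨ ∃ s l, x = s ++ [(l, lastId x)] ∧ 0 < lastId x := by
  rcases List.eq_nil_or_concat x with rfl | ⟨s, b, rfl⟩
  · exact Or.inl ⟨rfl, rfl⟩
  · rw [List.concat_eq_append] at *
    rw [lastId_append]
    refine Or.inr ⟨s, b.1, rfl, ?_⟩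
    rw [List.pairwise_cons] at h
    exact h.1 b.2 (by simp)

theorem prefix_id_le {s y : SPath} {l r : ℕ}
    (h : (0 :: (s ++ (l, r) :: y).map Prod.snd).Pairwise (· < ·)) :
    ∀ a ∈ s ++ [(l, r)], a.2 ≤ r := by
  have h2 : (0 :: (s ++ [(l, r)]).map Prod.snd).Pairwise (· < ·) := by
    refine h.sublist ?_
    simp
  intro a ha
  have := id_le_last h2 a ha
  rwa [lastId_append] at this

def labOf (C : CSys Q) : SPath → ℕ
  | [] => C.D + 1
  | a :: _ => a.1

omit [Fintype Q] in
theorem upd_head (F : ℕ) (q : Q) (J : Set Q) (y : SPath) :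
    ∃ l i x, C.upd F q J y = (l, i) :: x ∧
      ∀ j, C.act J j → l < j → labOf C y < j ∨ q ∈ C.P J j := by
  cases y with
  | nil =>
    refine ⟨_, _, _, rfl, ?_⟩
    intro j hj hl
    have := C.actD J j hj
    exact absurd hj (C.nextLab_between J _ j hl (by omega))
  | cons a x =>
    unfold CSys.upd
    split_ifs with h1 h2
    · refine ⟨_, _, _, rfl, ?_⟩
      intro j hj hl
      rcases lt_trichotomy j a.1 with h | h | h
      · exact absurd hj (C.nextLab_between J _ j hl h)
      · right; rwa [h]
      · left; exact h
    · exact ⟨a.1, a.2, _, rfl, fun j _ h => Or.inl h⟩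
    · exact ⟨_, _, _, rfl, fun j _ h => Or.inl h⟩

theorem sound_path (X : Ctx C N idx) {r t0 : ℕ} (hT : ∀ t ≥ t0, r < erun C N idx Q₀ R t)
    {q0 : Q} {p : SPath} (hp : mrun C N idx Q₀ R t0 q0 = some p) (hr : lastId p = r)
    (t : ℕ) (ht : t0 ≤ t) (q : Q) (s y : SPath) (l : ℕ)
    (h : mrun C N idx Q₀ R t q = some (s ++ (l, r) :: y)) : s ++ [(l, r)] = p := by
  induction t, ht using Nat.le_induction generalizing q y with
  | base =>
    have hI := (inv_mrun Q₀ R X t0).1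
    rcases last_cases (hI.inc _ _ hp) with ⟨h1, h2⟩ | ⟨s', l', h1, h2⟩
    · have h3 := hI.inc _ _ h
      rw [List.pairwise_cons] at h3
      have := h3.1 r (by simp)
      omega
    · rw [hr] at h1
      rw [h1] at hp
      obtain ⟨rfl, rfl⟩ := hI.uniq _ _ _ _ _ _ _ _ _ h hp
      exact h1.symm
  | succ t ht ih =>
    have hI := inv_mrun Q₀ R X t
    have h1 := prefix_id_le ((inv_mrun Q₀ R X (t+1)).1.inc _ _ h)
    have h2 : mrun C N idx Q₀ R (t+1) q = some ((s ++ [(l, r)]) ++ y) := by rw [h]; simp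
    obtain ⟨y', z, z2, h3, -⟩ := step_back X hI.1 hI.2 (R := R t)
      (fun a ha => (h1 a ha).trans_lt (hT t ht)) h2
    exact ih _ y' (by rw [h3]; simp)

theorem sound_main (X : Ctx C N idx) {r : ℕ} (h : MAcc C N idx Q₀ R r) :
    ∃ ρ : ℕ → Q, ρ 0 ∈ Q₀ ∧ (∀ t, R t (ρ t) (ρ (t+1))) ∧ C.good (InfStates ρ) := by
  obtain ⟨⟨T, hT⟩, hF⟩ := h
  obtain ⟨t0, ht0, q0, p, hp, hr⟩ := hF T
  replace hT : ∀ t ≥ t0, r < erun C N idx Q₀ R t := fun t ht => hT t (by omega)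
  have hpr : ∀ a ∈ p, a.2 ≤ r := by
    rw [← hr]; exact id_le_last ((inv_mrun Q₀ R X t0).1.inc _ _ hp)
  have hfl : ∀ T', ∃ t ≥ T', t ≥ t0 ∧ ∃ q, mrun C N idx Q₀ R t q = some p := by
    intro T'
    obtain ⟨t, ht, q, x, hx, hxr⟩ := hF (T' + t0)
    refine ⟨t, by omega, by omega, q, ?_⟩
    rw [hx]
    congr 1
    have hinc := (inv_mrun Q₀ R X t).1.inc _ _ hx
    rcases last_cases hinc with ⟨h1, h2⟩ | ⟨s', l', h1, h2⟩
    · rcases last_cases ((inv_mrun Q₀ R X t0).1.inc _ _ hp) with ⟨h3, h4⟩ | ⟨s', l', h3, h4⟩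
      · rw [h1, h3]
      · omega
    · rw [hxr] at h1
      rw [h1]
      exact sound_path Q₀ R X hT hp hr t (by omega) q s' [] l' (by rw [hx, h1])
  let pt : ℕ → SPath := fun t => if t0 ≤ t then p else []
  have hpt : ∀ t, ∀ a ∈ pt t, a.2 < erun C N idx Q₀ R t := by
    intro t a ha
    by_cases ht : t0 ≤ t
    · simp only [pt, if_pos ht] at ha
      exact (hpr a ha).trans_lt (hT t ht)
    · simp [pt, if_neg ht] at ha
  have hmono : ∀ t, ∃ u, pt (t+1) = pt t ++ u := by
    intro t
    by_cases ht : t0 ≤ t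
    · exact ⟨[], by simp [pt, ht, Nat.le_succ_of_le ht]⟩
    · exact ⟨pt (t+1), by simp [pt, ht]⟩
  let V : ℕ → Q → Prop := fun t q => ∃ y, mrun C N idx Q₀ R t q = some (pt t ++ y)
  have hback : ∀ t q, V (t+1) q → V t (prd C N idx (mrun C N idx Q₀ R t) (R t) q) := by
    rintro t q ⟨y, hy⟩
    obtain ⟨u, hu⟩ := hmono t
    rw [hu, List.append_assoc] at hy
    have hI := inv_mrun Q₀ R X t
    obtain ⟨y', z, z2, h3, -⟩ := step_back X hI.1 hI.2 (R := R t) (hpt t) hy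
    exact ⟨y', h3⟩
  have hapx : ∀ t q, V t q → ∃ ρ : ℕ → Q, ρ t = q ∧ ∀ s < t,
      (ρ s = prd C N idx (mrun C N idx Q₀ R s) (R s) (ρ (s+1)) ∧ V (s+1) (ρ (s+1))) := by
    intro t
    induction t with
    | zero => exact fun q _ => ⟨fun _ => q, rfl, by simp⟩
    | succ t ih =>
      intro q hq
      obtain ⟨ρ, h1, h2⟩ := ih _ (hback t q hq)
      refine ⟨fun s => if s = t + 1 then q else ρ s, by simp, ?_⟩
      intro s hs
      rcases Nat.lt_succ_iff_lt_or_eq.mp hs with h | rfl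
      · have e1 : s ≠ t + 1 := by omega
        have e2 : s ≠ t := by omega
        simp only [e1, e2, if_false, Nat.add_right_cancel_iff]
        exact h2 s h
      · simp only [if_true]
        refine ⟨?_, hq⟩
        rw [if_neg (by omega), h1]
  obtain ⟨ρ, hρ⟩ := konig (fun s a b => a = prd C N idx (mrun C N idx Q₀ R s) (R s) b ∧ V (s+1) b)
    (by
      intro M
      obtain ⟨t, h1, h2, q, h3⟩ := hfl M
      obtain ⟨ρ, -, h4⟩ := hapx t q ⟨[], by simp [pt, h2, h3]⟩
      exact ⟨ρ, fun s hs => h4 s (by omega)⟩)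
  have hV : ∀ t, V t (ρ t) := by
    intro t
    rw [(hρ t).1]
    exact hback t _ (hρ t).2
  have hR : ∀ t, R t (ρ t) (ρ (t+1)) := by
    intro t
    obtain ⟨y, hy⟩ := hV (t+1)
    have hI := inv_mrun Q₀ R X t
    obtain ⟨y', z, z2, -, h3, -⟩ := step_back X hI.1 hI.2 (R := R t) (p := []) (by simp) hy
    rw [← (hρ t).1] at h3
    exact h3
  have hJ : ∀ t ≥ t0 + 1, ρ t ∈ C.commit Set.univ p := by
    intro t ht
    obtain ⟨t, rfl⟩ : ∃ t', t = t' + 1 := ⟨t - 1, by omega⟩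
    obtain ⟨y, hy⟩ := hV (t+1)
    have e : pt (t+1) = p := by simp only [pt]; rw [if_pos (by omega)]
    rw [e] at hy
    have hI := inv_mrun Q₀ R X t
    obtain ⟨y', z, z2, -, -, h3, -⟩ := step_back X hI.1 hI.2 (R := R t) (p := p)
      (fun a ha => (hpr a ha).trans_lt (hT t (by omega))) hy
    exact C.pass_mem _ _ _ (Set.mem_univ _) h3
  set J := C.commit Set.univ p with hJd
  have hflρ : ∀ t ≥ t0, (∃ q, mrun C N idx Q₀ R t q = some p) → ∀ y,
      mrun C N idx Q₀ R t (ρ t) = some (p ++ y) → y = [] := by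
    rintro t ht ⟨q, hq⟩ y hy
    exact (inv_mrun Q₀ R X t).1.fl _ _ _ _ hq hy
  refine ⟨ρ, ?_, hR, ?_⟩
  · obtain ⟨y, hy⟩ := hV 0
    exact (init0_some _ hy).1
  · refine C.sound J _ (inf_subset ρ J (t0+1) hJ) ?_
    intro j hj
    apply inf_of_frequently
    intro T'
    obtain ⟨t1, h1, h2, hf1⟩ := hfl T'
    obtain ⟨t2, h3, h4, hf2⟩ := hfl (t1 + 1)
    have key : ∀ t ≥ t1,
      (∀ j, C.act J j → ∃ s, t1 < s ∧ ρ s ∈ C.P J j) ∨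
      ∃ y, mrun C N idx Q₀ R t (ρ t) = some (p ++ y) ∧ (y = [] → t = t1) ∧
        ∀ j, C.act J j → labOf C y < j → ∃ s, t1 < s ∧ ρ s ∈ C.P J j := by
      intro t ht
      induction t, ht using Nat.le_induction with
      | base =>
        right
        obtain ⟨y, hy⟩ := hV t1
        simp only [pt, if_pos (show t0 ≤ t1 from h2)] at hy
        have hy0 := hflρ t1 h2 hf1 y hy
        refine ⟨y, hy, fun _ => rfl, ?_⟩
        intro j hj hl
        have := C.actD J j hj
        rw [hy0] at hl
        simp only [labOf] at hl
        omega
      | succ t ht ih =>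
        rcases ih with ih | ⟨y, hy, -, ih⟩
        · exact Or.inl ih
        obtain ⟨y', hy'⟩ := hV (t+1)
        simp only [pt, if_pos (show t0 ≤ t + 1 by omega)] at hy'
        have hI := inv_mrun Q₀ R X t
        obtain ⟨y1, z, z2, g1, -, -, g4, g5, -, g7, -⟩ := step_back X hI.1 hI.2 (R := R t) (p := p)
          (fun a ha => (hpr a ha).trans_lt (hT t (by omega))) hy'
        rw [← (hρ t).1, hy] at g1
        have e1 : y = y1 := by simpa using g1
        subst e1
        obtain ⟨l, i, x, k1, k2⟩ := upd_head (C := C) (N + idx (ρ (t+1))) (ρ (t+1)) J y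
        rw [← hJd, k1] at g4
        have k3 : ∀ j, C.act J j → l < j → ∃ s, t1 < s ∧ ρ s ∈ C.P J j := by
          intro j hj hl
          rcases k2 j hj hl with h | h
          · exact ih j hj h
          · exact ⟨t+1, by omega, h⟩
        cases z with
        | nil =>
          left
          obtain ⟨i', y'', g8⟩ := g7 rfl
          rw [g8] at g4
          simp at g4
          intro j hj
          refine k3 j hj ?_
          rcases Nat.eq_zero_or_pos j with rfl | h
          · exact absurd hj (C.act0 J)
          · omega
        | cons b z =>
          right
          refine ⟨y', hy', ?_, ?_⟩
          · intro e
            rw [e] at g5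
            simp [rmap] at g5
          · intro j hj hl
            apply k3 j hj
            rw [g5] at hl
            simp only [rmap, List.map_cons, labOf] at hl
            simp only [List.cons_append, List.cons.injEq] at g4
            rw [← g4.1] at hl
            exact hl
    rcases key t2 (by omega) with h5 | ⟨y, hy, h6, -⟩
    · obtain ⟨s, h7, h8⟩ := h5 j hj
      exact ⟨s, by omega, h8⟩
    · have := h6 (hflρ t2 h4 hf2 y hy)
      omega

end Sound

section Inst
variable {Q : Type} [Fintype Q] {k : ℕ} (G B : Fin k → Set Q)

def SGood (S : Set Q) : Prop := ∀ i, (S ∩ G i).Nonempty → (S ∩ B i).Nonempty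

noncomputable def sysK : CSys Q where
  D := k
  act J j := ∃ i : Fin k, j = i + 1 ∧ (J ∩ G i).Nonempty
  P J j := {q | ∃ i : Fin k, j = i + 1 ∧ q ∈ B i}
  nx J j := {q | q ∈ J ∧ ∀ i : Fin k, j = i + 1 → q ∉ G i}
  mu J := Set.ncard {i : Fin k | (J ∩ G i).Nonempty}
  good := SGood G B
  act0 := by rintro J ⟨i, h, -⟩; omega
  actD := by rintro J j ⟨i, h, -⟩; omega
  P0 := by
    intro J; ext q
    constructor
    · rintro ⟨i, h, -⟩; omega
    · exact fun h => h.elim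
  nx0 := by
    intro J; ext q
    constructor
    · rintro ⟨h, -⟩; exact h
    · exact fun h => ⟨h, fun i hi => by omega⟩
  mu_lt := by
    rintro J j ⟨i, rfl, hi⟩
    apply Set.ncard_lt_ncard _ (Set.toFinite _)
    refine ⟨?_, ?_⟩
    · rintro i' ⟨q, h1, h2⟩
      exact ⟨q, h1.1, h2⟩
    · intro hc
      obtain ⟨q, h1, h2⟩ := hc (show i ∈ {i : Fin k | (J ∩ G i).Nonempty} from hi)
      exact h1.2 i rfl h2
  mu_univ := by
    have := Set.ncard_le_card {i : Fin k | (Set.univ ∩ G i).Nonempty}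
    simpa using this
  sound := by
    intro J S hS h i hi
    obtain ⟨q, h1, i', h2, h3⟩ := h (i + 1) ⟨i, rfl, hi.mono (Set.inter_subset_inter_left _ hS)⟩
    have : i = i' := Fin.ext (by omega)
    subst this
    exact ⟨q, h1, h3⟩
  complete := by
    rintro J S j hS hg ⟨i, rfl, hi⟩ he q hq
    refine ⟨hS hq, ?_⟩
    intro i' hi' hq'
    have : i = i' := Fin.ext (by omega)
    subst this
    obtain ⟨q2, h1, h2⟩ := hg i ⟨q, hq, hq'⟩
    have h3 : q2 ∈ S ∩ {q | ∃ i' : Fin k, (i : ℕ) + 1 = i' + 1 ∧ q ∈ B i'} := ⟨h1, i, rfl, h2⟩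
    rw [he] at h3
    exact h3

omit [Fintype Q] in
theorem exists_bad {S : Set Q} (h : ¬ SGood G B S) : ∃ i, (S ∩ G i).Nonempty ∧ S ∩ B i = ∅ := by
  unfold SGood at h
  push Not at h
  exact h

open Classical in
noncomputable def badG (S : Set Q) : Set Q :=
  if h : SGood G B S then ∅ else G (exists_bad G B h).choose

omit [Fintype Q] in
theorem badG_nonempty {S : Set Q} (h : ¬ SGood G B S) : (S ∩ badG G B S).Nonempty := by
  unfold badG
  rw [dif_neg h]
  exact (exists_bad G B h).choose_spec.1

omit [Fintype Q] in
theorem badG_disj {J S : Set Q} (h : ¬ SGood G B J) (hS : S ⊆ J) (hg : SGood G B S) :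
    ∀ q ∈ S, q ∉ badG G B J := by
  unfold badG
  rw [dif_neg h]
  intro q hq hq2
  obtain ⟨q', h1, h2⟩ := hg _ ⟨q, hq, hq2⟩
  have h3 := (exists_bad G B h).choose_spec.2
  have h4 : q' ∈ J ∩ B (exists_bad G B h).choose := ⟨hS h1, h2⟩
  rw [h3] at h4
  exact h4

noncomputable def sysN (hn : 1 ≤ Fintype.card Q) : CSys Q where
  D := Fintype.card Q
  act J j := (SGood G B J ∧ ∃ q ∈ J, j = Fintype.equivFin Q q + 1) ∨ (¬ SGood G B J ∧ j = 1)
  P J j := {q | SGood G B J ∧ j = Fintype.equivFin Q q + 1}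
  nx J j := {q | q ∈ J ∧ (SGood G B J → j ≠ Fintype.equivFin Q q + 1) ∧
    (¬ SGood G B J → j = 1 → q ∉ badG G B J)}
  mu J := J.ncard
  good := SGood G B
  act0 := by
    rintro J (⟨-, q, -, h⟩ | ⟨-, h⟩) <;> omega
  actD := by
    rintro J j (⟨-, q, -, h⟩ | ⟨-, h⟩) <;> omega
  P0 := by
    intro J; ext q
    constructor
    · rintro ⟨-, h⟩; omega
    · exact fun h => h.elim
  nx0 := by
    intro J; ext q
    constructor
    · rintro ⟨h, -⟩; exact h
    · exact fun h => ⟨h, fun _ => by omega, fun _ => by omega⟩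
  mu_lt := by
    intro J j h
    apply Set.ncard_lt_ncard _ (Set.toFinite _)
    refine ⟨fun q hq => hq.1, ?_⟩
    intro hc
    rcases h with ⟨hg, q, hq, rfl⟩ | ⟨hg, rfl⟩
    · exact (hc hq).2.1 hg rfl
    · obtain ⟨q, h1, h2⟩ := badG_nonempty G B hg
      exact (hc h1).2.2 hg rfl h2
  mu_univ := by
    rw [Set.ncard_univ, Nat.card_eq_fintype_card]
  sound := by
    intro J S hS h
    by_cases hg : SGood G B J
    · have : S = J := by
        apply Set.Subset.antisymm hS
        intro q hq
        obtain ⟨q', h1, -, h2⟩ := h _ (Or.inl ⟨hg, q, hq, rfl⟩)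
        have : q = q' := (Fintype.equivFin Q).injective (Fin.ext (by omega))
        rw [this]; exact h1
      rw [this]; exact hg
    · obtain ⟨q', h1, h2, -⟩ := h 1 (Or.inr ⟨hg, rfl⟩)
      exact absurd h2 hg
  complete := by
    intro J S j hS hgS h he q hq
    refine ⟨hS hq, ?_, ?_⟩
    · intro hg hj
      have h3 : q ∈ S ∩ {q | SGood G B J ∧ j = Fintype.equivFin Q q + 1} := ⟨hq, hg, hj⟩
      rw [he] at h3
      exact h3
    · intro hg hj
      exact badG_disj G B hg hS hgS q hq

theorem exists_sys (hn : 1 ≤ Fintype.card Q) :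
    ∃ C : CSys Q, C.D = min (Fintype.card Q) k ∧ C.good = SGood G B := by
  rcases le_total (Fintype.card Q) k with h | h
  · exact ⟨sysN G B hn, by rw [min_eq_left h]; rfl, rfl⟩
  · exact ⟨sysK G B, by rw [min_eq_right h]; rfl, rfl⟩
end Inst

section Final

def encL (D N L : ℕ) (hN : 0 < N) (x : SPath) : Fin L → Option (Fin (D+1) × Fin N) :=
  fun i => (x[(i : ℕ)]?).map fun a => (⟨min a.1 D, by omega⟩, ⟨a.2 % N, Nat.mod_lt _ hN⟩)

theorem encL_inj {D N L : ℕ} (hN : 0 < N) {x y : SPath} (hx : x.length ≤ L) (hy : y.length ≤ L)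
    (bx : ∀ a ∈ x, a.1 ≤ D ∧ a.2 < N) (bY : ∀ a ∈ y, a.1 ≤ D ∧ a.2 < N)
    (h : encL D N L hN x = encL D N L hN y) : x = y := by
  apply List.ext_getElem?
  intro i
  by_cases hi : i < L
  · have h1 := congrFun h ⟨i, hi⟩
    simp only [encL] at h1
    rcases e1 : x[i]? with _ | a <;> rcases e2 : y[i]? with _ | b
    · rfl
    · simp [e1, e2] at h1
    · simp [e1, e2] at h1
    · have h2 := bx a (List.mem_of_getElem? e1)
      have h3 := bY b (List.mem_of_getElem? e2)
      simp only [e1, e2, Option.map_some, Option.some.injEq, Prod.mk.injEq, Fin.mk.injEq] at h1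
      rw [Nat.mod_eq_of_lt h2.2, Nat.mod_eq_of_lt h3.2] at h1
      have : a = b := Prod.ext (by omega) h1.2
      rw [this]
  · rw [List.getElem?_eq_none (by omega), List.getElem?_eq_none (by omega)]

theorem bound_nat (n D N : ℕ) (hn : 2 ≤ n) (hD : D ≤ n) (hN : N = n * (D + 1)) :
    ((((D+1)*N+1)^(n+D)+1)^n)*(N+1) ≤ n ^ (14 * n^2) := by
  have a1 : n + 1 ≤ n^2 := by nlinarith
  have a2 : N ≤ n * n^2 := by
    rw [hN]; exact Nat.mul_le_mul_left _ (by omega)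
  have pw : ∀ j, n^j + 1 ≤ n^(j+1) := by
    intro j
    have := Nat.one_le_pow j n (by omega)
    rw [pow_succ]; nlinarith
  have a3 : (D+1)*N + 1 ≤ n^6 := by
    have h1 : (D+1)*N ≤ n^2 * (n * n^2) := Nat.mul_le_mul (by omega) a2
    have h2 : n^2 * (n * n^2) = n^5 := by ring
    have : n^5 + 1 ≤ n^6 := pw 5
    omega
  have a4 : N + 1 ≤ n^4 := by
    have h2 : n * n^2 = n^3 := by ring
    have : n^3 + 1 ≤ n^4 := pw 3
    omega
  have a5 : ((D+1)*N+1)^(n+D) + 1 ≤ n^(12*n+1) := by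
    have h1 : ((D+1)*N+1)^(n+D) ≤ (n^6)^(2*n) :=
      (Nat.pow_le_pow_left a3 _).trans (Nat.pow_le_pow_right (by positivity) (by omega))
    have h2 : (n^6)^(2*n) = n^(12*n) := by rw [← pow_mul]; ring_nf
    have := pw (12*n)
    omega
  calc _ ≤ (n^(12*n+1))^n * n^4 := Nat.mul_le_mul (Nat.pow_le_pow_left a5 _) a4
    _ = n^((12*n+1)*n+4) := by rw [← pow_mul, ← pow_add]
    _ ≤ _ := Nat.pow_le_pow_right (by omega) (by nlinarith)

theorem bound_real (n m : ℕ) (hn : 2 ≤ n) (h : m ≤ n ^ (14 * n^2)) :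
    (m : ℝ) ≤ (2 : ℝ) ^ ((14 : ℝ) * (n : ℝ) ^ 2 * Real.logb 2 n) := by
  have h1 : (m : ℝ) ≤ (n : ℝ) ^ (14 * n^2) := by exact_mod_cast h
  have hpos : (0 : ℝ) < n := by positivity
  rw [mul_comm, Real.rpow_mul (by norm_num), Real.rpow_logb (by norm_num) (by norm_num) hpos]
  have h2 : ((14 : ℝ) * (n : ℝ)^2) = ((14 * n^2 : ℕ) : ℝ) := by push_cast; ring
  rw [h2, Real.rpow_natCast]
  exact h1

variable {Q : Type} [Fintype Q] (C : CSys Q) (N : ℕ) (idx : Q → ℕ)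

abbrev VS : Type := {v : Mac Q × ℕ // MInv C v.1 ∧ IdsLt N v.1 ∧ v.2 ≤ N}

variable {C N idx}

noncomputable def encV (X : Ctx C N idx) (v : VS C N) :
    (Q → Option (Fin (Fintype.card Q + C.D) → Option (Fin (C.D+1) × Fin N))) × Fin (N+1) :=
  (fun q => (v.1.1 q).map (encL C.D N _ X.Npos), ⟨v.1.2, Nat.lt_succ_of_le v.2.2.2⟩)

theorem VS_bd (v : VS C N) {q : Q} {x : SPath} (h : v.1.1 q = some x) :
    x.length ≤ Fintype.card Q + C.D ∧ ∀ a ∈ x, a.1 ≤ C.D ∧ a.2 < N := by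
  refine ⟨length_le v.2.1 h, ?_⟩
  intro a ha
  refine ⟨?_, v.2.2.1 q x h a ha⟩
  obtain ⟨s, y, rfl⟩ := List.append_of_mem ha
  rcases v.2.1.lab q _ h s a y rfl with h0 | h0
  · omega
  · exact C.actD _ _ h0

theorem encV_inj (X : Ctx C N idx) : Function.Injective (encV X) := by
  intro v v' h
  simp only [encV, Prod.mk.injEq, Fin.mk.injEq] at h
  apply Subtype.ext
  refine Prod.ext ?_ h.2
  funext q
  have h1 := congrFun h.1 q
  rcases e1 : v.1.1 q with _ | x <;> rcases e2 : v'.1.1 q with _ | y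
  · rfl
  · simp [e1, e2] at h1
  · simp [e1, e2] at h1
  · simp only [e1, e2, Option.map_some, Option.some.injEq] at h1
    rw [encL_inj X.Npos (VS_bd v e1).1 (VS_bd v' e2).1 (VS_bd v e1).2 (VS_bd v' e2).2 h1]

theorem VS_finite (X : Ctx C N idx) : Finite (VS C N) := Finite.of_injective _ (encV_inj X)

theorem VS_card (X : Ctx C N idx) : Nat.card (VS C N) ≤
    ((((C.D+1)*N+1)^(Fintype.card Q+C.D)+1)^(Fintype.card Q))*(N+1) := by
  classical
  have h := Nat.card_le_card_of_injective _ (encV_inj X)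
  refine h.trans (le_of_eq ?_)
  rw [Nat.card_eq_fintype_card]
  simp

noncomputable def vstep (X : Ctx C N idx) (R : Q → Q → Prop) (v : VS C N) : VS C N :=
  ⟨(stepF C N idx R v.1.1, stepE C N idx R v.1.1),
    inv_step X v.2.1 v.2.2.1 R, ids_step X v.2.1 v.2.2.1 R, stepE_le X v.2.1 v.2.2.1 R⟩

noncomputable def vinit (C : CSys Q) (N : ℕ) (Q₀ : Set Q) : VS C N :=
  ⟨(init0 Q₀, 0), inv_init0 C Q₀, ids_init0 N Q₀, Nat.zero_le _⟩

theorem vrun_fst (X : Ctx C N idx) (Q₀ : Set Q) (R : ℕ → Q → Q → Prop) (v : ℕ → VS C N)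
    (h0 : v 0 = vinit C N Q₀) (h : ∀ t, v (t+1) = vstep X (R t) (v t)) (t : ℕ) :
    (v t).1.1 = mrun C N idx Q₀ R t := by
  induction t with
  | zero => rw [h0]; rfl
  | succ t ih =>
    rw [h]
    simp only [vstep, mrun, ih]

theorem vrun_snd (X : Ctx C N idx) (Q₀ : Set Q) (R : ℕ → Q → Q → Prop) (v : ℕ → VS C N)
    (h0 : v 0 = vinit C N Q₀) (h : ∀ t, v (t+1) = vstep X (R t) (v t)) (t : ℕ) :
    (v (t+1)).1.2 = erun C N idx Q₀ R t := by
  rw [h]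
  simp only [vstep, erun, vrun_fst X Q₀ R v h0 h t]

theorem rabin_iff (X : Ctx C N idx) (Q₀ : Set Q) (R : ℕ → Q → Q → Prop) {m : ℕ}
    (E : VS C N ≃ Fin m) (ρ : ℕ → Fin m) (h0 : ρ 0 = E (vinit C N Q₀))
    (h : ∀ t, ρ (t+1) = E (vstep X (R t) (E.symm (ρ t)))) (r : ℕ) :
    ((InfStates ρ ∩ {s | ∃ q x, (E.symm s).1.1 q = some x ∧ lastId x = r}).Nonempty ∧
      InfStates ρ ∩ {s | (E.symm s).1.2 ≤ r} = ∅) ↔ MAcc C N idx Q₀ R r := by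
  have k0 : E.symm (ρ 0) = vinit C N Q₀ := by rw [h0]; simp
  have k1 : ∀ t, E.symm (ρ (t+1)) = vstep X (R t) (E.symm (ρ t)) := by
    intro t; rw [h]; simp
  have hf := vrun_fst X Q₀ R (fun t => E.symm (ρ t)) k0 k1
  have hs := vrun_snd X Q₀ R (fun t => E.symm (ρ t)) k0 k1
  constructor
  · rintro ⟨⟨s, hs1, hs2⟩, he⟩
    refine ⟨?_, ?_⟩
    · obtain ⟨T, hT⟩ := eventually_inf ρ
      refine ⟨T, fun t ht => ?_⟩
      rw [← hs t]
      by_contra hc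
      have : ρ (t+1) ∈ InfStates ρ ∩ {s | (E.symm s).1.2 ≤ r} := ⟨hT _ (by omega), not_lt.mp hc⟩
      rw [he] at this
      exact this
    · intro T
      obtain ⟨t, ht, rfl⟩ := hs1 T
      obtain ⟨q, x, h1, h2⟩ := hs2
      exact ⟨t, ht, q, x, by rw [← hf t]; exact h1, h2⟩
  · rintro ⟨⟨T, hT⟩, hF⟩
    refine ⟨?_, ?_⟩
    · apply inf_of_frequently
      intro T'
      obtain ⟨t, ht, q, x, h1, h2⟩ := hF T'
      exact ⟨t, ht, q, x, by rw [← hf t] at h1; exact h1, h2⟩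
    · apply Set.eq_empty_of_forall_notMem
      rintro s ⟨h1, h2⟩
      obtain ⟨t, ht, rfl⟩ := h1 (T+1)
      obtain ⟨t, rfl⟩ : ∃ t', t = t' + 1 := ⟨t - 1, by omega⟩
      have h3 := hT t (by omega)
      rw [← hs t] at h3
      exact absurd h2 (not_le.mpr h3)

end Final

/-- Streett determinization, asymptotic form `2^{O(n² log n)}`: there is a
constant `c > 0` such that every nondeterministic Streett automaton with
`n ≥ 2` states and index size `k ≥ 1` has an equivalent deterministic Rabin
automaton with at most `2^{c·n²·log₂ n}` states and index size at most
`n·(min(n,k)+1)`. -/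
theorem streett_determinization_general :
    ∃ c : ℝ, 0 < c ∧ ∀ (α Q : Type) (_ : Fintype α) (_ : Nonempty α) (_ : Fintype Q)
      (n k : ℕ), Fintype.card Q = n → 2 ≤ n → 1 ≤ k →
      ∀ (Q₀ : Set Q) (Δ : Q → α → Q → Prop) (G B : Fin k → Set Q),
      ∃ (m kB : ℕ) (init : Fin m) (δ : Fin m → α → Fin m)
        (G' B' : Fin kB → Set (Fin m)),
        (m : ℝ) ≤ (2 : ℝ) ^ (c * (n : ℝ) ^ 2 * Real.logb 2 n) ∧
        kB ≤ n * (min n k + 1) ∧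
        ∀ w : ℕ → α,
          (∃ ρ : ℕ → Q, ρ 0 ∈ Q₀ ∧ (∀ i : ℕ, Δ (ρ i) (w i) (ρ (i + 1))) ∧
            ∀ i : Fin k, (InfStates ρ ∩ G i).Nonempty → (InfStates ρ ∩ B i).Nonempty) ↔
          (∃ ρ : ℕ → Fin m, ρ 0 = init ∧ (∀ i : ℕ, ρ (i + 1) = δ (ρ i) (w i)) ∧
            ∃ i : Fin kB, (InfStates ρ ∩ G' i).Nonempty ∧ InfStates ρ ∩ B' i = ∅) := by
  refine ⟨14, by norm_num, ?_⟩
  intro α Q _ _ _ n k hcard hn hk Q₀ Δ G B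
  obtain ⟨C, hD, hgood⟩ := exists_sys G B (by omega : 1 ≤ Fintype.card Q)
  rw [hcard] at hD
  have X : Ctx C (n * (C.D + 1)) (fun q => (Fintype.equivFin Q q : ℕ)) :=
    ⟨fun a b h => (Fintype.equivFin Q).injective (Fin.ext h), by rw [hcard], by omega⟩
  have hfin := VS_finite X
  let E := Finite.equivFin (VS C (n * (C.D + 1)))
  refine ⟨Nat.card (VS C (n * (C.D + 1))), n * (C.D + 1), E (vinit C _ Q₀),
    fun s a => E (vstep X (fun q q' => Δ q a q') (E.symm s)),
    fun r => {s | ∃ q x, (E.symm s).1.1 q = some x ∧ lastId x = r},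
    fun r => {s | (E.symm s).1.2 ≤ r}, ?_, ?_, ?_⟩
  · refine bound_real n _ hn ((VS_card X).trans ?_)
    rw [hcard]
    exact bound_nat n C.D _ hn (by rw [hD]; exact min_le_left _ _) rfl
  · rw [hD]
  · intro w
    constructor
    · rintro ⟨ρ, h0, h1, h2⟩
      obtain ⟨r, hr, hacc⟩ := complete_main Q₀ (fun t q q' => Δ q (w t) q') X ρ h0 h1
        (by rw [hgood]; exact h2)
      let σ : ℕ → Fin (Nat.card (VS C (n * (C.D + 1)))) := fun t => Nat.rec (E (vinit C _ Q₀))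
        (fun t s => E (vstep X (fun q q' => Δ q (w t) q') (E.symm s))) t
      refine ⟨σ, rfl, fun t => rfl, ⟨r, hr⟩, ?_⟩
      exact (rabin_iff X Q₀ (fun t q q' => Δ q (w t) q') E σ rfl (fun t => rfl) r).mpr hacc
    · rintro ⟨σ, h0, h1, r, hr⟩
      have hacc := (rabin_iff X Q₀ (fun t q q' => Δ q (w t) q') E σ h0 h1 r).mp hr
      obtain ⟨ρ, g0, g1, g2⟩ := sound_main Q₀ (fun t q q' => Δ q (w t) q') X hacc
      rw [hgood] at g2
      exact ⟨ρ, g0, g1, g2⟩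
end

section
/- There exists a constant c > 0 such that for every nondeterministic Streett automaton A with n ≥ 1 states and index size k with 1 ≤ k ≤ n, there exists a deterministic Rabin automaton B over the same alphabet with L(B) = L(A), whose number of states is at most 2^{c·(n·log₂(n+1) + n·k·log₂(k+1))} and whose index size is at most n·(k+1). -/
namespace SD
open Classical

abbrev Pth := List (ℕ × ℕ)

noncomputable def hope (k : ℕ) (v : Pth) : Finset ℕ :=
  (Finset.Icc 1 k).filter (fun j => j ∉ v.map Prod.fst)

lemma hope_snoc (k : ℕ) (v : Pth) (j c : ℕ) : hope k (v ++ [(j, c)]) = (hope k v).erase j := by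
  ext x
  simp only [hope, Finset.mem_filter, Finset.mem_erase, List.map_append, List.mem_append,
    List.map_cons, List.map_nil, List.mem_singleton]
  tauto

lemma hope_pos {k : ℕ} {v : Pth} {j : ℕ} (h : j ∈ hope k v) : j ≠ 0 := by
  simp [hope] at h; omega

lemma hope_snoc_zero (k : ℕ) (v : Pth) (c : ℕ) : hope k (v ++ [(0, c)]) = hope k v := by
  rw [hope_snoc]; exact Finset.erase_eq_of_notMem (fun h => hope_pos h rfl)

lemma hope_card_le (k : ℕ) (v : Pth) : (hope k v).card ≤ k := by
  have := Finset.card_filter_le (Finset.Icc 1 k) (fun j => j ∉ v.map Prod.fst)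
  simpa [hope] using this

def fr (n : ℕ) (u : Pth) (j : ℕ) : ℕ := n + Encodable.encode (u, j)

lemma fr_inj {n : ℕ} {u u' : Pth} {j j' : ℕ} (h : fr n u j = fr n u' j') : u = u' ∧ j = j' := by
  have : Encodable.encode (u, j) = Encodable.encode (u', j') := by unfold fr at h; omega
  have := Encodable.encode_injective this
  simpa using this

lemma fr_ge (n : ℕ) (u : Pth) (j : ℕ) : n ≤ fr n u j := by unfold fr; omega

def fe (n : ℕ) (u : Pth) (j : ℕ) : Pth := u ++ [(j, fr n u j)]

noncomputable def nxt (k : ℕ) (u : Pth) (j : ℕ) : ℕ := ((hope k u).filter (· < j)).sup id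

lemma nxt_spec (k : ℕ) (u : Pth) (j : ℕ) : nxt k u j = 0 ∨ nxt k u j ∈ hope k u := by
  rcases ((hope k u).filter (· < j)).eq_empty_or_nonempty with h | h
  · left; simp [nxt, h]
  · right
    obtain ⟨x, hx, h2⟩ := Finset.exists_mem_eq_sup _ h id
    unfold nxt; rw [h2]; exact (Finset.mem_filter.1 hx).1

lemma nxt_lt (k : ℕ) (u : Pth) {j : ℕ} (hj : j ≠ 0) : nxt k u j < j := by
  unfold nxt
  rw [Finset.sup_lt_iff (by simpa using Nat.pos_of_ne_zero hj)]
  intro b hb; exact (Finset.mem_filter.1 hb).2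

lemma le_nxt (k : ℕ) (u : Pth) {i j : ℕ} (hi : i ∈ hope k u) (h : i < j) : i ≤ nxt k u j :=
  Finset.le_sup (f := id) (Finset.mem_filter.2 ⟨hi, h⟩)

/-! prefix helper -/

lemma snoc_cases (v : Pth) : v = [] ∨ ∃ u j c, v = u ++ [(j, c)] := by
  rcases List.eq_nil_or_concat v with h | ⟨u, e, h⟩
  · exact Or.inl h
  · exact Or.inr ⟨u, e.1, e.2, by simpa using h⟩

lemma prefix_snoc {w u : Pth} {e : ℕ × ℕ} (h : w <+: u ++ [e]) : w = u ++ [e] ∨ w <+: u := by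
  rwa [List.prefix_concat_iff] at h

lemma exists_next {v p : Pth} (h : v <+: p) (hne : v ≠ p) : ∃ e, v ++ [e] <+: p := by
  obtain ⟨s, rfl⟩ := h
  cases s with
  | nil => simp at hne
  | cons e s => exact ⟨e, s, by simp⟩

/-! nodes -/
section
variable {Q : Type}

def Nodes (R : Q → Option Pth) : Set Pth := {v | ∃ q p, R q = some p ∧ v <+: p}

lemma Nodes.pre {R : Q → Option Pth} {u v : Pth} (h : v ∈ Nodes R) (huv : u <+: v) : u ∈ Nodes R := by
  obtain ⟨q, p, h1, h2⟩ := h; exact ⟨q, p, h1, huv.trans h2⟩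

lemma Nodes.snoc {R : Q → Option Pth} {u : Pth} {e} (h : u ++ [e] ∈ Nodes R) : u ∈ Nodes R :=
  Nodes.pre h (List.prefix_append _ _)
end

structure Pre (n k : ℕ) (N : Set Pth) : Prop where
  wf : ∀ u j c, u ++ [(j, c)] ∈ N → j = 0 ∨ j ∈ hope k u
  u1 : ∀ u j j' c, u ++ [(j, c)] ∈ N → u ++ [(j', c)] ∈ N → j = j'
  i1 : ∀ u u' j j' c, c ≠ 0 → u ++ [(j, c)] ∈ N → u' ++ [(j', c)] ∈ N → u = u' ∧ j = j'
  i0 : ∀ u, u ++ [(0, 0)] ∉ N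
  fr : ∀ u j c, u ++ [(j, c)] ∈ N → c < n ∨ c = fr n u j

lemma Pre.extend {n k : ℕ} (hn : 1 ≤ n) {N N' : Set Pth} (h : Pre n k N)
    (hs : ∀ v ∈ N', v ∈ N ∨ ∃ u j, v = fe n u j ∧ (j = 0 ∨ j ∈ hope k u)) : Pre n k N' := by
  have key : ∀ u j c, u ++ [(j, c)] ∈ N' →
      (u ++ [(j, c)] ∈ N ∧ c < n) ∨ (c = SD.fr n u j ∧ n ≤ c ∧ (j = 0 ∨ j ∈ hope k u)) := by
    intro u j c hv
    have fresh : ∀ j', c = SD.fr n u j' → n ≤ c := by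
      intro j' hc; rw [hc]; exact fr_ge _ _ _
    rcases hs _ hv with h1 | ⟨u', j', h1, h2⟩
    · rcases h.fr _ _ _ h1 with h3 | h3
      · exact Or.inl ⟨h1, h3⟩
      · exact Or.inr ⟨h3, fresh _ h3, h.wf _ _ _ h1⟩
    · unfold fe at h1
      have := List.append_inj' h1 rfl
      obtain ⟨rfl, h4⟩ := this
      simp only [List.cons.injEq, Prod.mk.injEq, and_true] at h4
      obtain ⟨rfl, h5⟩ := h4
      exact Or.inr ⟨h5, fresh _ h5, h2⟩
  refine ⟨?_, ?_, ?_, ?_, ?_⟩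
  · intro u j c hv
    rcases key _ _ _ hv with h1 | h1
    · exact h.wf _ _ _ h1.1
    · exact h1.2.2
  · intro u j j' c hv hv'
    rcases key _ _ _ hv with h1 | h1 <;> rcases key _ _ _ hv' with h2 | h2
    · exact h.u1 _ _ _ _ h1.1 h2.1
    · omega
    · omega
    · exact (fr_inj (h1.1.symm.trans h2.1)).2
  · intro u u' j j' c hc hv hv'
    rcases key _ _ _ hv with h1 | h1 <;> rcases key _ _ _ hv' with h2 | h2
    · exact h.i1 _ _ _ _ _ hc h1.1 h2.1
    · omega
    · omega
    · exact (fr_inj (h1.1.symm.trans h2.1))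
  · intro u hv
    rcases key _ _ _ hv with h1 | h1
    · exact h.i0 _ h1.1
    · omega
  · intro u j c hv
    rcases key _ _ _ hv with h1 | h1
    · exact Or.inl h1.2
    · exact Or.inr h1.1

/-! trunc -/
noncomputable def trunc (gr : Pth → Prop) : Pth → Pth → Pth
  | pre, [] => pre
  | pre, e :: t => if gr pre then pre else trunc gr (pre ++ [e]) t

lemma trunc_spec (gr : Pth → Prop) (pre rest : Pth) :
    ∃ a, a <+: rest ∧ trunc gr pre rest = pre ++ a ∧ (∀ b, b <+: a → b ≠ a → ¬ gr (pre ++ b)) ∧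
      (a = rest ∨ gr (pre ++ a)) := by
  induction rest generalizing pre with
  | nil => exact ⟨[], by simp, by simp [trunc], by simp, by simp⟩
  | cons e t ih =>
    by_cases h : gr pre
    · exact ⟨[], by simp, by simp [trunc, h], by simp, by simp [h]⟩
    · obtain ⟨a, h1, h2, h3, h4⟩ := ih (pre ++ [e])
      refine ⟨e :: a, by simpa using h1, by simp [trunc, h, h2], ?_, ?_⟩
      · intro b hb hne
        cases b with
        | nil => simpa using h
        | cons e' b =>
          rw [List.cons_prefix_cons] at hb
          obtain ⟨rfl, hb⟩ := hb
          have := h3 b hb (by rintro rfl; exact hne rfl)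
          simpa using this
      · rcases h4 with h4 | h4
        · left; rw [h4]
        · right; simpa using h4

lemma trunc_prefix (gr : Pth → Prop) (p : Pth) : trunc gr [] p <+: p := by
  obtain ⟨a, h1, h2, -⟩ := trunc_spec gr [] p
  rw [h2]; simpa using h1

lemma trunc_iff (gr : Pth → Prop) (p v : Pth) :
    v <+: trunc gr [] p ↔ v <+: p ∧ ∀ u, u <+: v → u ≠ v → ¬ gr u := by
  obtain ⟨a, h1, h2, h3, h4⟩ := trunc_spec gr [] p
  simp only [List.nil_append] at *
  rw [h2]
  constructor
  · intro h
    refine ⟨h.trans h1, fun u hu hne => h3 u (hu.trans h) ?_⟩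
    rintro rfl
    exact hne (hu.eq_of_length_le h.length_le)
  · rintro ⟨h5, h6⟩
    rcases List.prefix_or_prefix_of_prefix h5 h1 with h | h
    · exact h
    · rcases h4 with rfl | h4
      · exact h5
      · by_cases hav : a = v
        · rw [hav]
        · exact absurd h4 (h6 a h hav)

/-! ext -/
noncomputable def ext1 (n k : ℕ) (v : Pth) : Pth :=
  if hope k v = ∅ then v else fe n v ((hope k v).sup id)

lemma sup_hope_mem {k : ℕ} {v : Pth} (h : hope k v ≠ ∅) : (hope k v).sup id ∈ hope k v := by
  obtain ⟨x, hx, h2⟩ := Finset.exists_mem_eq_sup _ (Finset.nonempty_iff_ne_empty.2 h) id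
  rw [h2]; exact hx

noncomputable def ext (n k : ℕ) (v : Pth) : Pth := (ext1 n k)^[k] v

lemma ext_iter (n k m : ℕ) (v : Pth) :
    v <+: (ext1 n k)^[m] v ∧ (hope k ((ext1 n k)^[m] v)).card ≤ (hope k v).card - m ∧
    (∀ w, w <+: (ext1 n k)^[m] v → w <+: v ∨ ∃ u j, w = fe n u j ∧ j ∈ hope k u) ∧
    (1 ≤ m → hope k v ≠ ∅ → fe n v ((hope k v).sup id) <+: (ext1 n k)^[m] v) := by
  induction m generalizing v with
  | zero => simp +contextual
  | succ m ih =>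
    rw [Function.iterate_succ_apply]
    by_cases h : hope k v = ∅
    · have : ext1 n k v = v := by simp [ext1, h]
      rw [this]
      obtain ⟨a, b, c, d⟩ := ih v
      exact ⟨a, by simp [h] at b ⊢; exact b, c, fun _ h' => absurd h h'⟩
    · have : ext1 n k v = fe n v ((hope k v).sup id) := by simp [ext1, h]
      rw [this]
      obtain ⟨a, b, c, d⟩ := ih (fe n v ((hope k v).sup id))
      refine ⟨(List.prefix_append _ _).trans a, ?_, ?_, fun _ _ => a⟩
      · have h2 : (hope k (fe n v ((hope k v).sup id))).card = (hope k v).card - 1 := by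
          unfold fe; rw [hope_snoc, Finset.card_erase_of_mem (sup_hope_mem h)]
        omega
      · intro w hw
        rcases c w hw with h1 | h1
        · rcases prefix_snoc h1 with h2 | h2
          · exact Or.inr ⟨v, _, h2, sup_hope_mem h⟩
          · exact Or.inl h2
        · exact Or.inr h1

lemma ext_prefix (n k : ℕ) (v : Pth) : v <+: ext n k v := (ext_iter n k k v).1
lemma ext_full (n k : ℕ) (v : Pth) : hope k (ext n k v) = ∅ := by
  have := (ext_iter n k k v).2.1
  have h2 := hope_card_le k v
  rw [← Finset.card_eq_zero]; unfold ext; omega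
lemma ext_cases {n k : ℕ} {v w : Pth} (h : w <+: ext n k v) :
    w <+: v ∨ ∃ u j, w = fe n u j ∧ j ∈ hope k u := (ext_iter n k k v).2.2.1 w h
lemma ext_first {n k : ℕ} (hk : 1 ≤ k) {v : Pth} (h : hope k v ≠ ∅) :
    fe n v ((hope k v).sup id) <+: ext n k v := (ext_iter n k k v).2.2.2 hk h

/-! renaming -/
def prom (N : Set Pth) (u : Pth) (c : ℕ) : Prop :=
  (∃ j, j ≠ 0 ∧ u ++ [(j, c)] ∈ N) ∧ ∀ j' c', j' ≠ 0 → u ++ [(j', c')] ∈ N → c ≤ c'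

def SS (N : Set Pth) : Set ℕ := {c | ∃ u j, u ++ [(j, c)] ∈ N ∧ ¬ (j ≠ 0 ∧ prom N u c)}

noncomputable def comp (N : Set Pth) (c : ℕ) : ℕ := 1 + {c' | c' ∈ SS N ∧ c' < c}.ncard

noncomputable def re (N : Set Pth) (u : Pth) (e : ℕ × ℕ) : ℕ × ℕ :=
  (e.1, if e.1 ≠ 0 ∧ prom N u e.2 then 0 else comp N e.2)

noncomputable def nu (N : Set Pth) : Pth → Pth → Pth
  | _, [] => []
  | pre, e :: t => re N pre e :: nu N (pre ++ [e]) t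

lemma nu_append (N : Set Pth) (pre a b : Pth) :
    nu N pre (a ++ b) = nu N pre a ++ nu N (pre ++ a) b := by
  induction a generalizing pre with
  | nil => simp [nu]
  | cons e t ih => simp [nu, ih]

lemma nu_snoc (N : Set Pth) (u : Pth) (e : ℕ × ℕ) :
    nu N [] (u ++ [e]) = nu N [] u ++ [re N u e] := by
  rw [nu_append]; simp [nu]

lemma nu_length (N : Set Pth) (pre a : Pth) : (nu N pre a).length = a.length := by
  induction a generalizing pre with
  | nil => simp [nu]
  | cons e t ih => simp [nu, ih]

lemma nu_labels (N : Set Pth) (pre a : Pth) : (nu N pre a).map Prod.fst = a.map Prod.fst := by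
  induction a generalizing pre with
  | nil => simp [nu]
  | cons e t ih => simp [nu, ih, re]

lemma nu_hope (N : Set Pth) (k : ℕ) (a : Pth) : hope k (nu N [] a) = hope k a := by
  unfold hope; rw [nu_labels]

lemma nu_mono (N : Set Pth) {u v : Pth} (h : u <+: v) : nu N [] u <+: nu N [] v := by
  obtain ⟨s, rfl⟩ := h
  rw [nu_append]; exact List.prefix_append _ _

lemma nu_prefix (N : Set Pth) {v' p : Pth} (h : v' <+: nu N [] p) :
    ∃ v, v <+: p ∧ v' = nu N [] v := by
  refine ⟨p.take v'.length, List.take_prefix _ _, ?_⟩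
  have h1 := nu_mono N (List.take_prefix v'.length p)
  have hl := h.length_le
  rw [nu_length] at hl
  refine List.IsPrefix.eq_of_length (List.prefix_of_prefix_length_le h h1 ?_) ?_
  · rw [nu_length, List.length_take]; omega
  · rw [nu_length, List.length_take]; omega

lemma comp_fin (N : Set Pth) (c : ℕ) : {c' | c' ∈ SS N ∧ c' < c}.Finite :=
  (Set.finite_Iio c).subset (fun _ h => h.2)

lemma comp_lt (N : Set Pth) {c d : ℕ} (hc : c ∈ SS N) (h : c < d) : comp N c < comp N d := by
  unfold comp
  have : {c' | c' ∈ SS N ∧ c' < c}.ncard < {c' | c' ∈ SS N ∧ c' < d}.ncard := by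
    apply Set.ncard_lt_ncard _ (comp_fin N d)
    refine ⟨fun x hx => ⟨hx.1, hx.2.trans h⟩, fun hh => ?_⟩
    have := hh (show c ∈ _ from ⟨hc, h⟩)
    exact lt_irrefl _ this.2
  omega

lemma comp_inj (N : Set Pth) {c d : ℕ} (hc : c ∈ SS N) (hd : d ∈ SS N) (h : comp N c = comp N d) :
    c = d := by
  rcases lt_trichotomy c d with h1 | h1 | h1
  · have := comp_lt N hc h1; omega
  · exact h1
  · have := comp_lt N hd h1; omega

lemma SS_pos {n k : ℕ} {N : Set Pth} (h : Pre n k N) {c : ℕ} (hc : c ∈ SS N) : c ≠ 0 := by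
  rintro rfl
  obtain ⟨u, j, h1, h2⟩ := hc
  apply h2
  have hj : j ≠ 0 := by rintro rfl; exact h.i0 _ h1
  exact ⟨hj, ⟨j, hj, h1⟩, fun _ _ _ _ => Nat.zero_le _⟩

lemma comp_le {n k : ℕ} {N : Set Pth} (h : Pre n k N) {c : ℕ} (hc : c ∈ SS N) : comp N c ≤ c := by
  have h0 := SS_pos h hc
  have : {c' | c' ∈ SS N ∧ c' < c}.ncard ≤ (Set.Ico 1 c).ncard := by
    apply Set.ncard_le_ncard _ (Set.finite_Ico 1 c)
    intro x hx
    exact ⟨Nat.pos_of_ne_zero (SS_pos h hx.1), hx.2⟩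
  rw [← Finset.coe_Ico, Set.ncard_coe_finset, Nat.card_Ico] at this
  unfold comp; omega

lemma re_le {n k : ℕ} {N : Set Pth} (h : Pre n k N) {u : Pth} {e : ℕ × ℕ} (he : u ++ [e] ∈ N) :
    (re N u e).2 ≤ e.2 := by
  unfold re
  by_cases hp : e.1 ≠ 0 ∧ prom N u e.2
  · simp [hp]
  · simp only [hp, if_false]
    exact comp_le h ⟨u, e.1, he, hp⟩

lemma nu_inj {n k : ℕ} {N : Set Pth} (hN : ∀ u e, u ++ [e] ∈ N → u ∈ N) (h : Pre n k N)
    (v w : Pth) (hv : v ∈ N) (hw : w ∈ N) (he : nu N [] v = nu N [] w) : v = w := by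
  induction v using List.reverseRecOn generalizing w with
  | nil =>
    have := congrArg List.length he
    rw [nu_length, nu_length] at this
    exact (List.length_eq_zero_iff.1 this.symm).symm
  | append_singleton v e ih =>
    rcases snoc_cases w with rfl | ⟨w, j, c, rfl⟩
    · have := congrArg List.length he
      rw [nu_length, nu_length] at this
      simp at this
    · rw [nu_snoc, nu_snoc] at he
      obtain ⟨h1, h2⟩ := List.append_inj' he rfl
      have hvw := ih w (hN _ _ hv) (hN _ _ hw) h1
      subst hvw
      obtain ⟨i, b⟩ := e
      simp only [List.cons.injEq, and_true, re, Prod.mk.injEq] at h2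
      obtain ⟨rfl, h3⟩ := h2
      congr 3
      by_cases hp : i ≠ 0 ∧ prom N v b <;> by_cases hq : i ≠ 0 ∧ prom N v c
      · exact le_antisymm (hp.2.2 _ _ hp.1 hw) (hq.2.2 _ _ hp.1 hv)
      · rw [if_pos hp, if_neg hq] at h3; unfold comp at h3; omega
      · rw [if_neg hp, if_pos hq] at h3; unfold comp at h3; omega
      · rw [if_neg hp, if_neg hq] at h3
        exact comp_inj N ⟨_, _, hv, hp⟩ ⟨_, _, hw, hq⟩ h3

/-! normalisation -/
def bucket (v : Pth) : ℕ := v.foldl (fun b e => if e.2 = 0 then b else e.2) 0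

lemma bucket_snoc (v : Pth) (j c : ℕ) : bucket (v ++ [(j, c)]) = if c = 0 then bucket v else c := by
  simp [bucket]

section
variable {Q : Type}

def Green (R : Q → Option Pth) (v : Pth) : Prop := ∀ j c, v ++ [(j, c)] ∈ Nodes R → j = 0

noncomputable def R3 (n k : ℕ) (R : Q → Option Pth) (q : Q) : Option Pth :=
  (R q).map (fun p => ext n k (trunc (Green R) [] p))

noncomputable def norm (n k : ℕ) (R : Q → Option Pth) (q : Q) : Option Pth :=
  (R3 n k R q).map (nu (Nodes (R3 n k R)) [])

structure Valid (n k : ℕ) (π : Q → Option Pth) : Prop where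
  pre : Pre n k (Nodes π)
  bd : ∀ u j c, u ++ [(j, c)] ∈ Nodes π → c < n
  i3 : ∀ u e, u ++ [e] ∈ Nodes π → ∃ j, u ++ [(j, 0)] ∈ Nodes π
  full : ∀ q p, π q = some p → hope k p = ∅

lemma R3_cases {n k : ℕ} {R : Q → Option Pth} {v : Pth} (h : v ∈ Nodes (R3 n k R)) :
    (v ∈ Nodes R ∧ ∀ u, u <+: v → u ≠ v → ¬ Green R u) ∨ ∃ u j, v = fe n u j ∧ j ∈ hope k u := by
  obtain ⟨q, p, h1, h2⟩ := h
  simp only [R3, Option.map_eq_some_iff] at h1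
  obtain ⟨p1, h3, rfl⟩ := h1
  rcases ext_cases h2 with h4 | h4
  · rw [trunc_iff] at h4
    exact Or.inl ⟨⟨q, p1, h3, h4.1⟩, h4.2⟩
  · exact Or.inr h4

lemma R3_of {n k : ℕ} {R : Q → Option Pth} {v : Pth} (h : v ∈ Nodes R)
    (h2 : ∀ u, u <+: v → u ≠ v → ¬ Green R u) : v ∈ Nodes (R3 n k R) := by
  obtain ⟨q, p, h1, h3⟩ := h
  refine ⟨q, _, by simp [R3, h1]; rfl, ?_⟩
  exact ((trunc_iff _ _ _).2 ⟨h3, h2⟩).trans (ext_prefix _ _ _)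

lemma R3_pre {n k : ℕ} (hn : 1 ≤ n) {R : Q → Option Pth} (h : Pre n k (Nodes R)) :
    Pre n k (Nodes (R3 n k R)) := by
  apply h.extend hn
  intro v hv
  rcases R3_cases hv with h1 | ⟨u, j, h1, h2⟩
  · exact Or.inl h1.1
  · exact Or.inr ⟨u, j, h1, Or.inr h2⟩

lemma fe_eq {n : ℕ} {u v : Pth} {j i c : ℕ} (h : v ++ [(i, c)] = fe n u j) :
    v = u ∧ i = j ∧ c = fr n u j := by
  unfold fe at h
  obtain ⟨rfl, h4⟩ := List.append_inj' h rfl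
  simpa using h4

lemma R3_child {n k : ℕ} {R : Q → Option Pth} {u : Pth} {e : ℕ × ℕ}
    (h : u ++ [e] ∈ Nodes (R3 n k R)) : ∃ j c, j ≠ 0 ∧ u ++ [(j, c)] ∈ Nodes (R3 n k R) := by
  obtain ⟨i, b⟩ := e
  rcases R3_cases h with h1 | ⟨u', j, h1, h2⟩
  · have h3 := h1.2 u (List.prefix_append _ _) (by simp)
    unfold Green at h3
    push Not at h3
    obtain ⟨j, c, h4, h5⟩ := h3
    refine ⟨j, c, h5, R3_of h4 ?_⟩
    intro w hw hne
    rcases prefix_snoc hw with h6 | h6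
    · exact absurd h6 hne
    · refine h1.2 w (h6.trans (List.prefix_append _ _)) ?_
      rintro rfl
      have := h6.length_le
      simp at this
  · obtain ⟨rfl, rfl, rfl⟩ := fe_eq h1
    exact ⟨i, _, hope_pos h2, h⟩

lemma norm_nodes {n k : ℕ} {R : Q → Option Pth} (v : Pth) :
    v ∈ Nodes (norm n k R) ↔
      ∃ w ∈ Nodes (R3 n k R), v = nu (Nodes (R3 n k R)) [] w := by
  constructor
  · rintro ⟨q, p, h1, h2⟩
    simp only [norm, Option.map_eq_some_iff] at h1
    obtain ⟨p1, h3, rfl⟩ := h1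
    obtain ⟨w, h4, h5⟩ := nu_prefix _ h2
    exact ⟨w, ⟨q, p1, h3, h4⟩, h5⟩
  · rintro ⟨w, ⟨q, p, h1, h2⟩, rfl⟩
    exact ⟨q, _, by simp [norm, h1], nu_mono _ h2⟩

lemma norm_snoc {n k : ℕ} {R : Q → Option Pth} {u : Pth} {j c : ℕ}
    (h : u ++ [(j, c)] ∈ Nodes (norm n k R)) :
    ∃ w d, w ++ [(j, d)] ∈ Nodes (R3 n k R) ∧ u = nu (Nodes (R3 n k R)) [] w ∧
      ((j ≠ 0 ∧ prom (Nodes (R3 n k R)) w d ∧ c = 0) ∨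
       (¬ (j ≠ 0 ∧ prom (Nodes (R3 n k R)) w d) ∧ c = comp (Nodes (R3 n k R)) d)) := by
  rw [norm_nodes] at h
  obtain ⟨w, hw, h⟩ := h
  rcases snoc_cases w with rfl | ⟨w, i, d, rfl⟩
  · simp [nu] at h
  · rw [nu_snoc] at h
    obtain ⟨rfl, h2⟩ := List.append_inj' h rfl
    simp only [re, List.cons.injEq, Prod.mk.injEq, and_true] at h2
    obtain ⟨rfl, h3⟩ := h2
    refine ⟨w, d, hw, rfl, ?_⟩
    by_cases hp : j ≠ 0 ∧ prom (Nodes (R3 n k R)) w d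
    · rw [if_pos hp] at h3; exact Or.inl ⟨hp.1, hp.2, h3⟩
    · rw [if_neg hp] at h3; exact Or.inr ⟨hp, h3⟩

lemma prom_exists {n k : ℕ} {R : Q → Option Pth} {u : Pth} {e : ℕ × ℕ}
    (h : u ++ [e] ∈ Nodes (R3 n k R)) :
    ∃ j c, j ≠ 0 ∧ u ++ [(j, c)] ∈ Nodes (R3 n k R) ∧ prom (Nodes (R3 n k R)) u c := by
  obtain ⟨j, c, h1, h2⟩ := R3_child h
  have hex : ∃ c, ∃ j, j ≠ 0 ∧ u ++ [(j, c)] ∈ Nodes (R3 n k R) := ⟨c, j, h1, h2⟩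
  obtain ⟨j0, h3, h4⟩ := Nat.find_spec hex
  exact ⟨j0, _, h3, h4, ⟨j0, h3, h4⟩, fun j' c' h5 h6 => Nat.find_min' hex ⟨j', h5, h6⟩⟩

lemma norm_i3 {n k : ℕ} {R : Q → Option Pth} (u : Pth) (e : ℕ × ℕ)
    (h : u ++ [e] ∈ Nodes (norm n k R)) : ∃ j, u ++ [(j, 0)] ∈ Nodes (norm n k R) := by
  obtain ⟨j, c⟩ := e
  obtain ⟨w, d, h1, rfl, -⟩ := norm_snoc h
  obtain ⟨i, b, h2, h3, h4⟩ := prom_exists h1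
  refine ⟨i, (norm_nodes _).2 ⟨_, h3, ?_⟩⟩
  rw [nu_snoc]; simp [re, h2, h4]

lemma leaf_of [Finite Q] {π : Q → Option Pth}
    (i3 : ∀ u e, u ++ [e] ∈ Nodes π → ∃ j, u ++ [(j, 0)] ∈ Nodes π) {v : Pth} (hv : v ∈ Nodes π) :
    ∃ q p, π q = some p ∧ bucket p = bucket v := by
  obtain ⟨M, hM⟩ : ∃ M, ∀ v ∈ Nodes π, v.length ≤ M := by
    obtain ⟨M, hM⟩ := (Set.finite_range (fun q => ((π q).getD []).length)).bddAbove
    refine ⟨M, ?_⟩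
    rintro v ⟨q, p, h1, h2⟩
    refine h2.length_le.trans (hM ⟨q, by simp [h1]⟩)
  generalize hd : M - v.length = d
  induction d using Nat.strong_induction_on generalizing v with
  | _ d ih =>
    have hv' := hv
    obtain ⟨q, p, h1, h2⟩ := hv'
    by_cases hp : v = p
    · exact ⟨q, p, h1, by rw [hp]⟩
    · obtain ⟨e, he⟩ := exists_next h2 hp
      obtain ⟨j, hj⟩ := i3 v e ⟨q, p, h1, he⟩
      have hl := hM _ hj
      simp at hl
      obtain ⟨q', p', h3, h4⟩ := ih (M - (v ++ [(j, 0)]).length) (by simp; omega) hj rfl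
      exact ⟨q', p', h3, by rw [h4, bucket_snoc]; simp⟩

lemma norm_bd [Fintype Q] {n k : ℕ} (hQ : Fintype.card Q = n) (hn : 1 ≤ n) {R : Q → Option Pth}
    (hR : Pre n k (Nodes R)) (u : Pth) (j c : ℕ) (h : u ++ [(j, c)] ∈ Nodes (norm n k R)) :
    c < n := by
  have h3 := R3_pre hn hR
  set N := Nodes (R3 n k R) with hN
  obtain ⟨w, d, h1, rfl, h2 | h2⟩ := norm_snoc h
  · omega
  have hd : d ∈ SS N := ⟨w, j, h1, h2.1⟩
  rw [h2.2]
  change comp N d < n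
  let F : Q → ℕ := fun q => bucket ((norm n k R q).getD [])
  have hF : ∀ v ∈ Nodes (norm n k R), bucket v ∈ Set.range F := by
    intro v hv
    obtain ⟨q, p, h4, h5⟩ := leaf_of norm_i3 hv
    exact ⟨q, by simp [F, h4, h5]⟩
  let A : Set ℕ := insert d {c' | c' ∈ SS N ∧ c' < d}
  have hA : A.ncard = comp N d := by
    rw [Set.ncard_insert_of_notMem (by simp) (comp_fin N d)]; unfold comp; omega
  have hAS : ∀ x ∈ A, x ∈ SS N := by
    rintro x (rfl | hx)
    · exact hd
    · exact hx.1
  have hAf : A.Finite := (comp_fin N d).insert d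
  have hsub : insert 0 (comp N '' A) ⊆ Set.range F := by
    rintro x (rfl | ⟨a, ha, rfl⟩)
    · have := hF [] (Nodes.pre h (List.nil_prefix))
      simpa [bucket] using this
    · obtain ⟨u', i, h5, h6⟩ := hAS a ha
      have := hF (nu N [] (u' ++ [(i, a)])) ((norm_nodes _).2 ⟨_, h5, rfl⟩)
      rw [nu_snoc] at this
      unfold re at this
      rw [if_neg h6, bucket_snoc, if_neg (by unfold comp; omega)] at this
      exact this
  have h7 := Set.ncard_le_ncard hsub (Set.finite_range F)
  rw [Set.ncard_insert_of_notMem _ (hAf.image _), Set.InjOn.ncard_image, hA] at h7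
  · have h8 : (Set.range F).ncard ≤ n := by
      rw [← Set.image_univ, ← hQ, ← Nat.card_eq_fintype_card, ← Set.ncard_univ]
      exact Set.ncard_image_le
    omega
  · intro x hx y hy hxy
    exact comp_inj N (hAS x hx) (hAS y hy) hxy
  · rintro ⟨a, -, ha⟩
    unfold comp at ha; omega

lemma nodes_snoc (R : Q → Option Pth) : ∀ u e, u ++ [e] ∈ Nodes R → u ∈ Nodes R :=
  fun _ _ h => Nodes.snoc h

lemma norm_valid [Fintype Q] {n k : ℕ} (hQ : Fintype.card Q = n) (hn : 1 ≤ n) {R : Q → Option Pth}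
    (hR : Pre n k (Nodes R)) : Valid n k (norm n k R) := by
  have h3 := R3_pre hn hR
  have hbd := norm_bd hQ hn hR
  have hinj := nu_inj (nodes_snoc _) h3
  refine ⟨⟨?_, ?_, ?_, ?_, fun u j c h => Or.inl (hbd u j c h)⟩, hbd, norm_i3, ?_⟩
  · intro u j c h
    obtain ⟨w, d, h1, rfl, -⟩ := norm_snoc h
    rw [nu_hope]; exact h3.wf _ _ _ h1
  · intro u j j' c h h'
    obtain ⟨w, d, h1, hw, h2⟩ := norm_snoc h
    obtain ⟨w', d', h1', hw', h2'⟩ := norm_snoc h'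
    have := hinj w w' (Nodes.snoc h1) (Nodes.snoc h1') (hw.symm.trans hw')
    subst this
    rcases h2 with h2 | h2 <;> rcases h2' with h2' | h2'
    · have : d = d' := le_antisymm (h2.2.1.2 _ _ h2'.1 h1') (h2'.2.1.2 _ _ h2.1 h1)
      subst this
      exact h3.u1 _ _ _ _ h1 h1'
    · have := h2'.2; unfold comp at this; omega
    · have := h2.2; unfold comp at this; omega
    · have := comp_inj _ ⟨_, _, h1, h2.1⟩ ⟨_, _, h1', h2'.1⟩ (h2.2.symm.trans h2'.2)
      subst this
      exact h3.u1 _ _ _ _ h1 h1'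
  · intro u u' j j' c hc h h'
    obtain ⟨w, d, h1, rfl, h2⟩ := norm_snoc h
    obtain ⟨w', d', h1', rfl, h2'⟩ := norm_snoc h'
    rcases h2 with h2 | h2
    · omega
    rcases h2' with h2' | h2'
    · omega
    have hS : d ∈ SS (Nodes (R3 n k R)) := ⟨_, _, h1, h2.1⟩
    have := comp_inj _ hS ⟨_, _, h1', h2'.1⟩ (h2.2.symm.trans h2'.2)
    subst this
    obtain ⟨rfl, rfl⟩ := h3.i1 _ _ _ _ _ (SS_pos h3 hS) h1 h1'
    exact ⟨rfl, rfl⟩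
  · intro u h
    obtain ⟨w, d, h1, rfl, h2 | h2⟩ := norm_snoc h
    · exact h2.1 rfl
    · have := h2.2; unfold comp at this; omega
  · intro q p h
    simp only [norm, R3, Option.map_map, Option.map_eq_some_iff] at h
    obtain ⟨p1, -, rfl⟩ := h
    simp only [Function.comp, nu_hope, ext_full]

/-! naming -/
noncomputable def name (k : ℕ) (v : Pth) : ℕ × ℕ := (bucket v, (hope k v).card)

lemma lvl_snoc {n k : ℕ} {N : Set Pth} (h : Pre n k N) {u : Pth} {j c : ℕ}
    (hv : u ++ [(j, c)] ∈ N) (hj : j ≠ 0) :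
    (hope k u).card = (hope k (u ++ [(j, c)])).card + 1 := by
  have := (h.wf _ _ _ hv).resolve_left hj
  rw [hope_snoc, Finset.card_erase_of_mem this]
  have := Finset.card_pos.2 ⟨_, this⟩
  omega

lemma lvl_top {n k : ℕ} {N : Set Pth} (hN : ∀ u e, u ++ [e] ∈ N → u ∈ N) (h : Pre n k N)
    {u : Pth} {j c : ℕ} (hv : u ++ [(j, c)] ∈ N) (hc : c ≠ 0) (w : Pth) (hw : w ∈ N)
    (hb : bucket w = c) : (hope k w).card ≤ (hope k (u ++ [(j, c)])).card := by
  induction w using List.reverseRecOn with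
  | nil => simp [bucket] at hb; omega
  | append_singleton w e ih =>
    obtain ⟨i, d⟩ := e
    rw [bucket_snoc] at hb
    by_cases hd : d = 0
    · rw [if_pos hd] at hb
      have h1 := ih (hN _ _ hw) hb
      subst hd
      have := lvl_snoc h hw (by rintro rfl; exact h.i0 _ hw)
      omega
    · rw [if_neg hd] at hb
      subst hb
      obtain ⟨rfl, rfl⟩ := h.i1 _ _ _ _ _ hc hv hw
      exact le_rfl

lemma name_inj {n k : ℕ} {N : Set Pth} (hN : ∀ u e, u ++ [e] ∈ N → u ∈ N) (h : Pre n k N)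
    (v w : Pth) (hv : v ∈ N) (hw : w ∈ N) (hb : bucket v = bucket w)
    (hl : (hope k v).card = (hope k w).card) : v = w := by
  have root : ∀ v j c, v ++ [(j, c)] ∈ N → bucket (v ++ [(j, c)]) = 0 →
      (hope k (v ++ [(j, c)])).card < (hope k []).card := by
    intro v j c hv hb
    rw [bucket_snoc] at hb
    have hc : c = 0 := by by_contra hc; rw [if_neg hc] at hb; exact hc hb
    subst hc
    have h1 := lvl_snoc h hv (by rintro rfl; exact h.i0 _ hv)
    have h2 : (hope k ([] : Pth)).card = k := by simp [hope]
    have := hope_card_le k v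
    omega
  induction v using List.reverseRecOn generalizing w with
  | nil =>
    rcases snoc_cases w with rfl | ⟨w, j, c, rfl⟩
    · rfl
    · have := root w j c hw (by rw [← hb]; rfl); omega
  | append_singleton v e ih =>
    obtain ⟨i, d⟩ := e
    rcases snoc_cases w with rfl | ⟨w, j, c, rfl⟩
    · have := root v i d hv (by rw [hb]; rfl); omega
    · by_cases hd : d = 0 <;> by_cases hc : c = 0
      · subst hd; subst hc
        simp only [bucket_snoc, if_true] at hb
        have h1 := lvl_snoc h hv (by rintro rfl; exact h.i0 _ hv)
        have h2 := lvl_snoc h hw (by rintro rfl; exact h.i0 _ hw)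
        have := ih w (hN _ _ hv) (hN _ _ hw) hb (by omega)
        subst this
        rw [h.u1 _ _ _ _ hv hw]
      · subst hd
        simp only [bucket_snoc, if_true, if_neg hc] at hb
        have h1 := lvl_snoc h hv (by rintro rfl; exact h.i0 _ hv)
        have := lvl_top hN h hw hc v (hN _ _ hv) hb
        omega
      · subst hc
        simp only [bucket_snoc, if_true, if_neg hd] at hb
        have h1 := lvl_snoc h hw (by rintro rfl; exact h.i0 _ hw)
        have := lvl_top hN h hv hd w (hN _ _ hw) hb.symm
        omega
      · simp only [bucket_snoc, if_neg hd, if_neg hc] at hb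
        subst hb
        obtain ⟨rfl, rfl⟩ := h.i1 _ _ _ _ _ hd hv hw
        rfl
end

section code
variable {Q : Type}

noncomputable def nm (n k : ℕ) (v : Pth) : Fin (n + 1) × Fin (k + 1) :=
  (Fin.ofNat (n + 1) (bucket v), Fin.ofNat (k + 1) (hope k v).card)

abbrev Cd (n k : ℕ) (Q : Type) : Type :=
  (Q → Option (Fin (n + 1))) × (Fin (n + 1) → Fin (n + 1) × Fin (k + 1)) ×
    (Fin (n + 1) × Fin (k + 1) → Option (Fin (k + 1) × Bool))

noncomputable def code (n k : ℕ) (π : Q → Option Pth) : Cd n k Q :=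
  (fun q => (π q).map (fun p => Fin.ofNat (n + 1) (bucket p)),
   fun b => if h : ∃ u j, u ++ [(j, (b : ℕ))] ∈ Nodes π then nm n k h.choose else (0, 0),
   fun x => if h : ∃ e : Pth × ℕ × ℕ, e.1 ++ [(e.2.1, e.2.2)] ∈ Nodes π ∧
        nm n k (e.1 ++ [(e.2.1, e.2.2)]) = x then
      some (Fin.ofNat (k + 1) h.choose.2.1, decide (h.choose.2.2 = 0)) else none)

lemma Valid.bucket_lt {n k : ℕ} (hn : 1 ≤ n) {π : Q → Option Pth} (h : Valid n k π) (v : Pth)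
    (hv : v ∈ Nodes π) : bucket v < n := by
  induction v using List.reverseRecOn with
  | nil => simp [bucket]; omega
  | append_singleton v e ih =>
    obtain ⟨j, c⟩ := e
    rw [bucket_snoc]
    split
    · exact ih (Nodes.snoc hv)
    · exact h.bd _ _ _ hv

lemma ofNat_inj {m a b : ℕ} (ha : a < m + 1) (hb : b < m + 1)
    (h : Fin.ofNat (m + 1) a = Fin.ofNat (m + 1) b) : a = b := by
  have := congrArg Fin.val h
  simpa [Fin.ofNat, Nat.mod_eq_of_lt ha, Nat.mod_eq_of_lt hb] using this

lemma nm_eq {n k : ℕ} (hn : 1 ≤ n) {π π' : Q → Option Pth} (h : Valid n k π) (h' : Valid n k π')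
    {v w : Pth} (hv : v ∈ Nodes π) (hw : w ∈ Nodes π') (he : nm n k v = nm n k w) :
    bucket v = bucket w ∧ (hope k v).card = (hope k w).card := by
  simp only [nm, Prod.mk.injEq] at he
  have h1 := h.bucket_lt hn v hv
  have h2 := h'.bucket_lt hn w hw
  have h3 := hope_card_le k v
  have h4 := hope_card_le k w
  exact ⟨ofNat_inj (by omega) (by omega) he.1, ofNat_inj (by omega) (by omega) he.2⟩

lemma nm_inj {n k : ℕ} (hn : 1 ≤ n) {π : Q → Option Pth} (h : Valid n k π)
    {v w : Pth} (hv : v ∈ Nodes π) (hw : w ∈ Nodes π) (he : nm n k v = nm n k w) : v = w := by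
  obtain ⟨h1, h2⟩ := nm_eq hn h h hv hw he
  exact name_inj (nodes_snoc _) h.pre v w hv hw h1 h2

lemma code_c2 {n k : ℕ} {π : Q → Option Pth} (h : Valid n k π)
    {u : Pth} {j c : ℕ} (hv : u ++ [(j, c)] ∈ Nodes π) (hc : c ≠ 0) :
    (code n k π).2.1 (Fin.ofNat (n + 1) c) = nm n k u := by
  have hlt := h.bd _ _ _ hv
  have hval : ((Fin.ofNat (n + 1) c : Fin (n + 1)) : ℕ) = c := by
    simp [Fin.ofNat, Nat.mod_eq_of_lt (show c < n + 1 by omega)]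
  have hex : ∃ u j, u ++ [(j, ((Fin.ofNat (n + 1) c : Fin (n + 1)) : ℕ))] ∈ Nodes π :=
    ⟨u, j, by rw [hval]; exact hv⟩
  simp only [code]
  rw [dif_pos hex]
  obtain ⟨j', hj'⟩ := hex.choose_spec
  have := (h.pre.i1 u _ j _ _ (by rw [hval]; exact hc) (by rw [hval]; exact hv) hj').1
  rw [← this]

lemma code_c3 {n k : ℕ} (hn : 1 ≤ n) {π : Q → Option Pth} (h : Valid n k π)
    {u : Pth} {j c : ℕ} (hv : u ++ [(j, c)] ∈ Nodes π) :
    (code n k π).2.2 (nm n k (u ++ [(j, c)])) = some (Fin.ofNat (k + 1) j, decide (c = 0)) := by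
  have hex : ∃ e : Pth × ℕ × ℕ, e.1 ++ [(e.2.1, e.2.2)] ∈ Nodes π ∧
      nm n k (e.1 ++ [(e.2.1, e.2.2)]) = nm n k (u ++ [(j, c)]) := ⟨(u, j, c), hv, rfl⟩
  simp only [code]
  rw [dif_pos hex]
  have h1 := hex.choose_spec
  have h2 := nm_inj hn h h1.1 hv h1.2
  obtain ⟨-, h4⟩ := List.append_inj' h2 rfl
  simp only [List.cons.injEq, Prod.mk.injEq, and_true] at h4
  rw [h4.1, h4.2]

lemma code_c3_nil {n k : ℕ} (hn : 1 ≤ n) {π : Q → Option Pth} (h : Valid n k π)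
    (hv : [] ∈ Nodes π) : (code n k π).2.2 (nm n k []) = none := by
  simp only [code]
  rw [dif_neg]
  rintro ⟨e, h1, h2⟩
  have := nm_inj hn h h1 hv h2
  simp at this

lemma label_le {n k : ℕ} {N : Set Pth} (h : Pre n k N) {u : Pth} {j c : ℕ}
    (hv : u ++ [(j, c)] ∈ N) : j ≤ k := by
  rcases h.wf _ _ _ hv with h | h
  · omega
  · simp [hope] at h; omega

lemma code_nodes {n k : ℕ} (hn : 1 ≤ n) {π π' : Q → Option Pth} (h : Valid n k π)
    (h' : Valid n k π') (hc : code n k π = code n k π') (v w : Pth) (hv : v ∈ Nodes π)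
    (hw : w ∈ Nodes π') (he : nm n k v = nm n k w) : v = w := by
  induction v using List.reverseRecOn generalizing w with
  | nil =>
    rcases snoc_cases w with rfl | ⟨w, j, c, rfl⟩
    · rfl
    · have h1 := code_c3_nil hn h hv
      have h2 := code_c3 hn h' hw
      rw [← he, ← hc, h1] at h2
      cases h2
  | append_singleton v e ih =>
    obtain ⟨i, d⟩ := e
    have h1 := code_c3 hn h hv
    rcases snoc_cases w with rfl | ⟨w, j, c, rfl⟩
    · have h2 := code_c3_nil hn h' hw
      rw [← he, ← hc, h1] at h2
      cases h2
    · have h2 := code_c3 hn h' hw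
      rw [← he, ← hc, h1] at h2
      simp only [Option.some.injEq, Prod.mk.injEq, decide_eq_decide] at h2
      have hi := label_le h.pre hv
      have hj := label_le h'.pre hw
      have hij : i = j := ofNat_inj (by omega) (by omega) h2.1
      subst hij
      obtain ⟨h3, h4⟩ := nm_eq hn h h' hv hw he
      simp only [bucket_snoc] at h3
      by_cases hd : d = 0
      · have hc0 := h2.2.1 hd
        subst hd; subst hc0
        simp only [if_true] at h3
        have hi0 : i ≠ 0 := by rintro rfl; exact h.pre.i0 _ hv
        have h5 := lvl_snoc h.pre hv hi0
        have h6 := lvl_snoc h'.pre hw hi0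
        rw [ih w (Nodes.snoc hv) (Nodes.snoc hw) (by unfold nm; rw [h3, h5, h6, h4])]
      · have hc0 : c ≠ 0 := fun h => hd (h2.2.2 h)
        rw [if_neg hd, if_neg hc0] at h3
        subst h3
        have h5 := code_c2 h hv hd
        have h6 := code_c2 h' hw hd
        rw [ih w (Nodes.snoc hv) (Nodes.snoc hw) (by rw [← h5, ← h6, hc])]

lemma code_inj {n k : ℕ} (hn : 1 ≤ n) {π π' : Q → Option Pth} (h : Valid n k π)
    (h' : Valid n k π') (hc : code n k π = code n k π') : π = π' := by
  funext q
  have h1 : (code n k π).1 q = (code n k π').1 q := by rw [hc]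
  simp only [code] at h1
  cases hp : π q with
  | none =>
    cases hp' : π' q with
    | none => rfl
    | some p' => simp [hp, hp'] at h1
  | some p =>
    cases hp' : π' q with
    | none => simp [hp, hp'] at h1
    | some p' =>
      rw [hp, hp'] at h1
      simp only [Option.map_some, Option.some.injEq] at h1
      rw [code_nodes hn h h' hc p p' ⟨q, p, hp, List.prefix_rfl⟩ ⟨q, p', hp', List.prefix_rfl⟩
        (by unfold nm; rw [h1, h.full _ _ hp, h'.full _ _ hp'])]

abbrev Flg (n k : ℕ) : Type := Fin n × Fin (k + 1) → Bool × Bool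

abbrev St (n k : ℕ) (Q : Type) : Type := {s : (Q → Option Pth) × Flg n k // Valid n k s.1}

noncomputable def stCode (n k : ℕ) (s : St n k Q) : Cd n k Q × Flg n k := (code n k s.1.1, s.1.2)

lemma stCode_inj {n k : ℕ} (hn : 1 ≤ n) : Function.Injective (stCode (Q := Q) n k) := by
  rintro ⟨⟨a, b⟩, h⟩ ⟨⟨a', b'⟩, h'⟩ he
  simp only [stCode, Prod.mk.injEq] at he
  have := code_inj hn h h' he.1
  simp only at this
  subst this
  rw [Subtype.mk.injEq, Prod.mk.injEq]
  exact ⟨rfl, he.2⟩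

lemma St_finite [Fintype Q] {n k : ℕ} (hn : 1 ≤ n) : Finite (St n k Q) :=
  Finite.of_injective _ (stCode_inj hn)

lemma St_card [Fintype Q] {n k : ℕ} (hQ : Fintype.card Q = n) (hn : 1 ≤ n) (hk : 1 ≤ k)
    (hkn : k ≤ n) : Nat.card (St n k Q) ≤ ((n + 1) ^ n * (k + 1) ^ (n * k)) ^ 16 := by
  have h1 := Nat.card_le_card_of_injective _ (stCode_inj (Q := Q) (k := k) hn)
  refine h1.trans ?_
  rw [Nat.card_eq_fintype_card]
  simp only [Fintype.card_prod, Fintype.card_fun, Fintype.card_option, Fintype.card_fin,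
    Fintype.card_bool, hQ]
  have a1 : (n + 1 + 1) ^ n ≤ (n + 1) ^ (2 * n) := by
    rw [pow_mul]; exact Nat.pow_le_pow_left (by nlinarith) n
  have a2 : ((n + 1) * (k + 1)) ^ (n + 1) ≤ (n + 1) ^ (4 * n) := by
    calc ((n + 1) * (k + 1)) ^ (n + 1) ≤ ((n + 1) ^ 2) ^ (n + 1) :=
          Nat.pow_le_pow_left (by nlinarith) _
      _ ≤ ((n + 1) ^ 2) ^ (2 * n) := Nat.pow_le_pow_right (by positivity) (by omega)
      _ = (n + 1) ^ (4 * n) := by rw [← pow_mul]; congr 1; ring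
  have hnk : n + 1 ≤ 2 * n := by omega
  have hk2 : k + 1 ≤ 2 * k := by omega
  have e1 : (n + 1) * (k + 1) ≤ 4 * (n * k) := by
    calc (n + 1) * (k + 1) ≤ (2 * n) * (2 * k) := Nat.mul_le_mul hnk hk2
      _ = _ := by ring
  have e2 : n * (k + 1) ≤ 2 * (n * k) := by nlinarith
  have a3 : ((k + 1) * 2 + 1) ^ ((n + 1) * (k + 1)) ≤ (k + 1) ^ (12 * (n * k)) := by
    calc ((k + 1) * 2 + 1) ^ ((n + 1) * (k + 1)) ≤ ((k + 1) ^ 3) ^ ((n + 1) * (k + 1)) :=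
          Nat.pow_le_pow_left (by nlinarith [Nat.zero_le (k^2), Nat.zero_le (k^3)]) _
      _ ≤ ((k + 1) ^ 3) ^ (4 * (n * k)) := Nat.pow_le_pow_right (by positivity) e1
      _ = _ := by rw [← pow_mul]; congr 1; ring
  have a4 : (2 * 2) ^ (n * (k + 1)) ≤ (k + 1) ^ (4 * (n * k)) := by
    calc (2 * 2) ^ (n * (k + 1)) ≤ ((k + 1) ^ 2) ^ (n * (k + 1)) :=
          Nat.pow_le_pow_left (by nlinarith) _
      _ ≤ ((k + 1) ^ 2) ^ (2 * (n * k)) := Nat.pow_le_pow_right (by positivity) e2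
      _ = _ := by rw [← pow_mul]; congr 1; ring
  calc _ ≤ ((n + 1) ^ (2 * n) * ((n + 1) ^ (4 * n) * (k + 1) ^ (12 * (n * k)))) *
        (k + 1) ^ (4 * (n * k)) := by gcongr
    _ = (n + 1) ^ (6 * n) * (k + 1) ^ (16 * (n * k)) := by ring
    _ ≤ (n + 1) ^ (16 * n) * (k + 1) ^ (16 * (n * k)) := by
      gcongr <;> omega
    _ = _ := by ring

end code

lemma real_bound {n k m : ℕ} (h : m ≤ ((n + 1) ^ n * (k + 1) ^ (n * k)) ^ 16) :
    (m : ℝ) ≤ (2 : ℝ) ^ ((16 : ℝ) * ((n : ℝ) * Real.logb 2 ((n : ℝ) + 1) +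
          (n : ℝ) * (k : ℝ) * Real.logb 2 ((k : ℝ) + 1))) := by
  have h1 : (m : ℝ) ≤ (((n : ℝ) + 1) ^ n * ((k : ℝ) + 1) ^ (n * k)) ^ 16 := by exact_mod_cast h
  refine h1.trans (le_of_eq ?_)
  have key : ∀ x : ℝ, 0 < x → ∀ a : ℕ, x ^ a = (2 : ℝ) ^ ((a : ℝ) * Real.logb 2 x) := by
    intro x hx a
    rw [mul_comm, Real.rpow_mul (by norm_num), Real.rpow_logb (by norm_num) (by norm_num) hx,
      Real.rpow_natCast]
  rw [key _ (by positivity) n, key _ (by positivity) (n * k), ← Real.rpow_add (by norm_num),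
    ← Real.rpow_natCast, ← Real.rpow_mul (by norm_num)]
  congr 1
  push_cast
  ring

section dyn
variable {Q : Type}

noncomputable def upd (n k : ℕ) (Bs Gs : ℕ → Set Q) (q' : Q) : Pth → Pth → Pth
  | pre, [] => pre
  | pre, e :: t => if q' ∈ Bs e.1 then fe n pre (nxt k pre e.1)
      else if q' ∈ Gs e.1 then fe n pre e.1 else upd n k Bs Gs q' (pre ++ [e]) t

lemma upd_prefix (n k : ℕ) (Bs Gs : ℕ → Set Q) (q' : Q) (pre rest : Pth) :
    pre <+: upd n k Bs Gs q' pre rest := by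
  induction rest generalizing pre with
  | nil => simp [upd]
  | cons e t ih =>
    unfold upd
    split
    · exact List.prefix_append _ _
    · split
      · exact List.prefix_append _ _
      · exact (List.prefix_append _ _).trans (ih _)

lemma upd_append (n k : ℕ) (Bs Gs : ℕ → Set Q) (q' : Q) (pre a s : Pth)
    (h : ∀ e ∈ a, q' ∉ Bs e.1 ∧ q' ∉ Gs e.1) :
    upd n k Bs Gs q' pre (a ++ s) = upd n k Bs Gs q' (pre ++ a) s := by
  induction a generalizing pre with
  | nil => simp
  | cons e t ih =>
    have h1 := h e (by simp)
    rw [List.cons_append, upd, if_neg h1.1, if_neg h1.2, ih _ (fun e he => h e (by simp [he]))]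
    simp

lemma upd_cases (n k : ℕ) (Bs Gs : ℕ → Set Q) (q' : Q) (pre rest : Pth) :
    (upd n k Bs Gs q' pre rest = pre ++ rest ∧ ∀ e ∈ rest, q' ∉ Bs e.1 ∧ q' ∉ Gs e.1) ∨
    ∃ a e, a ++ [e] <+: rest ∧ (∀ e ∈ a, q' ∉ Bs e.1 ∧ q' ∉ Gs e.1) ∧
      (upd n k Bs Gs q' pre rest = fe n (pre ++ a) (nxt k (pre ++ a) e.1) ∨
       upd n k Bs Gs q' pre rest = fe n (pre ++ a) e.1) := by
  induction rest generalizing pre with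
  | nil => left; simp [upd]
  | cons e t ih =>
    by_cases hB : q' ∈ Bs e.1
    · right; exact ⟨[], e, by simp, by simp, by left; simp [upd, hB]⟩
    by_cases hG : q' ∈ Gs e.1
    · right; exact ⟨[], e, by simp, by simp, by right; simp [upd, hB, hG]⟩
    have hu : upd n k Bs Gs q' pre (e :: t) = upd n k Bs Gs q' (pre ++ [e]) t := by
      rw [upd, if_neg hB, if_neg hG]
    rw [hu]
    rcases ih (pre ++ [e]) with ⟨h1, h2⟩ | ⟨a, f, h1, h2, h3⟩
    · left
      refine ⟨by rw [h1]; simp, ?_⟩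
      intro x hx
      rcases List.mem_cons.1 hx with rfl | hx
      · exact ⟨hB, hG⟩
      · exact h2 x hx
    · right
      refine ⟨e :: a, f, by simpa using h1, ?_, by simpa using h3⟩
      intro x hx
      rcases List.mem_cons.1 hx with rfl | hx
      · exact ⟨hB, hG⟩
      · exact h2 x hx

def key (p : Pth) : List (ℕ ×ₗ ℕ) := p.map toLex

lemma key_le {v s t : Pth} {e f : ℕ × ℕ} (h : key (v ++ e :: s) ≤ key (v ++ f :: t)) :
    toLex e ≤ toLex f := by
  by_contra h2
  rw [not_le] at h2
  have h3 : key (v ++ f :: t) < key (v ++ e :: s) := by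
    unfold key
    rw [List.map_append, List.map_append, List.map_cons, List.map_cons]
    exact List.Lex.append_left _ (List.Lex.rel h2) _
  exact absurd h (not_le.2 h3)

structure RawSpec (n k : ℕ) (Bs Gs : ℕ → Set Q) (D : Q → Q → Prop) (π R : Q → Option Pth) : Prop where
  s1 : ∀ q' p, R q' = some p → ∃ q p0, D q q' ∧ π q = some p0 ∧ p = upd n k Bs Gs q' [] p0
  s2 : ∀ q q' p0, D q q' → π q = some p0 →
    ∃ p, R q' = some p ∧ key p ≤ key (upd n k Bs Gs q' [] p0)

lemma raw_exists [Finite Q] (n k : ℕ) (Bs Gs : ℕ → Set Q) (D : Q → Q → Prop) (π : Q → Option Pth) :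
    ∃ R, RawSpec n k Bs Gs D π R := by
  have : ∀ q', ∃ o : Option Pth,
      (∀ p, o = some p → ∃ q p0, D q q' ∧ π q = some p0 ∧ p = upd n k Bs Gs q' [] p0) ∧
      (∀ q p0, D q q' → π q = some p0 → ∃ p, o = some p ∧ key p ≤ key (upd n k Bs Gs q' [] p0)) := by
    intro q'
    let P : Set Q := {q | D q q' ∧ (π q).isSome}
    by_cases hP : P.Nonempty
    · obtain ⟨q, hq, hmin⟩ := Set.exists_min_image P
        (fun q => key (upd n k Bs Gs q' [] ((π q).getD []))) (Set.toFinite P) hP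
      obtain ⟨p0, hp0⟩ := Option.isSome_iff_exists.1 hq.2
      refine ⟨some (upd n k Bs Gs q' [] p0), ?_, ?_⟩
      · intro p hp
        exact ⟨q, p0, hq.1, hp0, (Option.some.inj hp).symm⟩
      · intro r p1 h1 h2
        have := hmin r ⟨h1, by simp [h2]⟩
        simp only [h2, hp0, Option.getD_some] at this
        exact ⟨_, rfl, this⟩
    · refine ⟨none, by simp, ?_⟩
      intro q p0 h1 h2
      exact absurd ⟨q, h1, by simp [h2]⟩ hP
  choose R hR using this
  exact ⟨R, fun q' p h => (hR q').1 p h, fun q q' p0 h1 h2 => (hR q').2 q p0 h1 h2⟩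

lemma raw_nodes {n k : ℕ} {Bs Gs : ℕ → Set Q} {D : Q → Q → Prop} {π R : Q → Option Pth}
    (h : RawSpec n k Bs Gs D π R) (hV : Valid n k π) {v : Pth} (hv : v ∈ Nodes R) :
    v ∈ Nodes π ∨ ∃ u j, v = fe n u j ∧ (j = 0 ∨ j ∈ hope k u) := by
  obtain ⟨q', p, h1, h2⟩ := hv
  obtain ⟨q, p0, h3, h4, rfl⟩ := h.s1 _ _ h1
  rcases upd_cases n k Bs Gs q' [] p0 with ⟨h5, -⟩ | ⟨a, ⟨i, c⟩, h5, -, h6⟩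
  · rw [h5] at h2; exact Or.inl ⟨q, p0, h4, by simpa using h2⟩
  · have h7 : a ++ [(i, c)] ∈ Nodes π := ⟨q, p0, h4, h5⟩
    have h8 : a <+: p0 := (List.prefix_append _ _).trans h5
    rw [List.nil_append] at h6
    rcases h6 with h6 | h6
    · rw [h6] at h2
      rcases prefix_snoc h2 with h9 | h9
      · exact Or.inr ⟨a, _, h9, nxt_spec _ _ _⟩
      · exact Or.inl ⟨q, p0, h4, h9.trans h8⟩
    · rw [h6] at h2
      rcases prefix_snoc h2 with h9 | h9
      · exact Or.inr ⟨a, _, h9, hV.pre.wf _ _ _ h7⟩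
      · exact Or.inl ⟨q, p0, h4, h9.trans h8⟩

lemma raw_pre {n k : ℕ} (hn : 1 ≤ n) {Bs Gs : ℕ → Set Q} {D : Q → Q → Prop} {π R : Q → Option Pth}
    (h : RawSpec n k Bs Gs D π R) (hV : Valid n k π) : Pre n k (Nodes R) :=
  hV.pre.extend hn (fun _ hv => raw_nodes h hV hv)

def Good (n k : ℕ) (R : Q → Option Pth) (v : Pth) : Prop :=
  v ∈ Nodes (R3 n k R) ∧ nu (Nodes (R3 n k R)) [] v = v

/-- `v` ends in an old edge. -/
def Old (n : ℕ) (v : Pth) : Prop := ∀ u j, v ≠ fe n u j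

lemma old_of {n k : ℕ} {π : Q → Option Pth} (h : Valid n k π) {v : Pth} (hv : v ∈ Nodes π) :
    Old n v := by
  rintro u j rfl
  have := h.bd u j _ hv
  have := fr_ge n u j
  omega

lemma Good.mem {n k : ℕ} {R : Q → Option Pth} {v : Pth} (h : Good n k R v) :
    v ∈ Nodes (norm n k R) := (norm_nodes _).2 ⟨v, h.1, h.2.symm⟩

lemma good_old {n k : ℕ} {Bs Gs : ℕ → Set Q} {D : Q → Q → Prop} {π R : Q → Option Pth}
    (h : RawSpec n k Bs Gs D π R) (hV : Valid n k π) (hV' : Valid n k (norm n k R)) {v : Pth}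
    (hg : Good n k R v) : v ∈ Nodes π := by
  have ho := old_of hV' hg.mem
  rcases R3_cases hg.1 with h1 | ⟨u, j, h1, -⟩
  · rcases raw_nodes h hV h1.1 with h2 | ⟨u, j, h2, -⟩
    · exact h2
    · exact absurd h2 (ho u j)
  · exact absurd h1 (ho u j)

lemma back {n k : ℕ} (hn : 1 ≤ n) {R : Q → Option Pth} (hP : Pre n k (Nodes R))
    (hV' : Valid n k (norm n k R)) {v : Pth} (hg : Good n k R v) {q' : Q} {p' : Pth}
    (hp : norm n k R q' = some p') (hv : v <+: p') :
    ∃ p1, R q' = some p1 ∧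
      p' = nu (Nodes (R3 n k R)) [] (ext n k (trunc (Green R) [] p1)) ∧
      v <+: trunc (Green R) [] p1 := by
  have ho := old_of hV' hg.mem
  have hp2 := hp
  simp only [norm, Option.map_eq_some_iff] at hp2
  obtain ⟨p3, h3, rfl⟩ := hp2
  have h3' := h3
  simp only [R3, Option.map_eq_some_iff] at h3'
  obtain ⟨p1, h1, rfl⟩ := h3'
  refine ⟨p1, h1, rfl, ?_⟩
  obtain ⟨v0, h4, h5⟩ := nu_prefix _ hv
  have h6 : v0 ∈ Nodes (R3 n k R) := ⟨q', _, h3, h4⟩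
  have := nu_inj (nodes_snoc _) (R3_pre hn hP) v v0 hg.1 h6 (hg.2.trans h5)
  subst this
  rcases ext_cases h4 with h7 | ⟨u, j, h7, -⟩
  · exact h7
  · exact absurd h7 (ho u j)

lemma pass {n k : ℕ} {Bs Gs : ℕ → Set Q} {q' : Q} {p0 v : Pth} (ho : Old n v)
    (h : v <+: upd n k Bs Gs q' [] p0) :
    v <+: p0 ∧ (∀ e ∈ v, q' ∉ Bs e.1 ∧ q' ∉ Gs e.1) := by
  rcases upd_cases n k Bs Gs q' [] p0 with ⟨h5, h6⟩ | ⟨a, e, h5, h6, h7⟩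
  · rw [h5] at h
    exact ⟨by simpa using h, fun e he => h6 e (h.subset he)⟩
  · have h8 : a <+: p0 := (List.prefix_append _ _).trans h5
    rw [List.nil_append] at h7
    have h9 : v <+: a := by
      rcases h7 with h7 | h7 <;> rw [h7] at h <;> rcases prefix_snoc h with h9 | h9
      · exact absurd h9 (ho _ _)
      · exact h9
      · exact absurd h9 (ho _ _)
      · exact h9
    exact ⟨h9.trans h8, fun e he => h6 e (h9.subset he)⟩

lemma child_keep {R : Q → Option Pth} {v p1 : Pth} {e : ℕ × ℕ} (h : v <+: trunc (Green R) [] p1)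
    (he : v ++ [e] <+: p1) (hg : ¬ Green R v) : v ++ [e] <+: trunc (Green R) [] p1 := by
  rw [trunc_iff] at h ⊢
  refine ⟨he, fun u hu hne => ?_⟩
  rcases prefix_snoc hu with h1 | h1
  · exact absurd h1 hne
  · by_cases huv : u = v
    · rw [huv]; exact hg
    · exact h.2 u h1 huv

lemma next_unique {v p : Pth} {e f : ℕ × ℕ} (h1 : v ++ [e] <+: p) (h2 : v ++ [f] <+: p) : e = f := by
  have := List.prefix_of_prefix_length_le h1 h2 (by simp)
  have := this.eq_of_length (by simp)
  simpa using this

lemma full_green {n k : ℕ} {R : Q → Option Pth} (hP : Pre n k (Nodes R)) {v : Pth}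
    (h : hope k v = ∅) : Green R v := by
  intro j c hv
  rcases hP.wf _ _ _ hv with h1 | h1
  · exact h1
  · rw [h] at h1; simp at h1

lemma ev_const {f : ℕ → ℕ} {T : ℕ} (h : ∀ t ≥ T, f (t + 1) ≤ f t) :
    ∃ T' ≥ T, ∀ t ≥ T', f t = f T' := by
  have anti : ∀ d t, T ≤ t → f (t + d) ≤ f t := by
    intro d
    induction d with
    | zero => intro t _; exact le_rfl
    | succ d ih => intro t ht; exact (h (t + d) (by omega)).trans (ih t ht)
  have hex : ∃ x, ∃ t ≥ T, f t = x := ⟨_, T, le_rfl, rfl⟩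
  obtain ⟨T', h1, h2⟩ := Nat.find_spec hex
  refine ⟨T', h1, fun t ht => ?_⟩
  have h3 := anti (t - T') T' h1
  rw [show T' + (t - T') = t by omega] at h3
  have h4 := Nat.find_min' hex ⟨t, by omega, rfl⟩
  omega

structure Sys (n k : ℕ) (Bs Gs : ℕ → Set Q) (D : ℕ → Q → Q → Prop)
    (π R : ℕ → Q → Option Pth) : Prop where
  hn : 1 ≤ n
  hk : 1 ≤ k
  V : ∀ t, Valid n k (π t)
  raw : ∀ t, RawSpec n k Bs Gs (D t) (π t) (R t)
  nxt : ∀ t, π (t + 1) = norm n k (R t)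
  B0 : Bs 0 = ∅
  G0 : Gs 0 = ∅

variable {n k : ℕ} {Bs Gs : ℕ → Set Q} {D : ℕ → Q → Q → Prop} {π R : ℕ → Q → Option Pth}

lemma Sys.pre (S : Sys n k Bs Gs D π R) (t : ℕ) : Pre n k (Nodes (R t)) :=
  raw_pre S.hn (S.raw t) (S.V t)

lemma Sys.V' (S : Sys n k Bs Gs D π R) (t : ℕ) : Valid n k (norm n k (R t)) := by
  rw [← S.nxt]; exact S.V _

/-- Soundness along a single run. -/
lemma Sys.sound (S : Sys n k Bs Gs D π R) {v : Pth} {T : ℕ} {ρ : ℕ → Q}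
    (hg : ∀ t ≥ T, Good n k (R t) v) (hgr : ∀ N, ∃ t ≥ N, Green (R t) v)
    (hv : ∀ t ≥ T, ∃ p, π t (ρ t) = some p ∧ v <+: p ∧
      R t (ρ (t + 1)) = some (upd n k Bs Gs (ρ (t + 1)) [] p)) :
    (∀ e ∈ v, ∀ t ≥ T, ρ (t + 1) ∉ Gs e.1) ∧
    (∀ j ∈ hope k v, ∀ N, ∃ t ≥ N, ρ t ∈ Bs j) := by
  have hold : Old n v := old_of (S.V' T) (hg T le_rfl).mem
  -- one step facts
  have step : ∀ t ≥ T, ∀ p, π t (ρ t) = some p → v <+: p →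
      R t (ρ (t + 1)) = some (upd n k Bs Gs (ρ (t + 1)) [] p) →
      ∃ p', π (t + 1) (ρ (t + 1)) = some p' ∧
        p' = nu (Nodes (R3 n k (R t))) []
          (ext n k (trunc (Green (R t)) [] (upd n k Bs Gs (ρ (t + 1)) [] p))) ∧
        v <+: trunc (Green (R t)) [] (upd n k Bs Gs (ρ (t + 1)) [] p) := by
    intro t ht p h1 h2 h3
    obtain ⟨p', h4, h5, -⟩ := hv (t + 1) (by omega)
    rw [S.nxt] at h4
    obtain ⟨p1, h6, h7, h8⟩ := back S.hn (S.pre t) (S.V' t) (hg t ht) h4 h5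
    rw [h3] at h6
    obtain rfl := Option.some.inj h6
    exact ⟨p', by rw [S.nxt]; exact h4, h7, h8⟩
  refine ⟨?_, ?_⟩
  · intro e he t ht
    obtain ⟨p, h1, h2, h3⟩ := hv t ht
    obtain ⟨p', h4, h5, h6⟩ := step t ht p h1 h2 h3
    exact ((pass hold (h6.trans (trunc_prefix _ _))).2 e he).2
  · intro j hj N
    by_contra hcon
    push Not at hcon
    obtain ⟨t1, ht1, hgreen⟩ := hgr (max T N)
    have hj0 := hope_pos hj
    have inv : ∀ d, ∃ p i c, π (t1 + 1 + d) (ρ (t1 + 1 + d)) = some p ∧ v ++ [(i, c)] <+: p ∧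
        j ≤ i := by
      intro d
      induction d with
      | zero =>
        obtain ⟨p, h1, h2, h3⟩ := hv t1 (by omega)
        obtain ⟨p', h4, h5, h6⟩ := step t1 (by omega) p h1 h2 h3
        have h7 : trunc (Green (R t1)) [] (upd n k Bs Gs (ρ (t1 + 1)) [] p) = v := by
          by_contra hne
          obtain ⟨e, he⟩ := exists_next h6 (fun h => hne h.symm)
          exact ((trunc_iff _ _ _).1 he).2 v (List.prefix_append _ _) (by simp) hgreen
        rw [h7] at h5
        have h8 : hope k v ≠ ∅ := by intro h; rw [h] at hj; simp at hj
        have h9 := nu_mono (Nodes (R3 n k (R t1))) (ext_first (n := n) S.hk h8)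
        unfold fe at h9
        rw [nu_snoc, (hg t1 (by omega)).2, ← h5] at h9
        exact ⟨p', _, _, h4, h9, Finset.le_sup (f := id) hj⟩
      | succ d ih =>
        obtain ⟨p, i, c, h1, h2, h3⟩ := ih
        set t := t1 + 1 + d with ht
        obtain ⟨p0, h4, h5, h6⟩ := hv t (by omega)
        rw [h1] at h4
        obtain rfl := Option.some.inj h4
        obtain ⟨p', h7, h8, h9⟩ := step t (by omega) p h1 h5 h6
        have hav := (pass hold (h9.trans (trunc_prefix _ _))).2
        have hch : ∃ i' c', j ≤ i' ∧ v ++ [(i', c')] <+: upd n k Bs Gs (ρ (t + 1)) [] p := by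
          obtain ⟨s, rfl⟩ := h2
          rw [List.append_assoc, upd_append _ _ _ _ _ _ _ _ hav, List.nil_append, List.singleton_append]
          unfold upd
          by_cases hB : ρ (t + 1) ∈ Bs i
          · rw [if_pos hB]
            have hij : j ≠ i := by rintro rfl; exact hcon (t + 1) (by omega) hB
            exact ⟨_, _, le_nxt k v hj (by omega), List.prefix_rfl⟩
          · rw [if_neg hB]
            by_cases hG : ρ (t + 1) ∈ Gs i
            · rw [if_pos hG]
              exact ⟨_, _, h3, List.prefix_rfl⟩
            · rw [if_neg hG]
              exact ⟨i, c, h3, upd_prefix _ _ _ _ _ _ _⟩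
        obtain ⟨i', c', h10, h11⟩ := hch
        have hng : ¬ Green (R t) v := by
          intro hG
          have := hG i' c' ⟨_, _, h6, h11⟩
          omega
        have h12 := nu_mono (Nodes (R3 n k (R t)))
          ((child_keep h9 h11 hng).trans (ext_prefix n k _))
        rw [nu_snoc, (hg t (by omega)).2, ← h8] at h12
        exact ⟨p', _, _, h7, h12, h10⟩
    obtain ⟨t2, ht2, hgreen2⟩ := hgr (t1 + 1)
    obtain ⟨p, i, c, h1, h2, h3⟩ := inv (t2 + 1 - (t1 + 1))
    rw [show t1 + 1 + (t2 + 1 - (t1 + 1)) = t2 + 1 by omega] at h1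
    obtain ⟨p0, i0, c0, h1', h2', h3'⟩ := inv (t2 - (t1 + 1))
    rw [show t1 + 1 + (t2 - (t1 + 1)) = t2 by omega] at h1'
    obtain ⟨pp, h4, h5, h6⟩ := hv t2 (by omega)
    rw [h1'] at h4
    obtain rfl := Option.some.inj h4
    obtain ⟨p', h7, h8, h9⟩ := step t2 (by omega) p0 h1' h5 h6
    have hav := (pass hold (h9.trans (trunc_prefix _ _))).2
    obtain ⟨s, rfl⟩ := h2'
    rw [List.append_assoc, upd_append _ _ _ _ _ _ _ _ hav, List.nil_append,
      List.singleton_append] at h6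
    unfold upd at h6
    by_cases hB : ρ (t2 + 1) ∈ Bs i0
    · rw [if_pos hB] at h6
      have hij : j ≠ i0 := by rintro rfl; exact hcon (t2 + 1) (by omega) hB
      have h10 := le_nxt k v hj (show j < i0 by omega)
      have : SD.nxt k v i0 = 0 := hgreen2 _ _ ⟨_, _, h6, List.prefix_rfl⟩
      omega
    · rw [if_neg hB] at h6
      by_cases hG : ρ (t2 + 1) ∈ Gs i0
      · rw [if_pos hG] at h6
        have : i0 = 0 := hgreen2 _ _ ⟨_, _, h6, List.prefix_rfl⟩
        omega
      · rw [if_neg hG] at h6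
        have := hgreen2 i0 c0 ⟨_, _, h6, upd_prefix _ _ _ _ _ _ _⟩
        omega
end dyn

section fin
variable {Q : Type}

def Reach (X : ℕ → Set Q) (E : ℕ → Q → Q → Prop) : ℕ → ℕ → Q → Prop
  | 0, t, q => q ∈ X t
  | d + 1, t, q => q ∈ X t ∧ ∃ q', E t q q' ∧ Reach X E d (t + 1) q'

lemma Reach.mem {X : ℕ → Set Q} {E : ℕ → Q → Q → Prop} {d t : ℕ} {q : Q} (h : Reach X E d t q) :
    q ∈ X t := by
  cases d with
  | zero => exact h
  | succ d => exact h.1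

lemma Reach.mono {X : ℕ → Set Q} {E : ℕ → Q → Q → Prop} {a b t : ℕ} {q : Q} (hab : a ≤ b)
    (h : Reach X E b t q) : Reach X E a t q := by
  induction b generalizing a t q with
  | zero => obtain rfl : a = 0 := by omega
            exact h
  | succ b ih =>
    cases a with
    | zero => exact h.1
    | succ a =>
      obtain ⟨h1, q', h2, h3⟩ := h
      exact ⟨h1, q', h2, ih (by omega) h3⟩

lemma Reach.zero {X : ℕ → Set Q} {E : ℕ → Q → Q → Prop}
    (hp : ∀ t, ∀ q' ∈ X (t + 1), ∃ q ∈ X t, E t q q') (t d : ℕ) (q : Q)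
    (h : Reach X E d t q) : ∃ q0, Reach X E (t + d) 0 q0 := by
  induction t generalizing d q with
  | zero => exact ⟨q, by simpa using h⟩
  | succ t ih =>
    obtain ⟨q0, h1, h2⟩ := hp t q h.mem
    obtain ⟨q1, h3⟩ := ih (d + 1) q0 ⟨h1, q, h2, h⟩
    exact ⟨q1, by rw [show t + 1 + d = t + (d + 1) by omega]; exact h3⟩

lemma unif [Finite Q] {P : Q → Prop} {F : ℕ → Q → Prop} (hF : ∀ a b q, a ≤ b → F b q → F a q)
    (h : ∀ d, ∃ q, P q ∧ F d q) : ∃ q, P q ∧ ∀ d, F d q := by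
  by_contra hcon
  have : ∀ q, ∃ d, P q → ¬ F d q := by
    intro q
    by_contra h2
    push Not at h2
    exact hcon ⟨q, (h2 0).1, fun d => (h2 d).2⟩
  choose d hd using this
  obtain ⟨M, hM⟩ := (Set.finite_range d).bddAbove
  obtain ⟨q, h1, h2⟩ := h M
  exact hd q h1 (hF _ _ q (hM ⟨q, rfl⟩) h2)

lemma konig [Finite Q] {X : ℕ → Set Q} {E : ℕ → Q → Q → Prop}
    (hne : ∀ N, ∃ t ≥ N, (X t).Nonempty)
    (hp : ∀ t, ∀ q' ∈ X (t + 1), ∃ q ∈ X t, E t q q') :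
    ∃ ρ : ℕ → Q, ∀ t, ρ t ∈ X t ∧ E t (ρ t) (ρ (t + 1)) := by
  have h0 : ∃ q, True ∧ ∀ d, Reach X E d 0 q := by
    refine unif (P := fun _ => True) (F := fun d q => Reach X E d 0 q)
      (fun a b q hab h => Reach.mono hab h) ?_
    intro d
    obtain ⟨t, ht, q, hq⟩ := hne d
    obtain ⟨q0, h⟩ := Reach.zero hp t 0 q hq
    exact ⟨q0, trivial, h.mono (by omega)⟩
  obtain ⟨q0, -, h0⟩ := h0
  have hs : ∀ t q, (∀ d, Reach X E d t q) → ∃ q', E t q q' ∧ ∀ d, Reach X E d (t + 1) q' := by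
    intro t q h
    refine unif (P := fun q' => E t q q') (F := fun d q => Reach X E d (t + 1) q)
      (fun a b q hab h => Reach.mono hab h) ?_
    intro d
    exact (h (d + 1)).2
  choose! f hf using hs
  let ρ : ℕ → Q := fun t => Nat.rec q0 (fun t q => f t q) t
  have hr : ∀ t d, Reach X E d t (ρ t) := by
    intro t
    induction t with
    | zero => exact h0
    | succ t ih => exact (hf t (ρ t) ih).2
  exact ⟨ρ, fun t => ⟨(hr t 0).mem, (hf t (ρ t) (hr t)).1⟩⟩

lemma norm_some {n k : ℕ} {R : Q → Option Pth} {q : Q} {p : Pth} (h : norm n k R q = some p) :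
    ∃ p1, R q = some p1 := by
  simp only [norm, Option.map_eq_some_iff, R3] at h
  obtain ⟨_, ⟨p1, h1, _⟩, _⟩ := h
  exact ⟨p1, h1⟩

variable {n k : ℕ} {Bs Gs : ℕ → Set Q} {D : ℕ → Q → Q → Prop} {π R : ℕ → Q → Option Pth}

lemma Sys.soundness [Finite Q] (S : Sys n k Bs Gs D π R) {v : Pth} {T : ℕ}
    (hg : ∀ t ≥ T, Good n k (R t) v) (hgr : ∀ N, ∃ t ≥ N, Green (R t) v) :
    ∃ ρ : ℕ → Q, (π 0 (ρ 0)).isSome ∧ (∀ t, D t (ρ t) (ρ (t + 1))) ∧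
      ∀ j, 1 ≤ j → j ≤ k → (∀ N, ∃ t ≥ N, ρ t ∈ Gs j) → ∀ N, ∃ t ≥ N, ρ t ∈ Bs j := by
  have hold : Old n v := old_of (S.V' T) (hg T le_rfl).mem
  obtain ⟨ρ, hρ⟩ := konig (X := fun t => {q | ∃ p, π t q = some p ∧ (T ≤ t → v <+: p)})
    (E := fun t q q' => D t q q' ∧ ∃ p, π t q = some p ∧
      R t q' = some (upd n k Bs Gs q' [] p)) (by
      intro N
      obtain ⟨q, p, h1, h2⟩ := (hg (max N T) (by omega)).mem
      rw [← S.nxt] at h1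
      exact ⟨max N T + 1, by omega, q, p, h1, fun _ => h2⟩) (by
      rintro t q' ⟨p', h1, h2⟩
      by_cases ht : T ≤ t
      · rw [S.nxt] at h1
        obtain ⟨p1, h3, h4, h5⟩ := back S.hn (S.pre t) (S.V' t) (hg t ht) h1 (h2 (by omega))
        obtain ⟨q, p0, h6, h7, rfl⟩ := (S.raw t).s1 _ _ h3
        exact ⟨q, ⟨p0, h7, fun _ => (pass hold (h5.trans (trunc_prefix _ _))).1⟩, h6, p0, h7, h3⟩
      · rw [S.nxt] at h1
        obtain ⟨p1, h3⟩ := norm_some h1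
        obtain ⟨q, p0, h6, h7, rfl⟩ := (S.raw t).s1 _ _ h3
        exact ⟨q, ⟨p0, h7, fun h => absurd h ht⟩, h6, p0, h7, h3⟩)
  have hs := S.sound (ρ := ρ) hg hgr (by
    intro t ht
    obtain ⟨⟨p, h1, h2⟩, -, p0, h3, h4⟩ := hρ t
    rw [h1] at h3
    obtain rfl := Option.some.inj h3
    exact ⟨p, h1, h2 ht, h4⟩)
  refine ⟨ρ, ?_, fun t => (hρ t).2.1, ?_⟩
  · obtain ⟨⟨p, h1, -⟩, -⟩ := hρ 0
    simp [h1]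
  · intro j hj1 hjk hG
    by_cases hj : j ∈ v.map Prod.fst
    · obtain ⟨e, he, rfl⟩ := List.mem_map.1 hj
      obtain ⟨t, ht, h⟩ := hG (T + 1)
      have := hs.1 e he (t - 1) (by omega)
      rw [show t - 1 + 1 = t by omega] at this
      exact absurd h this
    · exact hs.2 j (by simp only [hope, Finset.mem_filter, Finset.mem_Icc]; exact ⟨⟨hj1, hjk⟩, hj⟩)

/-- the run stays below `v` -/
def Cl (n k : ℕ) (Bs Gs : ℕ → Set Q) (π R : ℕ → Q → Option Pth) (ρ : ℕ → Q) (v : Pth) (T : ℕ) :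
    Prop :=
  ∀ t ≥ T, Good n k (R t) v ∧ (∃ p, π t (ρ t) = some p ∧ v <+: p) ∧
    ∀ e ∈ v, ρ (t + 1) ∉ Bs e.1 ∧ ρ (t + 1) ∉ Gs e.1

lemma Sys.one (S : Sys n k Bs Gs D π R) {ρ : ℕ → Q} (hD : ∀ t, D t (ρ t) (ρ (t + 1)))
    {v : Pth} {T : ℕ} (hC : Cl n k Bs Gs π R ρ v T) {t : ℕ} (ht : T ≤ t)
    (hng : ¬ Green (R t) v) {p : Pth} {e : ℕ × ℕ} (hp : π t (ρ t) = some p)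
    (he : v ++ [e] <+: p) :
    ∃ e' p', v ++ [e'] ∈ Nodes (R3 n k (R t)) ∧ π (t + 1) (ρ (t + 1)) = some p' ∧
      v ++ [re (Nodes (R3 n k (R t))) v e'] <+: p' ∧ e'.1 ≤ e.1 ∧
      (ρ (t + 1) ∈ Bs e.1 → e'.1 < e.1) ∧
      (ρ (t + 1) ∉ Bs e.1 → ρ (t + 1) ∉ Gs e.1 → e'.1 = e.1 → e'.2 ≤ e.2) := by
  obtain ⟨hgood, -, hav⟩ := hC t ht
  have hold : Old n v := old_of (S.V' t) hgood.mem
  obtain ⟨-, ⟨p', h1, h2⟩, -⟩ := hC (t + 1) (by omega)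
  have h1' := h1
  rw [S.nxt] at h1'
  obtain ⟨p1, h3, h4, h5⟩ := back S.hn (S.pre t) (S.V' t) hgood h1' h2
  have hvp1 : v <+: p1 := h5.trans (trunc_prefix _ _)
  have hne : v ≠ p1 := by
    rintro rfl
    obtain ⟨q, p0, h6, h7, h8⟩ := (S.raw t).s1 _ _ h3
    rcases upd_cases n k Bs Gs (ρ (t + 1)) [] p0 with ⟨h9, -⟩ | ⟨a, f, -, -, h9 | h9⟩
    · rw [h9, List.nil_append] at h8
      have := (S.V t).full _ _ h7
      rw [← h8] at this
      exact hng (full_green (S.pre t) this)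
    · exact hold _ _ (h8.trans h9)
    · exact hold _ _ (h8.trans h9)
  obtain ⟨e', he'⟩ := exists_next hvp1 hne
  have h6 := (child_keep h5 he' hng).trans (ext_prefix n k _)
  have h7 : v ++ [e'] ∈ Nodes (R3 n k (R t)) := ⟨ρ (t + 1), _, by simp [R3, h3], h6⟩
  have h8 := nu_mono (Nodes (R3 n k (R t))) h6
  rw [nu_snoc, hgood.2, ← h4] at h8
  obtain ⟨pp, h9, h10⟩ := (S.raw t).s2 _ _ _ (hD t) hp
  rw [h3] at h9
  obtain rfl := Option.some.inj h9
  obtain ⟨s, rfl⟩ := he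
  obtain ⟨s1, rfl⟩ := he'
  rw [List.append_assoc v [e], upd_append _ _ _ _ _ _ _ _ hav, List.nil_append,
    List.singleton_append, List.append_assoc, List.singleton_append] at h10
  unfold upd at h10
  refine ⟨e', p', h7, h1, h8, ?_⟩
  by_cases hB : ρ (t + 1) ∈ Bs e.1
  · rw [if_pos hB] at h10
    have h11 := key_le h10
    rw [Prod.Lex.toLex_le_toLex] at h11
    have h0 : e.1 ≠ 0 := by intro h0; rw [h0, S.B0] at hB; exact hB
    have := nxt_lt k v h0
    simp only at h11
    exact ⟨by omega, fun _ => by omega, fun h => absurd hB h⟩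
  · rw [if_neg hB] at h10
    by_cases hG : ρ (t + 1) ∈ Gs e.1
    · rw [if_pos hG] at h10
      have h11 := key_le h10
      rw [Prod.Lex.toLex_le_toLex] at h11
      simp only at h11
      exact ⟨by omega, fun h => absurd h hB, fun _ h => absurd hG h⟩
    · rw [if_neg hG] at h10
      obtain ⟨s2, h12⟩ := upd_prefix n k Bs Gs (ρ (t + 1)) (v ++ [e]) s
      rw [← h12, List.append_assoc v [e], List.singleton_append] at h10
      have h11 := key_le h10
      rw [Prod.Lex.toLex_le_toLex] at h11
      exact ⟨by omega, fun h => absurd h hB, fun _ _ _ => by omega⟩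

lemma Sys.step (S : Sys n k Bs Gs D π R) {ρ : ℕ → Q} (hD : ∀ t, D t (ρ t) (ρ (t + 1)))
    (hacc : ∀ j, (∀ N, ∃ t ≥ N, ρ t ∈ Gs j) → ∀ N, ∃ t ≥ N, ρ t ∈ Bs j)
    {v : Pth} {T : ℕ} (hC : Cl n k Bs Gs π R ρ v T) (hng : ∀ t ≥ T, ¬ Green (R t) v) :
    ∃ e T', Cl n k Bs Gs π R ρ (v ++ [e]) T' := by
  have hex : ∀ t, ∃ e, T ≤ t → ∃ p, π t (ρ t) = some p ∧ v ++ [e] <+: p := by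
    intro t
    by_cases ht : T ≤ t
    · obtain ⟨-, ⟨p, h1, h2⟩, -⟩ := hC t ht
      have hne : v ≠ p := by
        rintro rfl
        exact hng t ht (full_green (S.pre t) ((S.V t).full _ _ h1))
      obtain ⟨e, he⟩ := exists_next h2 hne
      exact ⟨e, fun _ => ⟨p, h1, he⟩⟩
    · exact ⟨(0, 0), fun h => absurd h ht⟩
  choose e he using hex
  have hst : ∀ t, ∃ e', T ≤ t → v ++ [e'] ∈ Nodes (R3 n k (R t)) ∧
      e (t + 1) = re (Nodes (R3 n k (R t))) v e' ∧ e'.1 ≤ (e t).1 ∧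
      (ρ (t + 1) ∈ Bs (e t).1 → e'.1 < (e t).1) ∧
      (ρ (t + 1) ∉ Bs (e t).1 → ρ (t + 1) ∉ Gs (e t).1 → e'.1 = (e t).1 → e'.2 ≤ (e t).2) := by
    intro t
    by_cases ht : T ≤ t
    · obtain ⟨p, h1, h2⟩ := he t ht
      obtain ⟨e', p', h3, h4, h5, h6⟩ := S.one hD hC ht (hng t ht) h1 h2
      obtain ⟨p2, h7, h8⟩ := he (t + 1) (by omega)
      rw [h4] at h7
      obtain rfl := Option.some.inj h7
      exact ⟨e', fun _ => ⟨h3, next_unique h8 h5, h6⟩⟩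
    · exact ⟨(0, 0), fun h => absurd h ht⟩
  choose e' he' using hst
  have hl : ∀ t ≥ T, (e (t + 1)).1 = (e' t).1 := by
    intro t ht; rw [(he' t ht).2.1]; rfl
  obtain ⟨T1, hT1, hc1⟩ := ev_const (f := fun t => (e t).1) (T := T) (fun t ht => by
    rw [hl t ht]; exact (he' t ht).2.2.1)
  have hnB : ∀ t ≥ T1, ρ (t + 1) ∉ Bs (e T1).1 := by
    intro t ht hB
    have h1 := hc1 t ht
    have h2 := hc1 (t + 1) (by omega)
    have h3 := (he' t (by omega)).2.2.2.1 (by rw [h1]; exact hB)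
    rw [← hl t (by omega)] at h3
    omega
  obtain ⟨T2, hT2, hnG⟩ : ∃ T2 ≥ T1, ∀ t ≥ T2, ρ (t + 1) ∉ Gs (e T1).1 := by
    by_contra hcon
    push Not at hcon
    have h1 := hacc (e T1).1 (fun N => by
      obtain ⟨t, ht, h⟩ := hcon (max N T1) (by omega)
      exact ⟨t + 1, by omega, h⟩) (T1 + 1)
    obtain ⟨t, ht, h⟩ := h1
    have := hnB (t - 1) (by omega)
    rw [show t - 1 + 1 = t by omega] at this
    exact this h
  have h2le : ∀ t ≥ T2, (e' t).2 ≤ (e t).2 := by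
    intro t ht
    have h1 := hc1 t (by omega)
    have h2 := hc1 (t + 1) (by omega)
    refine (he' t (by omega)).2.2.2.2 (by rw [h1]; exact hnB t (by omega))
      (by rw [h1]; exact hnG t ht) ?_
    rw [← hl t (by omega), h2, h1]
  have h3le : ∀ t ≥ T2, (e (t + 1)).2 ≤ (e' t).2 := by
    intro t ht
    rw [(he' t (by omega)).2.1]
    exact re_le (R3_pre S.hn (S.pre t)) (he' t (by omega)).1
  obtain ⟨T3, hT3, hc2⟩ := ev_const (f := fun t => (e t).2) (T := T2)
    (fun t ht => (h3le t ht).trans (h2le t ht))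
  have heq : ∀ t ≥ T3, e t = e T3 := fun t ht =>
    Prod.ext ((hc1 t (by omega)).trans (hc1 T3 (by omega)).symm) (hc2 t ht)
  have heq' : ∀ t ≥ T3, e' t = e T3 := by
    intro t ht
    refine Prod.ext ?_ ?_
    · rw [← hl t (by omega), heq (t + 1) (by omega)]
    · have h1 := h2le t (by omega)
      have h2 := h3le t (by omega)
      rw [heq t ht] at h1
      rw [heq (t + 1) (by omega)] at h2
      omega
  refine ⟨e T3, T3, fun t ht => ⟨⟨?_, ?_⟩, ?_, ?_⟩⟩
  · have := (he' t (by omega)).1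
    rwa [heq' t ht] at this
  · have h1 := (he' t (by omega)).2.1
    rw [heq' t ht, heq (t + 1) (by omega)] at h1
    rw [nu_snoc, (hC t (by omega)).1.2, ← h1]
  · have := he t (by omega)
    rwa [heq t ht] at this
  · intro x hx
    rcases List.mem_append.1 hx with hx | hx
    · exact (hC t (by omega)).2.2 x hx
    · rw [List.mem_singleton.1 hx, hc1 T3 (by omega)]
      exact ⟨hnB t (by omega), hnG t (by omega)⟩

lemma Sys.completeness (S : Sys n k Bs Gs D π R) {ρ : ℕ → Q} (h0 : (π 0 (ρ 0)).isSome)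
    (hD : ∀ t, D t (ρ t) (ρ (t + 1)))
    (hacc : ∀ j, (∀ N, ∃ t ≥ N, ρ t ∈ Gs j) → ∀ N, ∃ t ≥ N, ρ t ∈ Bs j)
    {M : ℕ} (hM : ∀ t, ∀ v ∈ Nodes (π t), v.length ≤ M) :
    ∃ v T, (∀ t ≥ T, Good n k (R t) v) ∧ ∀ N, ∃ t ≥ N, Green (R t) v := by
  by_contra hcon
  have alive : ∀ t, ∃ p, π t (ρ t) = some p := by
    intro t
    induction t with
    | zero => exact Option.isSome_iff_exists.1 h0
    | succ t ih =>
      obtain ⟨p, hp⟩ := ih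
      obtain ⟨p1, h1, -⟩ := (S.raw t).s2 _ _ _ (hD t) hp
      rw [S.nxt]
      exact ⟨_, by simp [norm, R3, h1]; rfl⟩
  have base : Cl n k Bs Gs π R ρ [] 0 := by
    intro t _
    obtain ⟨p, hp⟩ := alive t
    obtain ⟨p1, h1, -⟩ := (S.raw t).s2 _ _ _ (hD t) hp
    exact ⟨⟨⟨ρ (t + 1), _, by simp [R3, h1]; rfl, List.nil_prefix⟩, by simp [nu]⟩,
      ⟨p, hp, List.nil_prefix⟩, by simp⟩
  have all : ∀ L, ∃ v T, v.length = L ∧ Cl n k Bs Gs π R ρ v T := by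
    intro L
    induction L with
    | zero => exact ⟨[], 0, rfl, base⟩
    | succ L ih =>
      obtain ⟨v, T, h1, h2⟩ := ih
      have : ∃ N, ∀ t ≥ N, ¬ Green (R t) v := by
        by_contra h3
        push Not at h3
        exact hcon ⟨v, T, fun t ht => (h2 t ht).1, h3⟩
      obtain ⟨N, hN⟩ := this
      obtain ⟨e, T', h4⟩ := S.step hD hacc (T := max T N) (fun t ht => h2 t (by omega))
        (fun t ht => hN t (by omega))
      exact ⟨_, T', by simp [h1], h4⟩
  obtain ⟨v, T, h1, h2⟩ := all (M + 1)
  obtain ⟨-, ⟨p, h3, h4⟩, -⟩ := h2 T le_rfl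
  have := hM T v ⟨_, p, h3, h4⟩
  omega

end fin

section rabin
variable {Q : Type}

lemma inf_iff {S : Type} [Finite S] (ρ : ℕ → S) (X : Set S) :
    (InfStates ρ ∩ X).Nonempty ↔ ∀ N, ∃ t ≥ N, ρ t ∈ X := by
  constructor
  · rintro ⟨q, h1, h2⟩ N
    obtain ⟨m, h3, h4⟩ := h1 N
    exact ⟨m, h3, by rw [h4]; exact h2⟩
  · intro h
    obtain ⟨q, h1, h2⟩ := unif (P := fun q => q ∈ X) (F := fun N q => ∃ m, N ≤ m ∧ ρ m = q)
      (fun a b q hab ⟨m, h1, h2⟩ => ⟨m, hab.trans h1, h2⟩) (fun N => by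
        obtain ⟨t, h1, h2⟩ := h N
        exact ⟨ρ t, h2, t, h1, rfl⟩)
    exact ⟨q, h2, h1⟩

noncomputable def flag (n k : ℕ) (R : Q → Option Pth) : Flg n k := fun x =>
  (decide (∃ v, name k v = (x.1.val, x.2.val) ∧ Good n k R v),
   decide (∃ v, name k v = (x.1.val, x.2.val) ∧ Good n k R v ∧ Green R v))

variable {n k : ℕ} {Bs Gs : ℕ → Set Q} {D : ℕ → Q → Q → Prop} {π R : ℕ → Q → Option Pth}

lemma name_eq {N : Set Pth} (hN : ∀ u e, u ++ [e] ∈ N → u ∈ N) (h : Pre n k N)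
    {v w : Pth} (hv : v ∈ N) (hw : w ∈ N) (he : name k v = name k w) : v = w := by
  simp only [name, Prod.mk.injEq] at he
  exact name_inj hN h v w hv hw he.1 he.2

lemma Sys.rabin (S : Sys n k Bs Gs D π R) :
    (∃ v T, (∀ t ≥ T, Good n k (R t) v) ∧ ∀ N, ∃ t ≥ N, Green (R t) v) ↔
    ∃ x : Fin n × Fin (k + 1), (∀ N, ∃ t ≥ N, (flag n k (R t) x).2 = true) ∧
      ∃ T, ∀ t ≥ T, (flag n k (R t) x).1 = true := by
  constructor
  · rintro ⟨v, T, h1, h2⟩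
    have hb := (S.V' T).bucket_lt S.hn v (h1 T le_rfl).mem
    refine ⟨(⟨bucket v, hb⟩, ⟨(hope k v).card, Nat.lt_succ_of_le (hope_card_le k v)⟩), ?_, T, ?_⟩
    · intro N
      obtain ⟨t, h3, h4⟩ := h2 (max N T)
      exact ⟨t, by omega, by
        simp only [flag, decide_eq_true_eq]
        exact ⟨v, rfl, h1 t (by omega), h4⟩⟩
    · intro t ht
      simp only [flag, decide_eq_true_eq]
      exact ⟨v, rfl, h1 t ht⟩
  · rintro ⟨x, h1, T, h2⟩
    simp only [flag, decide_eq_true_eq] at h1 h2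
    obtain ⟨v, hv, hgv⟩ := h2 T le_rfl
    have all : ∀ d, Good n k (R (T + d)) v := by
      intro d
      induction d with
      | zero => exact hgv
      | succ d ih =>
        obtain ⟨w, hw, hgw⟩ := h2 (T + (d + 1)) (by omega)
        have h3 : v ∈ Nodes (π (T + (d + 1))) := by
          have := ih.mem
          rwa [← S.nxt] at this
        have h4 := good_old (S.raw _) (S.V _) (S.V' _) hgw
        have := name_eq (nodes_snoc _) (S.V _).pre h3 h4 (hv.trans hw.symm)
        subst this
        exact hgw
    have all' : ∀ t ≥ T, Good n k (R t) v := by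
      intro t ht
      have := all (t - T)
      rwa [show T + (t - T) = t by omega] at this
    refine ⟨v, T, all', fun N => ?_⟩
    obtain ⟨t, ht, w, hw, hgw, hgr⟩ := h1 (max N T)
    have := name_eq (nodes_snoc _) (S.V' t).pre (all' t (by omega)).mem hgw.mem (hv.trans hw.symm)
    subst this
    exact ⟨t, by omega, hgr⟩

noncomputable def rw' [Finite Q] (n k : ℕ) (Bs Gs : ℕ → Set Q) (D : Q → Q → Prop)
    (π : Q → Option Pth) : Q → Option Pth := (raw_exists n k Bs Gs D π).choose

lemma rw'_spec [Finite Q] (n k : ℕ) (Bs Gs : ℕ → Set Q) (D : Q → Q → Prop)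
    (π : Q → Option Pth) : RawSpec n k Bs Gs D π (rw' n k Bs Gs D π) :=
  (raw_exists n k Bs Gs D π).choose_spec

def Lb {k : ℕ} (B : Fin k → Set Q) (j : ℕ) : Set Q := {q | ∃ i : Fin k, i.val + 1 = j ∧ q ∈ B i}

lemma core {α : Type} [Fintype Q] (hQ : Fintype.card Q = n) (hn : 1 ≤ n) (hk : 1 ≤ k)
    (Q₀ : Set Q) (Δ : Q → α → Q → Prop) (G B : Fin k → Set Q) :
    ∃ (s0 : St n k Q) (dl : St n k Q → α → St n k Q), ∀ (w : ℕ → α) (s : ℕ → St n k Q),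
      s 0 = s0 → (∀ t, s (t + 1) = dl (s t) (w t)) →
      ((∃ ρ : ℕ → Q, ρ 0 ∈ Q₀ ∧ (∀ t, Δ (ρ t) (w t) (ρ (t + 1))) ∧
        ∀ i : Fin k, (∀ N, ∃ t ≥ N, ρ t ∈ G i) → ∀ N, ∃ t ≥ N, ρ t ∈ B i) ↔
      ∃ x : Fin n × Fin (k + 1), (∀ N, ∃ t ≥ N, ((s t).1.2 x).2 = true) ∧
        ∃ T, ∀ t ≥ T, ((s t).1.2 x).1 = true) := by
  let R0 : Q → Option Pth := fun q => if q ∈ Q₀ then some [] else none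
  have hN0 : ∀ v ∈ Nodes R0, v = [] := by
    rintro v ⟨q, p, h1, h2⟩
    simp only [R0] at h1
    split at h1
    · obtain rfl := Option.some.inj h1
      simpa using h2
    · simp at h1
  have hnot : ∀ u e, u ++ [e] ∉ Nodes R0 := fun u e h => by simpa using hN0 _ h
  have hP0 : Pre n k (Nodes R0) :=
    ⟨fun u j c h => absurd h (hnot _ _), fun u j j' c h => absurd h (hnot _ _),
     fun u u' j j' c _ h => absurd h (hnot _ _), fun u => hnot _ _,
     fun u j c h => absurd h (hnot _ _)⟩
  refine ⟨⟨(norm n k R0, fun _ => (false, false)), norm_valid hQ hn hP0⟩,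
    fun s a => ⟨(norm n k (rw' n k (Lb B) (Lb G) (fun q q' => Δ q a q') s.1.1),
      flag n k (rw' n k (Lb B) (Lb G) (fun q q' => Δ q a q') s.1.1)),
      norm_valid hQ hn (raw_pre hn (rw'_spec n k (Lb B) (Lb G) _ _) s.2)⟩, ?_⟩
  intro w s hs0 hs
  have hfin : Finite (St n k Q) := St_finite hn
  let R : ℕ → Q → Option Pth := fun t =>
    rw' n k (Lb B) (Lb G) (fun q q' => Δ q (w t) q') (s t).1.1
  have S : Sys n k (Lb B) (Lb G) (fun t q q' => Δ q (w t) q') (fun t => (s t).1.1) R :=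
    ⟨hn, hk, fun t => (s t).2, fun t => rw'_spec n k (Lb B) (Lb G) _ _, fun t => by rw [hs t],
      by simp [Lb], by simp [Lb]⟩
  have hfl : ∀ t, (s (t + 1)).1.2 = flag n k (R t) := fun t => by rw [hs t]
  have hsome : ∀ q, ((s 0).1.1 q).isSome ↔ q ∈ Q₀ := by
    intro q
    rw [hs0]
    by_cases h : q ∈ Q₀ <;> simp [norm, R3, R0, h]
  obtain ⟨M, hM⟩ : ∃ M, ∀ t, ∀ v ∈ Nodes (s t).1.1, v.length ≤ M := by
    obtain ⟨M, hM⟩ := (Set.finite_range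
      (fun x : St n k Q × Q => ((x.1.1.1 x.2).getD []).length)).bddAbove
    refine ⟨M, ?_⟩
    rintro t v ⟨q, p, h1, h2⟩
    have := hM ⟨(s t, q), rfl⟩
    simp only [h1, Option.getD_some] at this
    exact h2.length_le.trans this
  have hrab : (∃ x : Fin n × Fin (k + 1), (∀ N, ∃ t ≥ N, ((s t).1.2 x).2 = true) ∧
        ∃ T, ∀ t ≥ T, ((s t).1.2 x).1 = true) ↔
      ∃ x : Fin n × Fin (k + 1), (∀ N, ∃ t ≥ N, (flag n k (R t) x).2 = true) ∧
      ∃ T, ∀ t ≥ T, (flag n k (R t) x).1 = true := by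
    apply exists_congr
    intro x
    apply and_congr
    · constructor
      · intro h N
        obtain ⟨t, h1, h2⟩ := h (N + 1)
        obtain ⟨t, rfl⟩ : ∃ t', t = t' + 1 := ⟨t - 1, by omega⟩
        rw [hfl] at h2
        exact ⟨t, by omega, h2⟩
      · intro h N
        obtain ⟨t, h1, h2⟩ := h N
        rw [← hfl] at h2
        exact ⟨t + 1, by omega, h2⟩
    · constructor
      · rintro ⟨T, h⟩
        refine ⟨T, fun t ht => ?_⟩
        rw [← hfl]
        exact h (t + 1) (by omega)
      · rintro ⟨T, h⟩
        refine ⟨T + 1, fun t ht => ?_⟩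
        obtain ⟨t, rfl⟩ : ∃ t', t = t' + 1 := ⟨t - 1, by omega⟩
        rw [hfl]
        exact h t (by omega)
  rw [hrab, ← S.rabin]
  constructor
  · rintro ⟨ρ, h1, h2, h3⟩
    refine S.completeness ((hsome _).2 h1) h2 ?_ hM
    intro j hj
    obtain ⟨t, -, i, rfl, -⟩ := hj 0
    have h4 := h3 i (fun N => by
      obtain ⟨t, ht, i', h5, h6⟩ := hj N
      obtain rfl : i' = i := Fin.ext (by omega)
      exact ⟨t, ht, h6⟩)
    intro N
    obtain ⟨t, ht, h5⟩ := h4 N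
    exact ⟨t, ht, i, rfl, h5⟩
  · rintro ⟨v, T, h1, h2⟩
    obtain ⟨ρ, h3, h4, h5⟩ := S.soundness h1 h2
    refine ⟨ρ, (hsome _).1 h3, h4, fun i hi N => ?_⟩
    have h6 := h5 (i.val + 1) (by omega) (by omega) (fun N => by
      obtain ⟨t, ht, h⟩ := hi N
      exact ⟨t, ht, i, rfl, h⟩) N
    obtain ⟨t, ht, i', h7, h8⟩ := h6
    obtain rfl : i' = i := Fin.ext (by omega)
    exact ⟨t, ht, h8⟩

end rabin
end SD

/-- Streett determinization for small index size `k ≤ n`, asymptotic form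
`2^{O(n log n + nk log k)}`: there is a constant `c > 0` such that every
nondeterministic Streett automaton with `n ≥ 1` states and index size
`1 ≤ k ≤ n` has an equivalent deterministic Rabin automaton with at most
`2^{c·(n·log₂(n+1) + n·k·log₂(k+1))}` states and index size at most
`n·(k+1)`. -/
theorem streett_determinization_small_index :
    ∃ c : ℝ, 0 < c ∧ ∀ (α Q : Type) (_ : Fintype α) (_ : Nonempty α) (_ : Fintype Q)
      (n k : ℕ), Fintype.card Q = n → 1 ≤ n → 1 ≤ k → k ≤ n →
      ∀ (Q₀ : Set Q) (Δ : Q → α → Q → Prop) (G B : Fin k → Set Q),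
      ∃ (m kB : ℕ) (init : Fin m) (δ : Fin m → α → Fin m)
        (G' B' : Fin kB → Set (Fin m)),
        (m : ℝ) ≤ (2 : ℝ) ^ (c * ((n : ℝ) * Real.logb 2 ((n : ℝ) + 1) +
          (n : ℝ) * (k : ℝ) * Real.logb 2 ((k : ℝ) + 1))) ∧
        kB ≤ n * (k + 1) ∧
        ∀ w : ℕ → α,
          (∃ ρ : ℕ → Q, ρ 0 ∈ Q₀ ∧ (∀ i : ℕ, Δ (ρ i) (w i) (ρ (i + 1))) ∧
            ∀ i : Fin k, (InfStates ρ ∩ G i).Nonempty → (InfStates ρ ∩ B i).Nonempty) ↔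
          (∃ ρ : ℕ → Fin m, ρ 0 = init ∧ (∀ i : ℕ, ρ (i + 1) = δ (ρ i) (w i)) ∧
            ∃ i : Fin kB, (InfStates ρ ∩ G' i).Nonempty ∧ InfStates ρ ∩ B' i = ∅) := by
  refine ⟨16, by norm_num, ?_⟩
  intro α Q _ _ _ n k hQ hn hk hkn Q₀ Δ G B
  obtain ⟨s0, dl, hcore⟩ := SD.core hQ hn hk Q₀ Δ G B
  have hfin : Finite (SD.St n k Q) := SD.St_finite hn
  let e : SD.St n k Q ≃ Fin (Nat.card (SD.St n k Q)) := Finite.equivFin _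
  refine ⟨Nat.card (SD.St n k Q), n * (k + 1), e s0, fun m a => e (dl (e.symm m) a),
    fun i => {m | ((e.symm m).1.2 (finProdFinEquiv.symm i)).2 = true},
    fun i => {m | ((e.symm m).1.2 (finProdFinEquiv.symm i)).1 = false},
    SD.real_bound (SD.St_card hQ hn hk hkn), le_rfl, ?_⟩
  intro w
  simp only [← Set.not_nonempty_iff_eq_empty, SD.inf_iff, Set.mem_setOf_eq]
  have hB : ∀ (ρ : ℕ → Fin (Nat.card (SD.St n k Q))) (x : Fin n × Fin (k + 1)),
      (¬ ∀ N, ∃ t ≥ N, ((e.symm (ρ t)).1.2 x).1 = false) ↔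
      ∃ T, ∀ t ≥ T, ((e.symm (ρ t)).1.2 x).1 = true := by
    intro ρ x
    push Not
    simp only [Bool.not_eq_false, ne_eq]
  simp only [hB]
  constructor
  · intro h
    let s : ℕ → SD.St n k Q := fun t => Nat.rec s0 (fun t s => dl s (w t)) t
    obtain ⟨x, h1, h2⟩ := (hcore w s rfl (fun t => rfl)).1 h
    refine ⟨fun t => e (s t), rfl, fun t => ?_, finProdFinEquiv x, ?_⟩
    · simp only [Equiv.symm_apply_apply]
      rfl
    · simp only [Equiv.symm_apply_apply]
      exact ⟨h1, h2⟩
  · rintro ⟨ρ, h1, h2, i, h3, h4⟩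
    refine (hcore w (fun t => e.symm (ρ t)) ?_ ?_).2 ⟨finProdFinEquiv.symm i, h3, h4⟩
    · simp [h1]
    · intro t
      simp [h2]
end
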